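/- For any early stopping point δ ∈ (0, 1/2) and any accuracy level ε with 0 < ε ≤ 1/√d, there exist T > 0 and discretization points 0 = t_0 < t_1 < ⋯ < t_K = T − δ with K ≤ C d^{3/2} (ε δ)^{-1} · L, where L is polylogarithmic in d, 1/ε and 1/δ, such that whenever the score estimates satisfy the score-estimation assumption for this discretization with errors ε_k, the output distribution of the stochastic Runge–Kutta diffusion sampler satisfies KL(q_δ ‖ p_output) ≤ C ( ε² + ε³ d^{5/2} δ^{-1} + Σ_{k=0}^{K-1} d^{1/2} ε_k^{1/2} ) for a universal constant C > 0. -/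

import Mathlib

/- Stochastic Runge–Kutta diffusion sampler: main convergence theorem (Theorem 3.1).

   Setup: `stdGaussian d` is the standard Gaussian N(0, I_d) on ℝ^d,
   `forwardLaw q0 u` is the law q_u of e^{-u} θ + √(1-e^{-2u}) g with θ ~ q0, g ~ N(0,I_d),
   `klDiv'` is the Kullback–Leibler divergence,
   `samplerLaw init step k` is the law of the k-th iterate of the Markov chain
   Ŷ_{k+1} = step k Ŷ_k (g_{k,1}, g_{k,2}) with fresh independent standard Gaussians,
   and `rkStep` is the stochastic Runge–Kutta update. -/

open MeasureTheory ProbabilityTheory Real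

noncomputable section

abbrev Vec (d : ℕ) := EuclideanSpace ℝ (Fin d)

def stdGaussian (d : ℕ) : Measure (Vec d) :=
  Measure.map (⇑(EuclideanSpace.equiv (Fin d) ℝ).symm)
    (Measure.pi fun _ : Fin d => gaussianReal 0 1)

def forwardLaw {d : ℕ} (q0 : Measure (Vec d)) (u : ℝ) : Measure (Vec d) :=
  Measure.map (fun p : Vec d × Vec d =>
      Real.exp (-u) • p.1 + Real.sqrt (1 - Real.exp (-2*u)) • p.2)
    (q0.prod (stdGaussian d))

def klDiv' {α : Type*} [MeasurableSpace α] (μ ν : Measure α) : ℝ :=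
  ∫ x, Real.log ((μ.rnDeriv ν x).toReal) ∂μ

def f1 (Δ : ℝ) : ℝ := Real.exp (2*Δ)/2 - 2*Real.exp Δ + Δ + 3/2
def f2 (Δ : ℝ) : ℝ := Real.exp (2*Δ)/2 - 1/2
def f3 (Δ : ℝ) : ℝ := Real.exp (2*Δ)/2 - Real.exp Δ + 1/2
def zeta1 (Δ : ℝ) : ℝ := 2 * Real.sqrt 2 * Real.sqrt (f1 Δ) / (Real.exp Δ - Real.exp (-Δ))
def zeta2 (Δ : ℝ) : ℝ := Real.sqrt 2 * f3 Δ / Real.sqrt (f1 Δ)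
def zeta3 (Δ : ℝ) : ℝ := Real.sqrt (2 * f2 Δ - 2 * (f3 Δ)^2 / f1 Δ)

/-- One step of the stochastic Runge–Kutta sampler with step size `Δ` and score estimate `shat`. -/
def rkStep {d : ℕ} (Δ : ℝ) (shat : Vec d → Vec d) (y : Vec d) (g : Vec d × Vec d) : Vec d :=
  Real.exp Δ • y + (Real.exp Δ - Real.exp (-Δ)) • shat (y + zeta1 Δ • g.1)
    + zeta2 Δ • g.1 + zeta3 Δ • g.2

/-- Law of the `k`-th iterate of the sampler Markov chain driven by two fresh independent
standard Gaussians per step. -/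
def samplerLaw {d : ℕ} (init : Measure (Vec d))
    (step : ℕ → Vec d → Vec d × Vec d → Vec d) : ℕ → Measure (Vec d)
  | 0 => init
  | k + 1 => Measure.map (fun p : Vec d × (Vec d × Vec d) => step k p.1 p.2)
      ((samplerLaw init step k).prod ((stdGaussian d).prod (stdGaussian d)))

/-- The true score `s(u, x) = ∇_x log q_{T-u}(x)`, expressed through the density `ρ` of the
forward process. -/
def score {d : ℕ} (ρ : ℝ → Vec d → ℝ) (T u : ℝ) (x : Vec d) : Vec d :=
  gradient (fun y => Real.log (ρ (T - u) y)) x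

section Helpers

open scoped ENNReal RealInnerProductSpace

variable {d : ℕ}

lemma stdGaussian_eq_stdGaussian : _root_.stdGaussian d
    = ProbabilityTheory.stdGaussian (Vec d) := by
  rw [← map_pi_eq_stdGaussian]; rfl

instance : IsProbabilityMeasure (_root_.stdGaussian d) := by
  rw [stdGaussian_eq_stdGaussian]; infer_instance

lemma charFun_stdGaussian_vec (t : Vec d) :
    charFun (_root_.stdGaussian d) t = Complex.exp (-‖t‖ ^ 2 / 2) := by
  rw [stdGaussian_eq_stdGaussian, ProbabilityTheory.charFun_stdGaussian]

lemma integral_cexp_prod_stdGaussian (s t : Vec d) :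
    ∫ p : Vec d × Vec d, Complex.exp (((⟪p.1, s⟫ + ⟪p.2, t⟫ : ℝ) : ℂ) * Complex.I)
      ∂((_root_.stdGaussian d).prod (_root_.stdGaussian d))
      = Complex.exp (-((‖s‖ ^ 2 + ‖t‖ ^ 2 : ℝ) : ℂ) / 2) := by
  have h1 : ∀ p : Vec d × Vec d, Complex.exp (((⟪p.1, s⟫ + ⟪p.2, t⟫ : ℝ) : ℂ) * Complex.I)
      = Complex.exp ((⟪p.1, s⟫ : ℝ) * Complex.I) * Complex.exp ((⟪p.2, t⟫ : ℝ) * Complex.I) := by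
    intro p
    rw [← Complex.exp_add]; push_cast; ring_nf
  simp_rw [h1]
  rw [integral_prod_mul (fun x : Vec d => Complex.exp ((⟪x, s⟫ : ℝ) * Complex.I))
    (fun x : Vec d => Complex.exp ((⟪x, t⟫ : ℝ) * Complex.I)), ← charFun_apply, ← charFun_apply,
    charFun_stdGaussian_vec, charFun_stdGaussian_vec, ← Complex.exp_add]
  push_cast; ring_nf

/-- Invariance of a pair of independent standard Gaussians under a reflection. -/
lemma map_reflection_stdGaussian {α β : ℝ} (h : α ^ 2 + β ^ 2 = 1) :
    ((_root_.stdGaussian d).prod (_root_.stdGaussian d)).map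
      (fun p : Vec d × Vec d => (α • p.1 + β • p.2, β • p.1 - α • p.2))
      = (_root_.stdGaussian d).prod (_root_.stdGaussian d) := by
  rw [← charFun_eq_prod_iff]
  intro t
  rw [Measure.map_map (by fun_prop) (by fun_prop), charFun_apply,
    integral_map (by fun_prop) (by fun_prop)]
  have h1 : ∀ p : Vec d × Vec d, ((⟪(WithLp.toLp 2 ∘ fun p : Vec d × Vec d =>
      (α • p.1 + β • p.2, β • p.1 - α • p.2)) p, t⟫ : ℝ)) =
      ⟪p.1, α • t.ofLp.1 + β • t.ofLp.2⟫ + ⟪p.2, β • t.ofLp.1 - α • t.ofLp.2⟫ := by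
    intro p
    simp only [Function.comp, WithLp.prod_inner_apply, inner_add_left, inner_sub_left,
      inner_add_right, inner_sub_right, inner_smul_left, inner_smul_right, conj_trivial]
    ring
  simp_rw [h1]
  rw [integral_cexp_prod_stdGaussian, charFun_stdGaussian_vec, charFun_stdGaussian_vec,
    ← Complex.exp_add]
  congr 1
  have h2 : ‖α • t.ofLp.1 + β • t.ofLp.2‖ ^ 2 + ‖β • t.ofLp.1 - α • t.ofLp.2‖ ^ 2 =
     ‖(WithLp.ofLp t).1‖ ^ 2 + ‖(WithLp.ofLp t).2‖ ^ 2 := by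
    rw [norm_add_sq_real, norm_sub_sq_real]
    simp only [norm_smul, inner_smul_left, inner_smul_right, conj_trivial, mul_pow,
      Real.norm_eq_abs, sq_abs]
    linear_combination (‖(WithLp.ofLp t).1‖ ^ 2 + ‖(WithLp.ofLp t).2‖ ^ 2) * h
  rw [h2]; push_cast; ring

lemma map_add_stdGaussian (a b : ℝ) :
    ((_root_.stdGaussian d).prod (_root_.stdGaussian d)).map
      (fun p : Vec d × Vec d => a • p.1 + b • p.2)
      = (_root_.stdGaussian d).map (fun x => √(a ^ 2 + b ^ 2) • x) := by
  have : IsFiniteMeasure ((_root_.stdGaussian d).map (fun x : Vec d => √(a ^ 2 + b ^ 2) • x)) :=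
    inferInstance
  apply Measure.ext_of_charFun
  ext t
  rw [charFun_apply, integral_map (by fun_prop) (by fun_prop), charFun_map_smul,
    charFun_stdGaussian_vec]
  have h1 : ∀ p : Vec d × Vec d, (⟪a • p.1 + b • p.2, t⟫ : ℝ) = ⟪p.1, a • t⟫ + ⟪p.2, b • t⟫ := by
    intro p
    simp only [inner_add_left, inner_smul_left, inner_smul_right, conj_trivial]
  simp_rw [h1]
  rw [integral_cexp_prod_stdGaussian]
  have h2 : ‖a • t‖ ^ 2 + ‖b • t‖ ^ 2 = ‖√(a ^ 2 + b ^ 2) • t‖ ^ 2 := by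
    simp only [norm_smul, mul_pow, Real.norm_eq_abs, sq_abs]
    rw [Real.sq_sqrt (by positivity)]; ring
  rw [h2]; push_cast; ring_nf

lemma map_inner_stdGaussian (w : Vec d) :
    (_root_.stdGaussian d).map (fun x => ⟪w, x⟫) = (gaussianReal 0 1).map (fun t => ‖w‖ * t) := by
  apply Measure.ext_of_charFun
  ext t
  rw [charFun_apply, integral_map (by fun_prop) (by fun_prop), charFun_map_mul,
    charFun_gaussianReal]
  have h1 : ∀ x : Vec d, (⟪⟪w, x⟫, t⟫ : ℝ) = ⟪x, t • w⟫ := by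
    intro x; rw [inner_smul_right, real_inner_comm w x]; simp
  simp_rw [h1]
  rw [← charFun_apply, charFun_stdGaussian_vec, norm_smul]
  congr 1
  simp only [mul_pow, Real.norm_eq_abs, Complex.ofReal_mul, ← Complex.ofReal_pow, sq_abs]
  simp; ring

/-- The Lebesgue density of the standard Gaussian. -/
def gaussDensity (d : ℕ) (x : Vec d) : ℝ := (2 * Real.pi) ^ (-(d : ℝ) / 2) * Real.exp (-‖x‖ ^ 2 / 2)

lemma gaussDensity_pos (x : Vec d) : 0 < gaussDensity d x := by
  unfold gaussDensity; positivity

lemma continuous_gaussDensity : Continuous (gaussDensity d) := by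
  unfold gaussDensity; fun_prop

lemma integrable_gaussDensity : Integrable (gaussDensity d) := by
  unfold gaussDensity
  apply Integrable.const_mul
  have := GaussianFourier.integrable_cexp_neg_mul_sq_norm_add (V := Vec d) (b := 1 / 2)
      (by norm_num) 0 0
  refine this.re.congr ?_
  filter_upwards with x
  simp
  rw [show -(2⁻¹ * (‖x‖:ℂ) ^ 2) = ((-‖x‖ ^ 2 / 2 : ℝ) : ℂ) by push_cast; ring,
      Complex.exp_ofReal_re]

lemma stdGaussian_eq_withDensity :
    _root_.stdGaussian d = volume.withDensity (fun x => ENNReal.ofReal (gaussDensity d x)) := by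
  have hf : IsFiniteMeasure (volume.withDensity (fun x : Vec d => ENNReal.ofReal
      (gaussDensity d x))) :=
    isFiniteMeasure_withDensity_ofReal integrable_gaussDensity.2
  apply Measure.ext_of_charFun
  ext t
  rw [charFun_stdGaussian_vec, charFun_apply, integral_withDensity_eq_integral_toReal_smul
    (by have := (continuous_gaussDensity (d := d)).measurable; fun_prop) (by simp)]
  simp_rw [ENNReal.toReal_ofReal (gaussDensity_pos _).le]
  have h1 : ∀ x : Vec d, gaussDensity d x • Complex.exp ((⟪x, t⟫ : ℝ) * Complex.I) =
     ((2 * Real.pi) ^ (-(d : ℝ) / 2) : ℝ) *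
      Complex.exp (-(1 / 2 : ℂ) * ‖x‖ ^ 2 + Complex.I * (⟪t, x⟫ : ℝ)) := by
    intro x
    unfold gaussDensity
    rw [Complex.exp_add, real_inner_comm, Complex.real_smul]
    push_cast
    rw [mul_assoc]
    congr 2
    · congr 1; ring
    · ring_nf
  simp_rw [h1]
  rw [integral_const_mul, GaussianFourier.integral_cexp_neg_mul_sq_norm_add (by norm_num)]
  have h2 : ((Real.pi : ℂ) / (1 / 2)) ^ ((Module.finrank ℝ (Vec d) : ℂ) / 2)
      = (((2 * Real.pi) ^ ((d : ℝ) / 2) : ℝ) : ℂ) := by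
    rw [Complex.ofReal_cpow (by positivity)]
    simp; ring_nf
  rw [h2, ← mul_assoc, ← Complex.ofReal_mul, ← Real.rpow_add (by positivity),
    show -(d : ℝ) / 2 + d / 2 = 0 by ring, Real.rpow_zero]
  simp
  ring_nf

/-- Cameron–Martin formula. -/
lemma lintegral_stdGaussian_add (w : Vec d) {f : Vec d → ℝ≥0∞} (hf : Measurable f) :
    ∫⁻ x, f (x + w) ∂(_root_.stdGaussian d) =
      ∫⁻ x, ENNReal.ofReal (Real.exp (⟪w, x⟫ - ‖w‖ ^ 2 / 2)) * f x ∂(_root_.stdGaussian d) := by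
  have hm := (continuous_gaussDensity (d := d)).measurable
  rw [stdGaussian_eq_withDensity, lintegral_withDensity_eq_lintegral_mul _ (by fun_prop)
      (by fun_prop),
    lintegral_withDensity_eq_lintegral_mul _ (by fun_prop) (by fun_prop)]
  rw [← lintegral_sub_right_eq_self _ w]
  refine lintegral_congr fun x => ?_
  simp only [Pi.mul_apply, sub_add_cancel, ← mul_assoc]
  rw [← ENNReal.ofReal_mul (gaussDensity_pos _).le]
  congr 2
  unfold gaussDensity
  rw [mul_assoc, ← Real.exp_add, norm_sub_sq_real, real_inner_comm]
  ring_nf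

lemma lintegral_stdGaussian_inner (w : Vec d) {f : ℝ → ℝ≥0∞} (hf : Measurable f) :
    ∫⁻ x, f ⟪w, x⟫ ∂(_root_.stdGaussian d) = ∫⁻ t, f (‖w‖ * t) ∂(gaussianReal 0 1) := by
  rw [← lintegral_map (f := f) (g := fun x : Vec d => ⟪w, x⟫) hf (by fun_prop),
      map_inner_stdGaussian,
    lintegral_map hf (by fun_prop)]

lemma lintegral_exp_inner_stdGaussian (w : Vec d) :
    ∫⁻ x, ENNReal.ofReal (Real.exp ⟪w, x⟫) ∂(_root_.stdGaussian d)
      = ENNReal.ofReal (Real.exp (‖w‖ ^ 2 / 2)) := by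
  have h := lintegral_stdGaussian_add w (f := fun _ => 1) measurable_const
  simp only [lintegral_const, measure_univ, mul_one] at h
  have h2 : ∀ x : Vec d, ENNReal.ofReal (Real.exp ⟪w, x⟫) =
      ENNReal.ofReal (Real.exp (‖w‖ ^ 2 / 2)) * ENNReal.ofReal
          (Real.exp (⟪w, x⟫ - ‖w‖ ^ 2 / 2)) := by
    intro x
    rw [← ENNReal.ofReal_mul (Real.exp_pos _).le, ← Real.exp_add]
    ring_nf
  simp_rw [h2]
  rw [lintegral_const_mul _ (by fun_prop), ← h, mul_one]

lemma lintegral_gaussianReal_exp_sq :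
    ∫⁻ t, ENNReal.ofReal (Real.exp (t ^ 2 / 4)) ∂(gaussianReal 0 1) ≤ 2 := by
  rw [gaussianReal_of_var_ne_zero _ one_ne_zero,
    lintegral_withDensity_eq_lintegral_mul _ (measurable_gaussianPDF _ _) (by fun_prop)]
  have h1 : ∀ t : ℝ, (gaussianPDF 0 1 * fun t => ENNReal.ofReal (Real.exp (t ^ 2 / 4))) t
      = ENNReal.ofReal ((√(2 * Real.pi))⁻¹ * Real.exp (-(1/4) * t ^ 2)) := by
    intro t
    simp only [Pi.mul_apply, gaussianPDF, gaussianPDFReal]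
    rw [← ENNReal.ofReal_mul (by positivity), mul_assoc, ← Real.exp_add]
    simp
    ring_nf
  simp_rw [h1]
  rw [← ofReal_integral_eq_lintegral_ofReal
    ((integrable_exp_neg_mul_sq (by norm_num)).const_mul _) (by filter_upwards with x; positivity),
    integral_const_mul, integral_gaussian]
  rw [show (2 : ℝ≥0∞) = ENNReal.ofReal 2 by simp]
  apply ENNReal.ofReal_le_ofReal
  rw [← Real.sqrt_inv, ← Real.sqrt_mul (by positivity)]
  apply Real.sqrt_le_iff.2 ⟨by norm_num, ?_⟩
  field_simp
  norm_num

lemma lintegral_exp_norm_sq_stdGaussian (hd : 1 ≤ d) :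
    ∫⁻ x, ENNReal.ofReal (Real.exp (‖x‖ ^ 2 / (4 * d))) ∂(_root_.stdGaussian d) ≤ 2 := by
  have hd' : (0 : ℝ) < d := by exact_mod_cast hd
  have h1 : ∀ x : Vec d, ENNReal.ofReal (Real.exp (‖x‖ ^ 2 / (4 * d))) ≤
      ENNReal.ofReal (1 / d) * ∑ i : Fin d,
        ENNReal.ofReal (Real.exp (⟪EuclideanSpace.single i (1 : ℝ), x⟫ ^ 2 / 4)) := by
    intro x
    rw [← ENNReal.ofReal_sum_of_nonneg (fun i _ => (Real.exp_pos _).le),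
      ← ENNReal.ofReal_mul (by positivity)]
    apply ENNReal.ofReal_le_ofReal
    have := convexOn_exp.map_sum_le (t := Finset.univ) (w := fun _ : Fin d => 1 / (d : ℝ))
      (p := fun i => x i ^ 2 / 4) (fun _ _ => by positivity) (by simp; field_simp) (by simp)
    simp only [smul_eq_mul, ← Finset.mul_sum] at this
    refine le_trans (le_of_eq ?_) (this.trans (le_of_eq ?_))
    · congr 1
      rw [EuclideanSpace.norm_sq_eq]
      simp only [Real.norm_eq_abs, sq_abs, ← Finset.sum_div]
      field_simp
    · simp [EuclideanSpace.inner_single_left]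
  refine (lintegral_mono h1).trans ?_
  rw [lintegral_const_mul _ (by fun_prop), lintegral_finsetSum _ (fun i _ => by fun_prop)]
  have h2 : ∀ i : Fin d, ∫⁻ x : Vec d, ENNReal.ofReal
      (Real.exp (⟪EuclideanSpace.single i (1 : ℝ), x⟫ ^ 2 / 4)) ∂(_root_.stdGaussian d) ≤ 2 := by
    intro i
    rw [lintegral_stdGaussian_inner _ (f := fun t => ENNReal.ofReal (Real.exp (t ^ 2 / 4)))
        (by fun_prop)]
    simpa using lintegral_gaussianReal_exp_sq
  calc _ ≤ ENNReal.ofReal (1 / d) * ∑ i : Fin d, 2 := by gcongr with i; exact h2 i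
    _ = 2 := by
      simp
      rw [← mul_assoc, ENNReal.ofReal_inv_of_pos hd']
      simp
      rw [ENNReal.inv_mul_cancel (by simp; omega) (by simp), one_mul]

section General

variable {Ω : Type*} [MeasurableSpace Ω]

/-- Jensen's inequality for powers of nonnegative functions. -/
lemma lintegral_rpow_le_of_isProbabilityMeasure (μ : Measure Ω) [IsProbabilityMeasure μ]
    {f : Ω → ℝ≥0∞} (hf : AEMeasurable f μ) {r : ℝ} (hr : 1 ≤ r) :
    (∫⁻ x, f x ∂μ) ^ r ≤ ∫⁻ x, f x ^ r ∂μ := by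
  rcases hr.eq_or_lt with rfl | hr
  · simp
  have h := ENNReal.lintegral_mul_le_Lp_mul_Lq μ (Real.HolderConjugate.conjExponent hr) hf
    (g := fun _ => 1) aemeasurable_const
  simp only [Pi.mul_apply, mul_one, ENNReal.one_rpow, lintegral_const, measure_univ] at h
  calc _ ≤ ((∫⁻ x, f x ^ r ∂μ) ^ (1 / r)) ^ r := by gcongr
    _ = _ := by rw [← ENNReal.rpow_mul, one_div_mul_cancel (by positivity), ENNReal.rpow_one]

lemma lintegral_pow_le_of_isProbabilityMeasure (μ : Measure Ω) [IsProbabilityMeasure μ]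
    {f : Ω → ℝ≥0∞} (hf : AEMeasurable f μ) {n : ℕ} (hn : 1 ≤ n) :
    (∫⁻ x, f x ∂μ) ^ n ≤ ∫⁻ x, f x ^ n ∂μ := by
  have := lintegral_rpow_le_of_isProbabilityMeasure μ hf (r := n) (by exact_mod_cast hn)
  simpa using this

/-- Jensen's inequality for concave powers. -/
lemma lintegral_rpow_le_rpow_lintegral (μ : Measure Ω) [IsProbabilityMeasure μ]
    {f : Ω → ℝ≥0∞} (hf : AEMeasurable f μ) {r : ℝ} (hr0 : 0 < r) (hr : r ≤ 1) :
    ∫⁻ x, f x ^ r ∂μ ≤ (∫⁻ x, f x ∂μ) ^ r := by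
  have := lintegral_rpow_le_of_isProbabilityMeasure μ (hf.pow_const r) (r := 1 / r)
    (by rw [le_div_iff₀ hr0]; linarith)
  simp only [← ENNReal.rpow_mul, mul_one_div_cancel hr0.ne', ENNReal.rpow_one] at this
  calc _ = ((∫⁻ x, f x ^ r ∂μ) ^ (1 / r)) ^ r := by
        rw [← ENNReal.rpow_mul, one_div_mul_cancel hr0.ne', ENNReal.rpow_one]
    _ ≤ _ := by gcongr

lemma lintegral_mul_le_sqrt_mul_sqrt (μ : Measure Ω) {f g : Ω → ℝ≥0∞} (hf : AEMeasurable f μ)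
    (hg : AEMeasurable g μ) :
    ∫⁻ x, f x * g x ∂μ ≤ (∫⁻ x, f x ^ 2 ∂μ) ^ (1 / 2 : ℝ) * (∫⁻ x, g x ^ 2 ∂μ) ^ (1 / 2 : ℝ) := by
  have h := ENNReal.lintegral_mul_le_Lp_mul_Lq μ (Real.HolderConjugate.two_two) hf hg
  simpa using h

lemma inv_lintegral_sq_le (μ : Measure Ω) [IsProbabilityMeasure μ] {f : Ω → ℝ≥0∞}
    (hf : AEMeasurable f μ) (h0 : ∀ x, f x ≠ 0) (ht : ∀ x, f x ≠ ∞) :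
    ((∫⁻ x, f x ∂μ)⁻¹) ^ 2 ≤ ∫⁻ x, (f x)⁻¹ ^ 2 ∂μ := by
  have h1 : (1 : ℝ≥0∞) ≤ (∫⁻ x, f x ∂μ) ^ (1 / 2 : ℝ) * (∫⁻ x, (f x)⁻¹ ∂μ) ^ (1 / 2 : ℝ) := by
    have h := lintegral_mul_le_sqrt_mul_sqrt μ (f := fun x => f x ^ (1 / 2 : ℝ))
      (g := fun x => (f x)⁻¹ ^ (1 / 2 : ℝ)) (hf.pow_const _) (hf.inv.pow_const _)
    have e1 : ∀ x, f x ^ (1 / 2 : ℝ) * (f x)⁻¹ ^ (1 / 2 : ℝ) = 1 := by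
      intro x
      rw [← ENNReal.mul_rpow_of_nonneg _ _ (by norm_num), ENNReal.mul_inv_cancel (h0 x) (ht x),
        ENNReal.one_rpow]
    have e2 : ∀ y : ℝ≥0∞, (y ^ (1 / 2 : ℝ)) ^ 2 = y := by
      intro y
      rw [← ENNReal.rpow_natCast, ← ENNReal.rpow_mul]; norm_num
    simpa only [e1, e2, lintegral_const, measure_univ, mul_one] using h
  have h2 : (1 : ℝ≥0∞) ≤ (∫⁻ x, f x ∂μ) * ∫⁻ x, (f x)⁻¹ ∂μ := by
    rw [← ENNReal.mul_rpow_of_nonneg _ _ (by norm_num)] at h1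
    have := ENNReal.rpow_le_rpow h1 (z := 2) (by norm_num)
    rw [← ENNReal.rpow_mul] at this
    simpa using this
  have h3 : (∫⁻ x, f x ∂μ)⁻¹ ≤ ∫⁻ x, (f x)⁻¹ ∂μ := by
    rw [ENNReal.inv_le_iff_le_mul (by intro h h'; simp [h, h'] at h2)
      (by intro h h'; simp [h, h'] at h2)]
    exact h2
  exact (pow_le_pow_left' h3 2).trans
    (lintegral_pow_le_of_isProbabilityMeasure μ hf.inv (by norm_num))

lemma klFun_le_sq {x : ℝ} (hx : 0 ≤ x) : InformationTheory.klFun x ≤ (x - 1) ^ 2 := by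
  rw [InformationTheory.klFun_apply]
  rcases hx.eq_or_lt with rfl | hx
  · simp
  nlinarith [Real.log_le_sub_one_of_pos hx]

/-- The chi-square bound on the Kullback–Leibler divergence, in terms of densities. -/
lemma klDiv_withDensity_le (M : Measure Ω) {q p : Ω → ℝ≥0∞} (hq : Measurable q)
    (hp : Measurable p) [IsProbabilityMeasure M] (hq1 : ∫⁻ x, q x ∂M = 1)
    (hp1 : ∫⁻ x, p x ∂M = 1) (hp0 : ∀ x, p x ≠ 0) :
    InformationTheory.klDiv (M.withDensity q) (M.withDensity p) ≤
      ∫⁻ x, ENNReal.ofReal (((q x).toReal - (p x).toReal) ^ 2 / (p x).toReal) ∂M := by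
  have hpt : ∀ᵐ x ∂M, p x < ∞ := ae_lt_top hp (by simp [hp1])
  have hqt : ∀ᵐ x ∂M, q x < ∞ := ae_lt_top hq (by simp [hq1])
  have : IsFiniteMeasure (M.withDensity q) := isFiniteMeasure_withDensity (by simp [hq1])
  have : IsFiniteMeasure (M.withDensity p) := isFiniteMeasure_withDensity (by simp [hp1])
  have hr : Measurable (fun x => q x / p x) := hq.div hp
  have e : M.withDensity q = (M.withDensity p).withDensity (fun x => q x / p x) := by
    rw [← withDensity_mul _ hp hr]
    apply withDensity_congr_ae
    filter_upwards [hpt] with x hx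
    simp only [Pi.mul_apply]
    rw [ENNReal.mul_div_cancel (hp0 x) hx.ne]
  have hac : M.withDensity q ≪ M.withDensity p := by
    rw [e]; exact withDensity_absolutelyContinuous _ _
  rw [InformationTheory.klDiv_eq_lintegral_klFun_of_ac hac]
  have hrn : (M.withDensity q).rnDeriv (M.withDensity p) =ᵐ[M.withDensity p]
      fun x => q x / p x := by
    conv_lhs => rw [e]
    exact Measure.rnDeriv_withDensity _ hr
  have hkm := InformationTheory.measurable_klFun
  calc _ = ∫⁻ x, ENNReal.ofReal (InformationTheory.klFun (q x / p x).toReal)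
      ∂(M.withDensity p) := by
        apply lintegral_congr_ae
        filter_upwards [hrn] with x hx
        rw [hx]
    _ = ∫⁻ x, p x * ENNReal.ofReal (InformationTheory.klFun (q x / p x).toReal) ∂M := by
        rw [lintegral_withDensity_eq_lintegral_mul _ hp (by fun_prop)]; rfl
    _ ≤ _ := by
        apply lintegral_mono_ae
        filter_upwards [hpt, hqt] with x hx hx'
        have hpx : 0 < (p x).toReal := ENNReal.toReal_pos (hp0 x) hx.ne
        rw [← ENNReal.ofReal_toReal hx.ne, ENNReal.toReal_ofReal hpx.le,
          ← ENNReal.ofReal_mul hpx.le]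
        apply ENNReal.ofReal_le_ofReal
        rw [ENNReal.ofReal_toReal hx.ne, ENNReal.toReal_div]
        calc _ ≤ (p x).toReal * ((q x).toReal / (p x).toReal - 1) ^ 2 := by
              gcongr; exact klFun_le_sq (by positivity)
          _ = _ := by field_simp

variable {Ω' Ω'' : Type*} [MeasurableSpace Ω'] [MeasurableSpace Ω'']

/-- One step of the comparison of two Markov chains in Kullback–Leibler divergence. -/
lemma klDiv_map_withDensity_prod_le (Q P : Measure Ω) (G : Measure Ω') [IsProbabilityMeasure Q]
    [IsProbabilityMeasure P] [IsProbabilityMeasure G] {q p : Ω × Ω' → ℝ≥0∞} (hq : Measurable q)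
    (hp : Measurable p) (hq1 : ∀ y, ∫⁻ x, q (y, x) ∂G = 1) (hp1 : ∀ y, ∫⁻ x, p (y, x) ∂G = 1)
    (hp0 : ∀ z, p z ≠ 0) {Φ : Ω × Ω' → Ω''} (hΦ : Measurable Φ) :
    InformationTheory.klDiv (((Q.prod G).withDensity q).map Φ) (((P.prod G).withDensity p).map Φ) ≤
      InformationTheory.klDiv Q P + ∫⁻ y, ∫⁻ x, ENNReal.ofReal
        (((q (y, x)).toReal - (p (y, x)).toReal) ^ 2 / (p (y, x)).toReal) ∂G ∂Q := by
  have key : ∀ (r : Ω × Ω' → ℝ≥0∞), Measurable r → (∀ y, ∫⁻ x, r (y, x) ∂G = 1) →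
      ∃ κ : Kernel Ω Ω', IsMarkovKernel κ ∧ ∀ R : Measure Ω, IsProbabilityMeasure R →
        (R.prod G).withDensity r = R ⊗ₘ κ := by
    intro r hr hr1
    have hm : Measurable (Function.uncurry fun (y : Ω) (x : Ω') => r (y, x)) := hr
    let κ := (Kernel.const Ω G).withDensity (fun y x => r (y, x))
    have hκ : IsMarkovKernel κ := by
      refine ⟨fun y => ⟨?_⟩⟩
      rw [Kernel.withDensity_apply' _ hm]
      simpa using hr1 y
    refine ⟨κ, hκ, fun R hR => ?_⟩
    rw [Measure.compProd_withDensity hm, Measure.compProd_const]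
  obtain ⟨κ, hκ, h1⟩ := key q hq hq1
  obtain ⟨η, hη, h2⟩ := key p hp hp1
  have h_int : ∀ r : Ω × Ω' → ℝ≥0∞, Measurable r → (∀ y, ∫⁻ x, r (y, x) ∂G = 1) →
      ∫⁻ z, r z ∂(Q.prod G) = 1 := by
    intro r hr hr1
    rw [lintegral_prod _ hr.aemeasurable]
    simp [hr1]
  rw [h1 Q inferInstance, h2 P inferInstance]
  refine (InformationTheory.klDiv_map_le _ _ hΦ).trans ?_
  rw [InformationTheory.klDiv_compProd_eq_add]
  gcongr
  rw [← h1 Q inferInstance, ← h2 Q inferInstance]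
  refine (klDiv_withDensity_le _ hq hp (h_int q hq hq1) (h_int p hp hp1) hp0).trans (le_of_eq ?_)
  rw [lintegral_prod _ (by fun_prop)]

lemma lintegral_chiSq_le (G : Measure Ω) {q p : Ω → ℝ≥0∞} (hq : Measurable q)
    (hp : Measurable p) (hp0 : ∀ x, p x ≠ 0) (hpt : ∀ᵐ x ∂G, p x < ∞) :
    ∫⁻ x, ENNReal.ofReal (((q x).toReal - (p x).toReal) ^ 2 / (p x).toReal) ∂G ≤
      (∫⁻ x, ‖(q x).toReal - (p x).toReal‖ₑ ^ 4 ∂G) ^ (1 / 2 : ℝ) *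
        (∫⁻ x, (p x)⁻¹ ^ 2 ∂G) ^ (1 / 2 : ℝ) := by
  have h := lintegral_mul_le_sqrt_mul_sqrt G
    (f := fun x => ‖(q x).toReal - (p x).toReal‖ₑ ^ 2) (g := fun x => (p x)⁻¹) (by fun_prop)
    (by fun_prop)
  simp only [← pow_mul] at h
  refine le_trans (lintegral_mono_ae ?_) h
  filter_upwards [hpt] with x hx
  have hpx : 0 < (p x).toReal := ENNReal.toReal_pos (hp0 x) hx.ne
  rw [Real.enorm_eq_ofReal_abs, ← ENNReal.ofReal_pow (abs_nonneg _), sq_abs, div_eq_mul_inv,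
    ENNReal.ofReal_mul (by positivity), ENNReal.ofReal_inv_of_pos hpx, ENNReal.ofReal_toReal hx.ne]

end General

section ScalarEstimates

lemma abs_exp_sub_sum_le (z : ℝ) (n : ℕ) :
    |Real.exp z - ∑ m ∈ Finset.range n, z ^ m / m.factorial| ≤ |z| ^ n * Real.exp |z| := by
  have := Complex.norm_exp_sub_sum_le_norm_mul_exp z n
  rw [Complex.norm_real, Real.norm_eq_abs] at this
  refine le_trans (le_of_eq ?_) this
  rw [← Real.norm_eq_abs, ← Complex.norm_real]
  push_cast; rfl

lemma abs_exp_sub_one_le_mul (z : ℝ) : |Real.exp z - 1| ≤ |z| * Real.exp |z| := by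
  simpa using abs_exp_sub_sum_le z 1

lemma abs_exp_sub_one_sub_le (z : ℝ) : |Real.exp z - 1 - z| ≤ z ^ 2 * Real.exp |z| := by
  simpa [Finset.sum_range_succ, sub_sub] using abs_exp_sub_sum_le z 2

lemma exp_half_le_two : Real.exp (1 / 2) ≤ 2 := by
  have h := Real.exp_one_lt_d9
  have h2 : Real.exp (1 / 2) * Real.exp (1 / 2) = Real.exp 1 := by rw [← Real.exp_add]; norm_num
  nlinarith [Real.exp_pos (1 / 2)]

lemma abs_exp_hermite_two_le {a t : ℝ} (ha : 0 ≤ a) (ha1 : a ≤ 1) :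
    |Real.exp (a * t - a ^ 2 / 2) - 1 - a * t - a ^ 2 / 2 * (t ^ 2 - 1)|
      ≤ 4 * a ^ 3 * Real.exp (6 * |t|) := by
  set z := a * t - a ^ 2 / 2 with hz
  have h3 := abs_exp_sub_sum_le z 3
  simp only [Finset.sum_range_succ, Finset.sum_range_zero] at h3
  norm_num [Nat.factorial] at h3
  have ht := abs_nonneg t
  have hE := Real.add_one_le_exp |t|
  have hzb : |z| ≤ a * (|t| + 1 / 2) := by
    calc |z| ≤ |a * t| + |a ^ 2 / 2| := abs_sub _ _
      _ = a * |t| + a ^ 2 / 2 := by rw [abs_mul, abs_of_nonneg ha, abs_of_nonneg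
          (by positivity : 0 ≤ a ^ 2 / 2)]
      _ ≤ _ := by nlinarith
  have hez : Real.exp |z| ≤ 2 * Real.exp |t| := by
    calc Real.exp |z| ≤ Real.exp (1 / 2 + |t|) := by
          apply Real.exp_le_exp.2; nlinarith
      _ = Real.exp (1 / 2) * Real.exp |t| := Real.exp_add _ _
      _ ≤ _ := by gcongr; exact exp_half_le_two
  have hR : |z| ^ 3 * Real.exp |z| ≤ 2 * a ^ 3 * Real.exp |t| ^ 4 := by
    calc |z| ^ 3 * Real.exp |z| ≤ (a * Real.exp |t|) ^ 3 * (2 * Real.exp |t|) := by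
          gcongr; exact hzb.trans (by gcongr; linarith)
      _ = _ := by ring
  have h6 : Real.exp (6 * |t|) = Real.exp |t| ^ 6 := by rw [← Real.exp_nat_mul]; norm_num
  have e1 : 1 ≤ Real.exp |t| := by linarith
  have e4 : Real.exp |t| ^ 4 ≤ Real.exp |t| ^ 6 := pow_le_pow_right₀ e1 (by norm_num)
  have e5 : Real.exp |t| ≤ Real.exp |t| ^ 6 := le_self_pow₀ e1 (by norm_num)
  rw [h6]
  have e : Real.exp z - 1 - a * t - a ^ 2 / 2 * (t ^ 2 - 1) =
      (Real.exp z - (1 + z + z ^ 2 / 2)) + (-(a ^ 3 * t / 2) + a ^ 4 / 8) := by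
    rw [hz]; ring
  rw [e]
  have h7 : |(-(a ^ 3 * t / 2) + a ^ 4 / 8)| ≤ a ^ 3 * Real.exp |t| ^ 6 := by
    calc _ ≤ |(-(a ^ 3 * t / 2))| + |a ^ 4 / 8| := abs_add_le _ _
      _ = a ^ 3 * (|t| / 2) + a ^ 3 * (a / 8) := by
        rw [abs_neg, abs_div, abs_mul, abs_of_nonneg (by positivity : 0 ≤ a ^ 3),
          abs_of_nonneg (by positivity : 0 ≤ a ^ 4 / 8)]
        norm_num; ring
      _ = a ^ 3 * (|t| / 2 + a / 8) := by ring
      _ ≤ _ := by gcongr; linarith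
  have h8 : 2 * a ^ 3 * Real.exp |t| ^ 4 ≤ 2 * a ^ 3 * Real.exp |t| ^ 6 := by gcongr
  have h9 : 0 ≤ a ^ 3 * Real.exp |t| ^ 6 := by positivity
  calc _ ≤ |Real.exp z - (1 + z + z ^ 2 / 2)| + |(-(a ^ 3 * t / 2) + a ^ 4 / 8)| := abs_add_le _ _
    _ ≤ _ := by linarith

lemma abs_exp_hermite_one_le {a t : ℝ} (ha : 0 ≤ a) :
    |Real.exp (a * t - a ^ 2 / 2) - 1 - a * t| ≤ 4 * a ^ 2 * Real.exp ((2 + a) * |t|) := by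
  have ht := abs_nonneg t
  have hE := Real.add_one_le_exp |t|
  have e1 : 1 ≤ Real.exp |t| := by linarith
  have ea : 1 ≤ Real.exp (a * |t|) := Real.one_le_exp (by positivity)
  have hsplit : Real.exp ((2 + a) * |t|) = Real.exp |t| ^ 2 * Real.exp (a * |t|) := by
    rw [← Real.exp_nat_mul, ← Real.exp_add]; push_cast; ring_nf
  have e2 : 1 ≤ Real.exp |t| ^ 2 := one_le_pow₀ e1
  rw [hsplit]
  have hat : |a * t| = a * |t| := by rw [abs_mul, abs_of_nonneg ha]
  rcases le_total a 1 with ha1 | ha1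
  · set z := a * t - a ^ 2 / 2 with hz
    have hzb : |z| ≤ a * (|t| + 1 / 2) := by
      calc |z| ≤ |a * t| + |a ^ 2 / 2| := abs_sub _ _
        _ = a * |t| + a ^ 2 / 2 := by rw [hat, abs_of_nonneg (by positivity : 0 ≤ a ^ 2 / 2)]
        _ ≤ _ := by nlinarith
    have hez : Real.exp |z| ≤ 2 * Real.exp (a * |t|) := by
      calc Real.exp |z| ≤ Real.exp (1 / 2 + a * |t|) := by
            apply Real.exp_le_exp.2; nlinarith
        _ = Real.exp (1 / 2) * Real.exp (a * |t|) := Real.exp_add _ _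
        _ ≤ _ := by gcongr; exact exp_half_le_two
    have hR : z ^ 2 * Real.exp |z| ≤ (a * Real.exp |t|) ^ 2 * (2 * Real.exp (a * |t|)) := by
      rw [← sq_abs]
      gcongr; exact hzb.trans (by gcongr; linarith)
    have e : Real.exp z - 1 - a * t = (Real.exp z - 1 - z) - a ^ 2 / 2 := by rw [hz]; ring
    rw [e]
    calc _ ≤ |Real.exp z - 1 - z| + |a ^ 2 / 2| := abs_sub _ _
      _ ≤ (a * Real.exp |t|) ^ 2 * (2 * Real.exp (a * |t|)) + a ^ 2 / 2 * 1 := by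
        rw [abs_of_nonneg (by positivity : 0 ≤ a ^ 2 / 2), mul_one]
        linarith [abs_exp_sub_one_sub_le z]
      _ ≤ (a * Real.exp |t|) ^ 2 * (2 * Real.exp (a * |t|)) +
          a ^ 2 / 2 * (Real.exp |t| ^ 2 * Real.exp (a * |t|)) := by
        gcongr; nlinarith
      _ ≤ _ := by
        have : 0 ≤ a ^ 2 * (Real.exp |t| ^ 2 * Real.exp (a * |t|)) := by positivity
        nlinarith
  · have h1 : Real.exp (a * t - a ^ 2 / 2) ≤ Real.exp (a * |t|) := by
      apply Real.exp_le_exp.2; nlinarith [le_abs_self t]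
    have h2 : a * |t| + 1 ≤ Real.exp (a * |t|) := Real.add_one_le_exp _
    have h3 : |Real.exp (a * t - a ^ 2 / 2) - 1 - a * t| ≤ 2 * Real.exp (a * |t|) := by
      have h4 := abs_le.1 hat.le
      have := Real.exp_pos (a * t - a ^ 2 / 2)
      rw [abs_le]; constructor <;> linarith
    have h4 : 1 ≤ a ^ 2 := one_le_pow₀ ha1
    calc _ ≤ 2 * 1 * (1 * Real.exp (a * |t|)) := by linarith
      _ ≤ 4 * a ^ 2 * (Real.exp |t| ^ 2 * Real.exp (a * |t|)) := by
        gcongr; norm_num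

end ScalarEstimates

section GaussianMoments

lemma lintegral_gaussianReal_exp_abs (c : ℝ) :
    ∫⁻ t, ENNReal.ofReal (Real.exp (c * |t|)) ∂(gaussianReal 0 1)
      ≤ ENNReal.ofReal (2 * Real.exp (c ^ 2 / 2)) := by
  have key : ∀ b : ℝ, ∫⁻ t, ENNReal.ofReal (Real.exp (b * t)) ∂(gaussianReal 0 1) =
      ENNReal.ofReal (Real.exp (b ^ 2 / 2)) := by
    intro b
    have := lintegral_exp_inner_stdGaussian (d := 1) (EuclideanSpace.single 0 b)
    have h2 := lintegral_stdGaussian_inner (d := 1) (EuclideanSpace.single 0 (1 : ℝ))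
      (f := fun t => ENNReal.ofReal (Real.exp (b * t))) (by fun_prop)
    simp [EuclideanSpace.inner_single_left] at this h2
    rw [← h2, ← this]
  calc _ ≤ ∫⁻ t, (ENNReal.ofReal (Real.exp (c * t)) + ENNReal.ofReal (Real.exp (-c * t)))
        ∂(gaussianReal 0 1) := by
        apply lintegral_mono; intro x
        dsimp only
        rw [← ENNReal.ofReal_add (by positivity) (by positivity)]
        apply ENNReal.ofReal_le_ofReal
        rcases abs_choice x with h | h <;> rw [h]
        · linarith [Real.exp_pos (-c * x)]
        · rw [show c * -x = -c * x by ring]; linarith [Real.exp_pos (c * x)]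
    _ = _ := by
        rw [lintegral_add_left (by fun_prop), key, key, two_mul,
          ENNReal.ofReal_add (by positivity) (by positivity), neg_sq]

/-- If a function of `⟪w, x⟫` is pointwise dominated by an exponential, so is its integral. -/
lemma lintegral_inner_le_of_exp_bound (w : Vec d) {f : ℝ → ℝ≥0∞} (hf : Measurable f) {A c : ℝ}
    (hA : 0 ≤ A) (h : ∀ t, f (‖w‖ * t) ≤ ENNReal.ofReal (A * Real.exp (c * |t|))) :
    ∫⁻ x, f ⟪w, x⟫ ∂(_root_.stdGaussian d) ≤ ENNReal.ofReal (A * (2 * Real.exp (c ^ 2 / 2))) := by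
  rw [lintegral_stdGaussian_inner w hf]
  calc _ ≤ ∫⁻ t, ENNReal.ofReal A * ENNReal.ofReal (Real.exp (c * |t|)) ∂(gaussianReal 0 1) := by
        apply lintegral_mono; intro t; dsimp only
        rw [← ENNReal.ofReal_mul hA]; exact h t
    _ = ENNReal.ofReal A * ∫⁻ t, ENNReal.ofReal (Real.exp (c * |t|)) ∂(gaussianReal 0 1) := by
        rw [lintegral_const_mul _ (by fun_prop)]
    _ ≤ _ := by
        rw [ENNReal.ofReal_mul hA]; gcongr; exact lintegral_gaussianReal_exp_abs c

lemma lintegral_norm_pow_stdGaussian (hd : 1 ≤ d) (n : ℕ) :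
    ∫⁻ x, ‖x‖ₑ ^ (2 * n) ∂(_root_.stdGaussian d) ≤
      ENNReal.ofReal (2 * (4 ^ n * n.factorial) * d ^ n) := by
  have hd' : (0 : ℝ) < d := by exact_mod_cast hd
  have h1 : ∀ x : Vec d, ‖x‖ₑ ^ (2 * n) ≤ ENNReal.ofReal ((4 * d) ^ n * n.factorial) *
      ENNReal.ofReal (Real.exp (‖x‖ ^ 2 / (4 * d))) := by
    intro x
    rw [← ofReal_norm, ← ENNReal.ofReal_pow (norm_nonneg _), ← ENNReal.ofReal_mul (by positivity)]
    apply ENNReal.ofReal_le_ofReal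
    have := Real.pow_div_factorial_le_exp (‖x‖ ^ 2 / (4 * d)) (by positivity) n
    rw [div_pow, div_div, div_le_iff₀ (by positivity)] at this
    rw [pow_mul]; linarith
  refine (lintegral_mono h1).trans ?_
  rw [lintegral_const_mul _ (by fun_prop)]
  calc _ ≤ ENNReal.ofReal ((4 * d) ^ n * n.factorial) * 2 := by
        gcongr; exact lintegral_exp_norm_sq_stdGaussian hd
    _ = _ := by
        rw [show (2 : ℝ≥0∞) = ENNReal.ofReal 2 by simp, ← ENNReal.ofReal_mul (by positivity)]
        congr 1; rw [mul_pow]; ring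

end GaussianMoments

lemma integrable_of_continuous_of_bounded_support {F : Type*} [NormedAddCommGroup F]
    {ν : Measure (Vec d)} [IsFiniteMeasure ν] {R : ℝ} (hν : ∀ᵐ w ∂ν, ‖w‖ ≤ R)
    {f : Vec d → F} (hf : Continuous f) : Integrable f ν := by
  obtain ⟨C, hC⟩ := (isCompact_closedBall (0 : Vec d) R).exists_bound_of_continuousOn
    hf.continuousOn
  refine Integrable.of_bound hf.aestronglyMeasurable C ?_
  filter_upwards [hν] with w hw
  exact hC w (by simpa using hw)

/-- The mean of `ν` tilted by `exp (ℓ ⟪·, g⟫)`. -/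
def tiltMean (ν : Measure (Vec d)) (ℓ : ℝ) (g : Vec d) : Vec d :=
  (∫ w, Real.exp (ℓ * ⟪w, g⟫) ∂ν)⁻¹ • ∫ w, Real.exp (ℓ * ⟪w, g⟫) • w ∂ν

/-- The second moment operator of `ν`. -/
def covApply (ν : Measure (Vec d)) (g : Vec d) : Vec d := ∫ w, ⟪w, g⟫ • w ∂ν

section

variable {ν : Measure (Vec d)} [IsProbabilityMeasure ν] {R ℓ : ℝ}

lemma measurable_tiltMean : Measurable (tiltMean ν ℓ) := by
  unfold tiltMean
  refine Measurable.fun_smul ?_ ?_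
  · apply Measurable.inv
    apply StronglyMeasurable.measurable
    apply StronglyMeasurable.integral_prod_right (f := fun g w => Real.exp (ℓ * ⟪w, g⟫))
    apply Continuous.stronglyMeasurable
    fun_prop
  · apply StronglyMeasurable.measurable
    apply StronglyMeasurable.integral_prod_right (f := fun (g w : Vec d) => Real.exp
        (ℓ * ⟪w, g⟫) • w)
    apply Continuous.stronglyMeasurable
    fun_prop

lemma measurable_covApply : Measurable (covApply ν) := by
  unfold covApply
  apply StronglyMeasurable.measurable
  apply StronglyMeasurable.integral_prod_right (f := fun (g w : Vec d) => (⟪w, g⟫ : ℝ) • w)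
  apply Continuous.stronglyMeasurable
  fun_prop

lemma norm_tiltMean_le (hν : ∀ᵐ w ∂ν, ‖w‖ ≤ R) (g : Vec d) : ‖tiltMean ν ℓ g‖ ≤ R := by
  have hpos : 0 < ∫ w, Real.exp (ℓ * ⟪w, g⟫) ∂ν :=
    integral_exp_pos (integrable_of_continuous_of_bounded_support hν (by fun_prop))
  unfold tiltMean
  rw [norm_smul, norm_inv, Real.norm_eq_abs, abs_of_pos hpos, inv_mul_le_iff₀ hpos,
      ← integral_mul_const]
  refine norm_integral_le_of_norm_le
    (integrable_of_continuous_of_bounded_support hν (by fun_prop)) ?_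
  filter_upwards [hν] with w hw
  rw [norm_smul, Real.norm_eq_abs, Real.abs_exp]
  gcongr

lemma integral_inner_eq_zero (hν : ∀ᵐ w ∂ν, ‖w‖ ≤ R) (hmean : ∫ w, w ∂ν = 0) (g : Vec d) :
    ∫ w, ⟪w, g⟫ ∂ν = 0 := by
  have : ∀ w : Vec d, (⟪w, g⟫ : ℝ) = ⟪g, w⟫ := fun w => real_inner_comm _ _
  simp_rw [this]
  rw [integral_inner (integrable_of_continuous_of_bounded_support (f := fun w => w) hν
      (by fun_prop)), hmean,
    inner_zero_right]

lemma one_le_integral_exp (hν : ∀ᵐ w ∂ν, ‖w‖ ≤ R) (hmean : ∫ w, w ∂ν = 0) (g : Vec d) :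
    1 ≤ ∫ w, Real.exp (ℓ * ⟪w, g⟫) ∂ν := by
  have hi : ∀ {f : Vec d → ℝ}, Continuous f → Integrable f ν :=
    fun hf => integrable_of_continuous_of_bounded_support hν hf
  calc (1 : ℝ) = ∫ w, (ℓ * ⟪w, g⟫ + 1) ∂ν := by
        rw [integral_add (hi (by fun_prop)) (hi (by fun_prop)), integral_const_mul,
          integral_inner_eq_zero hν hmean]
        simp
    _ ≤ _ := integral_mono (hi (by fun_prop)) (hi (by fun_prop)) fun w => Real.add_one_le_exp _

/-- The scalar majorant `|z| exp |z|` used in the estimates of tilted means. -/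
def expMajorant (z : ℝ) : ℝ := |z| * Real.exp |z|

lemma expMajorant_nonneg (z : ℝ) : 0 ≤ expMajorant z := by unfold expMajorant; positivity

@[fun_prop]
lemma continuous_expMajorant : Continuous expMajorant := by unfold expMajorant; fun_prop

lemma abs_exp_sub_one_sub_le_expMajorant_sq (z : ℝ) :
    |Real.exp z - 1 - z| ≤ expMajorant z ^ 2 := by
  refine (abs_exp_sub_one_sub_le z).trans ?_
  unfold expMajorant
  rw [mul_pow, sq_abs]
  gcongr
  exact le_self_pow₀ (Real.one_le_exp (abs_nonneg z)) (by norm_num)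

lemma norm_tiltMean_le_integral (hν : ∀ᵐ w ∂ν, ‖w‖ ≤ R) (hmean : ∫ w, w ∂ν = 0) (g : Vec d) :
    ‖tiltMean ν ℓ g‖ ≤ R * ∫ w, expMajorant (ℓ * ⟪w, g⟫) ∂ν := by
  have hi : ∀ {F : Type} [NormedAddCommGroup F] {f : Vec d → F}, Continuous f → Integrable f ν :=
    fun hf => integrable_of_continuous_of_bounded_support hν hf
  have h1 := one_le_integral_exp (ℓ := ℓ) hν hmean g
  have h2 : ∫ w, Real.exp (ℓ * ⟪w, g⟫) • w ∂ν = ∫ w, (Real.exp (ℓ * ⟪w, g⟫) - 1) • w ∂ν := by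
    simp_rw [sub_smul, one_smul]
    rw [integral_sub (hi (by fun_prop)) (hi (by fun_prop)), hmean, sub_zero]
  have h3 : ‖∫ w, Real.exp (ℓ * ⟪w, g⟫) • w ∂ν‖ ≤ R * ∫ w, expMajorant (ℓ * ⟪w, g⟫) ∂ν := by
    rw [h2, ← integral_const_mul]
    refine norm_integral_le_of_norm_le (hi (by fun_prop)) ?_
    filter_upwards [hν] with w hw
    rw [norm_smul, Real.norm_eq_abs, mul_comm]
    gcongr
    · exact (norm_nonneg _).trans hw
    · exact abs_exp_sub_one_le_mul _
  unfold tiltMean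
  rw [norm_smul, norm_inv, Real.norm_eq_abs, abs_of_pos (by linarith)]
  calc _ ≤ 1 * ‖∫ w, Real.exp (ℓ * ⟪w, g⟫) • w ∂ν‖ := by
        gcongr; exact inv_le_one_of_one_le₀ h1
    _ ≤ _ := by rwa [one_mul]

lemma norm_tiltMean_sub_le_integral (hν : ∀ᵐ w ∂ν, ‖w‖ ≤ R) (hmean : ∫ w, w ∂ν = 0)
    (g : Vec d) :
    ‖tiltMean ν ℓ g - ℓ • covApply ν g‖ ≤ 2 * R * ∫ w, expMajorant (ℓ * ⟪w, g⟫) ^ 2 ∂ν := by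
  have hi : ∀ {F : Type} [NormedAddCommGroup F] {f : Vec d → F}, Continuous f → Integrable f ν :=
    fun hf => integrable_of_continuous_of_bounded_support hν hf
  have h1 := one_le_integral_exp (ℓ := ℓ) hν hmean g
  set Z := ∫ w, Real.exp (ℓ * ⟪w, g⟫) ∂ν with hZ
  have hM : ∫ w, Real.exp (ℓ * ⟪w, g⟫) • w ∂ν = Z • tiltMean ν ℓ g := by
    unfold tiltMean
    rw [smul_smul, ← hZ, mul_inv_cancel₀ (by linarith), one_smul]
  have h2 : ∫ w, (Real.exp (ℓ * ⟪w, g⟫) - 1 - ℓ * ⟪w, g⟫) • w ∂ν =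
      Z • tiltMean ν ℓ g - ℓ • covApply ν g := by
    simp_rw [sub_smul, one_smul, mul_smul]
    rw [integral_sub (hi (by fun_prop)) (hi (by fun_prop)),
      integral_sub (hi (by fun_prop)) (hi (by fun_prop)), hmean, sub_zero, hM, integral_smul]
    rfl
  have h3 : ∫ w, (Real.exp (ℓ * ⟪w, g⟫) - 1 - ℓ * ⟪w, g⟫) ∂ν = Z - 1 := by
    rw [integral_sub (hi (by fun_prop)) (hi (by fun_prop)),
      integral_sub (hi (by fun_prop)) (hi (by fun_prop)), integral_const_mul,
      integral_inner_eq_zero hν hmean]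
    simp [hZ]
  have h4 : Z - 1 ≤ ∫ w, expMajorant (ℓ * ⟪w, g⟫) ^ 2 ∂ν := by
    rw [← h3]
    exact integral_mono (hi (by fun_prop)) (hi (by fun_prop)) fun w =>
      (le_abs_self _).trans (abs_exp_sub_one_sub_le_expMajorant_sq _)
  have h5 : ‖Z • tiltMean ν ℓ g - ℓ • covApply ν g‖ ≤
      R * ∫ w, expMajorant (ℓ * ⟪w, g⟫) ^ 2 ∂ν := by
    rw [← h2, ← integral_const_mul]
    refine norm_integral_le_of_norm_le (hi (by fun_prop)) ?_
    filter_upwards [hν] with w hw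
    rw [norm_smul, Real.norm_eq_abs, mul_comm]
    gcongr
    · exact (norm_nonneg _).trans hw
    · exact abs_exp_sub_one_sub_le_expMajorant_sq _
  have e : tiltMean ν ℓ g - ℓ • covApply ν g =
      (Z • tiltMean ν ℓ g - ℓ • covApply ν g) - (Z - 1) • tiltMean ν ℓ g := by
    rw [sub_smul, one_smul]; abel
  have hn := norm_tiltMean_le (ℓ := ℓ) hν g
  have h6 : ‖(Z - 1) • tiltMean ν ℓ g‖ ≤ (∫ w, expMajorant (ℓ * ⟪w, g⟫) ^ 2 ∂ν) * R := by
    rw [norm_smul, Real.norm_eq_abs, abs_of_nonneg (by linarith)]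
    gcongr
  have h7 := norm_sub_le (Z • tiltMean ν ℓ g - ℓ • covApply ν g) ((Z - 1) • tiltMean ν ℓ g)
  rw [← e] at h7
  linarith

/-- Jensen's inequality for even powers of integrals against a compactly supported measure. -/
lemma ofReal_integral_pow_le (hν : ∀ᵐ w ∂ν, ‖w‖ ≤ R) {f : Vec d → ℝ} (hf : Continuous f)
    (hf0 : ∀ w, 0 ≤ f w) {n : ℕ} (hn : 1 ≤ n) :
    ENNReal.ofReal (∫ w, f w ∂ν) ^ n ≤ ∫⁻ w, ENNReal.ofReal (f w) ^ n ∂ν := by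
  rw [ofReal_integral_eq_lintegral_ofReal (integrable_of_continuous_of_bounded_support hν hf)
    (by filter_upwards with w using hf0 w)]
  exact lintegral_pow_le_of_isProbabilityMeasure ν (by fun_prop) hn

lemma lintegral_expMajorant_pow_le (w : Vec d) (h : |ℓ| * ‖w‖ ≤ 1) (n : ℕ) :
    ∫⁻ g, ENNReal.ofReal (expMajorant (ℓ * ⟪w, g⟫)) ^ n ∂(_root_.stdGaussian d) ≤
      ENNReal.ofReal ((|ℓ| * ‖w‖) ^ n * (2 * Real.exp ((2 * n) ^ 2 / 2))) := by
  refine lintegral_inner_le_of_exp_bound w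
    (f := fun t => ENNReal.ofReal (expMajorant (ℓ * t)) ^ n) (by fun_prop) (by positivity) ?_
  intro t
  rw [← ENNReal.ofReal_pow (expMajorant_nonneg _)]
  apply ENNReal.ofReal_le_ofReal
  have h1 : expMajorant (ℓ * (‖w‖ * t)) ≤ |ℓ| * ‖w‖ * Real.exp (2 * |t|) := by
    unfold expMajorant
    rw [abs_mul, abs_mul, abs_norm, ← mul_assoc]
    rw [mul_assoc]
    gcongr
    rw [show 2 * |t| = |t| + |t| by ring, Real.exp_add]
    have := Real.add_one_le_exp |t|
    gcongr
    · linarith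
    · nlinarith [abs_nonneg t]
  calc _ ≤ (|ℓ| * ‖w‖ * Real.exp (2 * |t|)) ^ n := by gcongr; exact expMajorant_nonneg _
    _ = _ := by rw [mul_pow, ← Real.exp_nat_mul]; ring_nf

end

lemma enorm_pow_eq_ofReal_abs_pow (z : ℝ) (n : ℕ) : ‖z‖ₑ ^ n = ENNReal.ofReal (|z| ^ n) := by
  rw [ENNReal.ofReal_pow (abs_nonneg z), ← Real.norm_eq_abs, ofReal_norm]

lemma lintegral_hermiteTwo_remainder_le {β₀ : ℝ} (hβ : 0 ≤ β₀) (w : Vec d) (hw : β₀ * ‖w‖ ≤ 1) :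
    ∫⁻ x, ‖Real.exp (β₀ * ⟪w, x⟫ - (β₀ * ‖w‖) ^ 2 / 2) - 1 - β₀ * ⟪w, x⟫
        - β₀ ^ 2 / 2 * (⟪w, x⟫ ^ 2 - ‖w‖ ^ 2)‖ₑ ^ 4 ∂(_root_.stdGaussian d) ≤
      ENNReal.ofReal (256 * (β₀ * ‖w‖) ^ 12 * (2 * Real.exp (24 ^ 2 / 2))) := by
  refine lintegral_inner_le_of_exp_bound w
    (f := fun z => ‖Real.exp (β₀ * z - (β₀ * ‖w‖) ^ 2 / 2) - 1 - β₀ * z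
        - β₀ ^ 2 / 2 * (z ^ 2 - ‖w‖ ^ 2)‖ₑ ^ 4) (by fun_prop) (by positivity) fun t => ?_
  rw [enorm_pow_eq_ofReal_abs_pow]
  apply ENNReal.ofReal_le_ofReal
  have h := abs_exp_hermite_two_le (t := t) (mul_nonneg hβ (norm_nonneg w)) hw
  calc _ = |Real.exp (β₀ * ‖w‖ * t - (β₀ * ‖w‖) ^ 2 / 2) - 1 - β₀ * ‖w‖ * t
        - (β₀ * ‖w‖) ^ 2 / 2 * (t ^ 2 - 1)| ^ 4 := by congr 2; ring_nf
    _ ≤ (4 * (β₀ * ‖w‖) ^ 3 * Real.exp (6 * |t|)) ^ 4 := by gcongr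
    _ = _ := by rw [mul_pow, ← Real.exp_nat_mul]; ring_nf

lemma lintegral_hermiteTwo_le (w : Vec d) :
    ∫⁻ x, ‖⟪w, x⟫ ^ 2 - ‖w‖ ^ 2‖ₑ ^ 4 ∂(_root_.stdGaussian d) ≤
      ENNReal.ofReal (‖w‖ ^ 8 * (2 * Real.exp (8 ^ 2 / 2))) := by
  refine lintegral_inner_le_of_exp_bound w
    (f := fun z => ‖z ^ 2 - ‖w‖ ^ 2‖ₑ ^ 4) (by fun_prop) (by positivity) fun t => ?_
  rw [enorm_pow_eq_ofReal_abs_pow]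
  apply ENNReal.ofReal_le_ofReal
  have h : |t ^ 2 - 1| ≤ Real.exp (2 * |t|) := by
    have h1 := Real.add_one_le_exp |t|
    have h2 := abs_nonneg t
    rw [show 2 * |t| = |t| + |t| by ring, Real.exp_add, abs_le]
    constructor <;> nlinarith [sq_abs t]
  calc _ = (‖w‖ ^ 2 * |t ^ 2 - 1|) ^ 4 := by
        rw [show (‖w‖ * t) ^ 2 - ‖w‖ ^ 2 = ‖w‖ ^ 2 * (t ^ 2 - 1) by ring, abs_mul,
          abs_of_nonneg (by positivity : (0 : ℝ) ≤ ‖w‖ ^ 2)]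
    _ ≤ (‖w‖ ^ 2 * Real.exp (2 * |t|)) ^ 4 := by gcongr
    _ = _ := by rw [mul_pow, ← Real.exp_nat_mul]; ring_nf

lemma lintegral_exp_inner_remainder_le (v : Vec d) :
    ∫⁻ x, ‖Real.exp (⟪v, x⟫ - ‖v‖ ^ 2 / 2) - 1 - ⟪v, x⟫‖ₑ ^ 4 ∂(_root_.stdGaussian d) ≤
      ENNReal.ofReal (512 * Real.exp 64 * (‖v‖ ^ 8 * Real.exp (16 * ‖v‖ ^ 2))) := by
  refine (lintegral_inner_le_of_exp_bound v (A := 256 * ‖v‖ ^ 8) (c := 8 + 4 * ‖v‖)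
    (f := fun z => ‖Real.exp (z - ‖v‖ ^ 2 / 2) - 1 - z‖ₑ ^ 4) (by fun_prop) (by positivity)
    fun t => ?_).trans ?_
  · rw [enorm_pow_eq_ofReal_abs_pow]
    apply ENNReal.ofReal_le_ofReal
    calc _ ≤ (4 * ‖v‖ ^ 2 * Real.exp ((2 + ‖v‖) * |t|)) ^ 4 := by
          gcongr; exact abs_exp_hermite_one_le (norm_nonneg v)
      _ = _ := by rw [mul_pow, ← Real.exp_nat_mul]; ring_nf
  · apply ENNReal.ofReal_le_ofReal
    have : Real.exp ((8 + 4 * ‖v‖) ^ 2 / 2) ≤ Real.exp 64 * Real.exp (16 * ‖v‖ ^ 2) := by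
      rw [← Real.exp_add]
      apply Real.exp_le_exp.2
      nlinarith [sq_nonneg (‖v‖ - 2)]
    calc _ ≤ 256 * ‖v‖ ^ 8 * (2 * (Real.exp 64 * Real.exp (16 * ‖v‖ ^ 2))) := by gcongr
      _ = _ := by ring

lemma lintegral_inner_pow_four_le (v : Vec d) :
    ∫⁻ x, ‖⟪v, x⟫‖ₑ ^ 4 ∂(_root_.stdGaussian d) ≤
      ENNReal.ofReal (2 * Real.exp 8 * ‖v‖ ^ 4) := by
  refine (lintegral_inner_le_of_exp_bound v (A := ‖v‖ ^ 4) (c := 4)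
    (f := fun z => ‖z‖ₑ ^ 4) (by fun_prop) (by positivity) fun t => ?_).trans ?_
  · rw [enorm_pow_eq_ofReal_abs_pow]
    apply ENNReal.ofReal_le_ofReal
    calc _ ≤ (‖v‖ * Real.exp |t|) ^ 4 := by
          rw [abs_mul, abs_norm]; gcongr; have := Real.add_one_le_exp |t|; linarith
      _ = _ := by rw [mul_pow, ← Real.exp_nat_mul]; norm_num
  · apply ENNReal.ofReal_le_ofReal
    norm_num
    linarith

/-- The perturbation of the Gaussian increment of the sampler, in whitened coordinates. -/
def drift (ν : Measure (Vec d)) (e : Vec d → Vec d) (b ℓ ξ : ℝ) (g : Vec d) : Vec d :=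
  b • (tiltMean ν ℓ g + e g) + ξ • g

/-- The part of `drift` which is not accounted for by the first order expansion. -/
def driftRem (ν : Measure (Vec d)) (e : Vec d → Vec d) (b ℓ ξ : ℝ) (g : Vec d) : Vec d :=
  b • (tiltMean ν ℓ g - ℓ • covApply ν g + e g) + ξ • g

lemma drift_eq {ν : Measure (Vec d)} {e : Vec d → Vec d} {b ℓ ξ : ℝ} (g : Vec d) :
    drift ν e b ℓ ξ g = (b * ℓ) • covApply ν g + driftRem ν e b ℓ ξ g := by
  unfold drift driftRem
  module

section

variable {ν : Measure (Vec d)} [IsProbabilityMeasure ν] {e : Vec d → Vec d} {b ℓ ξ s : ℝ}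

@[fun_prop]
lemma measurable_drift (he : Measurable e) : Measurable (drift ν e b ℓ ξ) := by
  unfold drift
  have := measurable_tiltMean (ν := ν) (ℓ := ℓ)
  fun_prop

@[fun_prop]
lemma measurable_driftRem (he : Measurable e) : Measurable (driftRem ν e b ℓ ξ) := by
  unfold driftRem
  have := measurable_tiltMean (ν := ν) (ℓ := ℓ)
  have := measurable_covApply (ν := ν)
  fun_prop

lemma norm_drift_sq_le (hν : ∀ᵐ w ∂ν, ‖w‖ ≤ 2 * √d) (he : ∀ g, ‖e g‖ ≤ 2 * √d)
    (hb : b ^ 2 ≤ s) (g : Vec d) :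
    ‖drift ν e b ℓ ξ g‖ ^ 2 ≤ 32 * s * d + 2 * ξ ^ 2 * ‖g‖ ^ 2 := by
  have h1 := norm_tiltMean_le (ℓ := ℓ) hν g
  have h2 : ‖drift ν e b ℓ ξ g‖ ≤ |b| * (4 * √d) + |ξ| * ‖g‖ := by
    unfold drift
    refine (norm_add_le _ _).trans ?_
    rw [norm_smul, norm_smul, Real.norm_eq_abs, Real.norm_eq_abs]
    gcongr
    refine (norm_add_le _ _).trans ?_
    linarith [he g]
  have h3 : √d ^ 2 = (d : ℝ) := Real.sq_sqrt (by positivity)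
  have hd : (0 : ℝ) ≤ d := by positivity
  calc _ ≤ (|b| * (4 * √d) + |ξ| * ‖g‖) ^ 2 := by gcongr
    _ ≤ 2 * ((|b| * (4 * √d)) ^ 2 + (|ξ| * ‖g‖) ^ 2) := add_sq_le
    _ = 32 * b ^ 2 * d + 2 * ξ ^ 2 * ‖g‖ ^ 2 := by
        rw [mul_pow, mul_pow, mul_pow, sq_abs, sq_abs, h3]; ring
    _ ≤ _ := by gcongr

lemma lintegral_exp_norm_drift_sq_le (hd : 1 ≤ d) (hν : ∀ᵐ w ∂ν, ‖w‖ ≤ 2 * √d)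
    (he : ∀ g, ‖e g‖ ≤ 2 * √d) (hb : b ^ 2 ≤ s) {c : ℝ} (hc : c ≤ 32)
    (hs : s * d ≤ 1 / 1024) (hξ : ξ ^ 2 * d ≤ 1 / 256) :
    ∫⁻ g, ENNReal.ofReal (Real.exp (c * ‖drift ν e b ℓ ξ g‖ ^ 2)) ∂(_root_.stdGaussian d) ≤
      ENNReal.ofReal (2 * Real.exp 1) := by
  have hd' : (0 : ℝ) < d := by exact_mod_cast hd
  have hs0 : 0 ≤ s := (sq_nonneg b).trans hb
  calc _ ≤ ∫⁻ g : Vec d, ENNReal.ofReal (Real.exp 1) * ENNReal.ofReal (Real.exp (‖g‖ ^ 2 / (4 * d)))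
        ∂(_root_.stdGaussian d) := by
        apply lintegral_mono; intro g; dsimp only
        rw [← ENNReal.ofReal_mul (by positivity), ← Real.exp_add]
        apply ENNReal.ofReal_le_ofReal
        apply Real.exp_le_exp.2
        have h1 := norm_drift_sq_le (ℓ := ℓ) (ξ := ξ) hν he hb g
        have h2 : 64 * ξ ^ 2 * ‖g‖ ^ 2 ≤ ‖g‖ ^ 2 / (4 * d) := by
          rw [le_div_iff₀ (by positivity)]
          nlinarith [sq_nonneg ‖g‖]
        have h3 : c * ‖drift ν e b ℓ ξ g‖ ^ 2 ≤ 32 * ‖drift ν e b ℓ ξ g‖ ^ 2 := by gcongr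
        nlinarith
    _ ≤ ENNReal.ofReal (Real.exp 1) * 2 := by
        rw [lintegral_const_mul _ (by fun_prop)]
        gcongr
        exact lintegral_exp_norm_sq_stdGaussian hd
    _ = _ := by
        rw [mul_comm 2, ENNReal.ofReal_mul (by positivity)]; norm_num

end

lemma ENNReal.add_add_pow_le (a b c : ℝ≥0∞) (n : ℕ) :
    (a + b + c) ^ n ≤ 3 ^ n * (a ^ n + b ^ n + c ^ n) := by
  have h : a + b + c ≤ 3 * max (max a b) c := by
    calc a + b + c ≤ max (max a b) c + max (max a b) c + max (max a b) c := by
          gcongr <;> simp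
      _ = _ := by ring
  calc _ ≤ (3 * max (max a b) c) ^ n := by gcongr
    _ = 3 ^ n * (max (max a b) c) ^ n := mul_pow _ _ _
    _ ≤ _ := by
        gcongr
        rcases max_choice (max a b) c with h | h <;> rw [h]
        · rcases max_choice a b with h | h <;> rw [h]
          · exact (le_add_right le_rfl).trans (le_add_right le_rfl)
          · exact (le_add_left le_rfl).trans (le_add_right le_rfl)
        · exact le_add_left le_rfl

section

variable {ν : Measure (Vec d)} [IsProbabilityMeasure ν] {e : Vec d → Vec d} {b ℓ ξ s R : ℝ}

lemma lintegral_lintegral_expMajorant_pow_le (hν : ∀ᵐ w ∂ν, ‖w‖ ≤ R) (hℓ : |ℓ| * R ≤ 1) (n : ℕ) :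
    ∫⁻ g, ∫⁻ w, ENNReal.ofReal (expMajorant (ℓ * ⟪w, g⟫)) ^ n ∂ν ∂(_root_.stdGaussian d) ≤
      ENNReal.ofReal (|ℓ| ^ n * (2 * Real.exp ((2 * n) ^ 2 / 2))) * ∫⁻ w, ‖w‖ₑ ^ n ∂ν := by
  rw [lintegral_lintegral_swap (by fun_prop), ← lintegral_const_mul _ (by fun_prop)]
  apply lintegral_mono_ae
  filter_upwards [hν] with w hw
  refine (lintegral_expMajorant_pow_le w ((by gcongr : |ℓ| * ‖w‖ ≤ |ℓ| * R).trans hℓ) n).trans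
    (le_of_eq ?_)
  rw [← ofReal_norm, ← ENNReal.ofReal_pow (norm_nonneg _), ← ENNReal.ofReal_mul (by positivity)]
  congr 1; ring

lemma lintegral_tiltMean_pow_le (hν : ∀ᵐ w ∂ν, ‖w‖ ≤ R) (hmean : ∫ w, w ∂ν = 0)
    (hR : 0 ≤ R) (hℓ : |ℓ| * R ≤ 1) {n : ℕ} (hn : 1 ≤ n) :
    ∫⁻ g, ‖tiltMean ν ℓ g‖ₑ ^ n ∂(_root_.stdGaussian d) ≤
      ENNReal.ofReal (R ^ n * (|ℓ| ^ n * (2 * Real.exp ((2 * n) ^ 2 / 2)))) *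
        ∫⁻ w, ‖w‖ₑ ^ n ∂ν := by
  calc _ ≤ ∫⁻ g, ENNReal.ofReal (R ^ n) *
        ∫⁻ w, ENNReal.ofReal (expMajorant (ℓ * ⟪w, g⟫)) ^ n ∂ν ∂(_root_.stdGaussian d) := by
        apply lintegral_mono; intro g; dsimp only
        refine le_trans ?_ (mul_le_mul_right (ofReal_integral_pow_le hν (by fun_prop)
          (fun w => expMajorant_nonneg _) hn) _)
        rw [ENNReal.ofReal_pow hR, ← mul_pow, ← ENNReal.ofReal_mul hR, ← ofReal_norm]
        gcongr
        exact norm_tiltMean_le_integral hν hmean g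
    _ ≤ _ := by
        rw [lintegral_const_mul' _ _ ENNReal.ofReal_ne_top, ENNReal.ofReal_mul (by positivity),
            mul_assoc]
        gcongr
        exact lintegral_lintegral_expMajorant_pow_le hν hℓ n

lemma lintegral_tiltMean_sub_pow_le (hν : ∀ᵐ w ∂ν, ‖w‖ ≤ R) (hmean : ∫ w, w ∂ν = 0)
    (hR : 0 ≤ R) (hℓ : |ℓ| * R ≤ 1) {n : ℕ} (hn : 1 ≤ n) :
    ∫⁻ g, ‖tiltMean ν ℓ g - ℓ • covApply ν g‖ₑ ^ n ∂(_root_.stdGaussian d) ≤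
      ENNReal.ofReal ((2 * R) ^ n * (|ℓ| ^ (2 * n) * (2 * Real.exp ((2 * (2 * n : ℕ)) ^ 2 / 2)))) *
        ∫⁻ w, ‖w‖ₑ ^ (2 * n) ∂ν := by
  calc _ ≤ ∫⁻ g, ENNReal.ofReal ((2 * R) ^ n) *
        ∫⁻ w, ENNReal.ofReal (expMajorant (ℓ * ⟪w, g⟫)) ^ (2 * n) ∂ν ∂(_root_.stdGaussian d) := by
        apply lintegral_mono; intro g; dsimp only
        have h := ofReal_integral_pow_le hν (f := fun w => expMajorant (ℓ * ⟪w, g⟫) ^ 2)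
          (by fun_prop) (fun w => sq_nonneg _) hn
        simp_rw [ENNReal.ofReal_pow (expMajorant_nonneg _), ← pow_mul] at h
        refine le_trans ?_ (mul_le_mul_right h _)
        rw [ENNReal.ofReal_pow (by positivity), ← mul_pow, ← ENNReal.ofReal_mul (by positivity),
          ← ofReal_norm]
        gcongr
        exact norm_tiltMean_sub_le_integral hν hmean g
    _ ≤ _ := by
        rw [lintegral_const_mul' _ _ ENNReal.ofReal_ne_top, ENNReal.ofReal_mul (by positivity),
            mul_assoc]
        gcongr
        exact lintegral_lintegral_expMajorant_pow_le hν hℓ (2 * n)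

lemma lintegral_enorm_pow_le_of_norm_le {Ω : Type*} [MeasurableSpace Ω] {μ : Measure Ω}
    {f : Ω → Vec d} (hf : ∀ᵐ w ∂μ, ‖f w‖ ≤ R) (hR : 0 ≤ R) (m n : ℕ) :
    ∫⁻ w, ‖f w‖ₑ ^ (m + n) ∂μ ≤ ENNReal.ofReal (R ^ m) * ∫⁻ w, ‖f w‖ₑ ^ n ∂μ := by
  rw [← lintegral_const_mul' _ _ ENNReal.ofReal_ne_top]
  apply lintegral_mono_ae
  filter_upwards [hf] with w hw
  rw [pow_add, ENNReal.ofReal_pow hR]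
  gcongr
  rw [← ofReal_norm]
  exact ENNReal.ofReal_le_ofReal hw

lemma lintegral_smul_add_add_smul_pow_le {X : Vec d → Vec d} (hX : Measurable X)
    (he : Measurable e) (b ξ : ℝ) (n : ℕ) :
    ∫⁻ g, ‖b • (X g + e g) + ξ • g‖ₑ ^ n ∂(_root_.stdGaussian d) ≤
      ENNReal.ofReal (3 ^ n) * (ENNReal.ofReal (|b| ^ n) * ∫⁻ g, ‖X g‖ₑ ^ n ∂(_root_.stdGaussian d)
        + ENNReal.ofReal (|b| ^ n) * ∫⁻ g, ‖e g‖ₑ ^ n ∂(_root_.stdGaussian d)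
        + ENNReal.ofReal (|ξ| ^ n) * ∫⁻ g, ‖g‖ₑ ^ n ∂(_root_.stdGaussian d)) := by
  have hb : ∀ z : ℝ, ENNReal.ofReal (|z| ^ n) = ‖z‖ₑ ^ n := fun z =>
    (enorm_pow_eq_ofReal_abs_pow z n).symm
  rw [hb, hb, ← lintegral_const_mul _ (by fun_prop), ← lintegral_const_mul _ (by fun_prop),
    ← lintegral_const_mul _ (by fun_prop), ← lintegral_add_left (by fun_prop),
    ← lintegral_add_left (by fun_prop), ← lintegral_const_mul _ (by fun_prop)]
  apply lintegral_mono; intro g; dsimp only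
  rw [← mul_pow, ← mul_pow, ← mul_pow, ← enorm_smul, ← enorm_smul, ← enorm_smul,
    show ENNReal.ofReal (3 ^ n) = 3 ^ n by rw [ENNReal.ofReal_pow (by norm_num)]; norm_num]
  refine le_trans ?_ (ENNReal.add_add_pow_le _ _ _ n)
  gcongr
  rw [smul_add]
  exact (enorm_add_le _ _).trans (by gcongr; exact enorm_add_le _ _)

lemma abs_mul_two_sqrt_le_one (hd : 1 ≤ d) (hℓ : ℓ ^ 2 ≤ s) (hs : s * d ≤ 1 / 1024) :
    |ℓ| * (2 * √d) ≤ 1 := by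
  have hd' : (0 : ℝ) < d := by exact_mod_cast hd
  rw [← sq_le_one_iff₀ (by positivity), mul_pow, mul_pow, sq_abs, Real.sq_sqrt hd'.le]
  nlinarith

end

lemma exists_lintegral_drift_pow_le : ∃ C : ℝ, 0 < C ∧ ∀ (d : ℕ), 1 ≤ d →
    ∀ (ν : Measure (Vec d)) [IsProbabilityMeasure ν] (e : Vec d → Vec d) (b ℓ ξ s E : ℝ),
    (∀ᵐ w ∂ν, ‖w‖ ≤ 2 * √d) → ∫ w, w ∂ν = 0 → Measurable e → (∀ g, ‖e g‖ ≤ 2 * √d) →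
    b ^ 2 ≤ s → ℓ ^ 2 ≤ s → s * d ≤ 1 / 1024 → 0 ≤ E →
    ∫⁻ g, ‖e g‖ₑ ^ 2 ∂(_root_.stdGaussian d) ≤ ENNReal.ofReal E →
    ∫⁻ g, ‖drift ν e b ℓ ξ g‖ₑ ^ 16 ∂(_root_.stdGaussian d) ≤
      ENNReal.ofReal (C * (s ^ 16 * d ^ 16 + s ^ 4 * d ^ 3 * E + ξ ^ 16 * d ^ 8)) := by
  obtain ⟨A, hA⟩ : ∃ A : ℝ, A = 2 * Real.exp ((2 * (16 : ℕ)) ^ 2 / 2) := ⟨_, rfl⟩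
  have hA0 : 0 < A := by rw [hA]; positivity
  refine ⟨3 ^ 16 * (4 ^ 16 * A + 4 ^ 7 + 2 * (4 ^ 8 * (Nat.factorial 8))), by positivity, ?_⟩
  intro d hd ν _ e b ℓ ξ s E hν hmean hem he hb hℓ hs hE hEe
  have hd' : (0 : ℝ) < d := by exact_mod_cast hd
  have hs0 : 0 ≤ s := (sq_nonneg b).trans hb
  have hR : ∀ n : ℕ, (2 * √d) ^ (2 * n) = (4 * d : ℝ) ^ n := fun n => by
    rw [pow_mul, mul_pow, Real.sq_sqrt hd'.le]; norm_num
  have hℓR := abs_mul_two_sqrt_le_one hd hℓ hs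
  have hb16 : |b| ^ 16 ≤ s ^ 8 := by
    rw [show |b| ^ 16 = (b ^ 2) ^ 8 by rw [← sq_abs b]; ring]; gcongr
  have hℓ16 : |ℓ| ^ 16 ≤ s ^ 8 := by
    rw [show |ℓ| ^ 16 = (ℓ ^ 2) ^ 8 by rw [← sq_abs ℓ]; ring]; gcongr
  have h1 : ∫⁻ g, ‖tiltMean ν ℓ g‖ₑ ^ 16 ∂(_root_.stdGaussian d) ≤
      ENNReal.ofReal (4 ^ 16 * A * s ^ 8 * d ^ 16) := by
    refine (lintegral_tiltMean_pow_le hν hmean (by positivity) hℓR (n := 16) (by norm_num)).trans ?_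
    refine (mul_le_mul_right (lintegral_enorm_pow_le_of_norm_le (f := fun w => w) hν
      (by positivity) 16 0) _).trans ?_
    simp only [pow_zero, lintegral_const, measure_univ, mul_one]
    rw [← ENNReal.ofReal_mul (by positivity), ← hA]
    apply ENNReal.ofReal_le_ofReal
    rw [show 16 = 2 * 8 by norm_num, hR, show 2 * 8 = 16 by norm_num]
    calc _ = 4 ^ 16 * A * |ℓ| ^ 16 * d ^ 16 := by ring
      _ ≤ _ := by gcongr
  have h2 : ∫⁻ g, ‖e g‖ₑ ^ 16 ∂(_root_.stdGaussian d) ≤ ENNReal.ofReal (4 ^ 7 * d ^ 7 * E) := by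
    refine (lintegral_enorm_pow_le_of_norm_le (.of_forall he) (by positivity) 14 2).trans ?_
    refine (mul_le_mul_right hEe _).trans (le_of_eq ?_)
    rw [← ENNReal.ofReal_mul (by positivity), show 14 = 2 * 7 by norm_num, hR]
    congr 1; ring
  have h3 := lintegral_norm_pow_stdGaussian hd 8
  refine (lintegral_smul_add_add_smul_pow_le measurable_tiltMean hem b ξ 16).trans ?_
  refine (mul_le_mul_right (add_le_add (add_le_add (mul_le_mul_right h1 _)
    (mul_le_mul_right h2 _)) (mul_le_mul_right h3 _)) _).trans ?_
  rw [← ENNReal.ofReal_mul (by positivity), ← ENNReal.ofReal_mul (by positivity),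
    ← ENNReal.ofReal_mul (by positivity), ← ENNReal.ofReal_add (by positivity) (by positivity),
    ← ENNReal.ofReal_add (by positivity) (by positivity), ← ENNReal.ofReal_mul (by positivity)]
  apply ENNReal.ofReal_le_ofReal
  have hξ : |ξ| ^ 16 = ξ ^ 16 := Even.pow_abs (by decide) ξ
  have k1 : |b| ^ 16 * (4 ^ 16 * A * s ^ 8 * d ^ 16) ≤ 4 ^ 16 * A * (s ^ 16 * d ^ 16) := by
    calc _ ≤ s ^ 8 * (4 ^ 16 * A * s ^ 8 * d ^ 16) := by gcongr
      _ = _ := by ring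
  have k2 : |b| ^ 16 * (4 ^ 7 * d ^ 7 * E) ≤ 4 ^ 7 * (s ^ 4 * d ^ 3 * E) := by
    calc _ ≤ s ^ 8 * (4 ^ 7 * d ^ 7 * E) := by gcongr
      _ = (s * d) ^ 4 * (4 ^ 7 * (s ^ 4 * d ^ 3 * E)) := by ring
      _ ≤ 1 * (4 ^ 7 * (s ^ 4 * d ^ 3 * E)) := by
          gcongr; exact pow_le_one₀ (by positivity) (by linarith)
      _ = _ := one_mul _
  have p1 : 0 ≤ s ^ 16 * (d : ℝ) ^ 16 := by positivity
  have p2 : 0 ≤ s ^ 4 * (d : ℝ) ^ 3 * E := by positivity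
  have p3 : 0 ≤ ξ ^ 16 * (d : ℝ) ^ 8 := mul_nonneg (Even.pow_nonneg (by decide) _) (by positivity)
  rw [hξ]
  refine le_trans (mul_le_mul_of_nonneg_left ?_ (by positivity)) (le_of_eq (mul_assoc _ _ _).symm)
  have q1 := mul_nonneg hA0.le p1
  have q2 := mul_nonneg hA0.le p2
  have q3 := mul_nonneg hA0.le p3
  norm_num [Nat.factorial] at *
  nlinarith

lemma exists_lintegral_driftRem_pow_le : ∃ C : ℝ, 0 < C ∧ ∀ (d : ℕ), 1 ≤ d →
    ∀ (ν : Measure (Vec d)) [IsProbabilityMeasure ν] (e : Vec d → Vec d) (b ℓ ξ s E V : ℝ),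
    (∀ᵐ w ∂ν, ‖w‖ ≤ 2 * √d) → ∫ w, w ∂ν = 0 → Measurable e → (∀ g, ‖e g‖ ≤ 2 * √d) →
    b ^ 2 ≤ s → ℓ ^ 2 ≤ s → s * d ≤ 1 / 1024 → 0 ≤ E → 0 ≤ V →
    ∫⁻ g, ‖e g‖ₑ ^ 2 ∂(_root_.stdGaussian d) ≤ ENNReal.ofReal E →
    ∫⁻ w, ‖w‖ₑ ^ 4 ∂ν ≤ ENNReal.ofReal V →
    ∫⁻ g, ‖driftRem ν e b ℓ ξ g‖ₑ ^ 4 ∂(_root_.stdGaussian d) ≤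
      ENNReal.ofReal (C * (s ^ 6 * d ^ 4 * V + s ^ 2 * d * E + ξ ^ 4 * d ^ 2)) := by
  obtain ⟨A, hA⟩ : ∃ A : ℝ, A = 2 * Real.exp ((2 * (2 * 4 : ℕ)) ^ 2 / 2) := ⟨_, rfl⟩
  have hA0 : 0 < A := by rw [hA]; positivity
  refine ⟨3 ^ 4 * (4 ^ 6 * A + 4 + 2 * (4 ^ 2 * (Nat.factorial 2))), by positivity, ?_⟩
  intro d hd ν _ e b ℓ ξ s E V hν hmean hem he hb hℓ hs hE hV hEe hVe
  have hd' : (0 : ℝ) < d := by exact_mod_cast hd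
  have hs0 : 0 ≤ s := (sq_nonneg b).trans hb
  have hR : ∀ n : ℕ, (2 * √d) ^ (2 * n) = (4 * d : ℝ) ^ n := fun n => by
    rw [pow_mul, mul_pow, Real.sq_sqrt hd'.le]; norm_num
  have hℓR := abs_mul_two_sqrt_le_one hd hℓ hs
  have hb4 : |b| ^ 4 ≤ s ^ 2 := by
    rw [show |b| ^ 4 = (b ^ 2) ^ 2 by rw [← sq_abs b]; ring]; gcongr
  have hℓ8 : |ℓ| ^ 8 ≤ s ^ 4 := by
    rw [show |ℓ| ^ 8 = (ℓ ^ 2) ^ 4 by rw [← sq_abs ℓ]; ring]; gcongr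
  have h1 : ∫⁻ g, ‖tiltMean ν ℓ g - ℓ • covApply ν g‖ₑ ^ 4 ∂(_root_.stdGaussian d) ≤
      ENNReal.ofReal (4 ^ 6 * A * s ^ 4 * d ^ 4 * V) := by
    refine (lintegral_tiltMean_sub_pow_le hν hmean (by positivity) hℓR (n := 4)
      (by norm_num)).trans ?_
    refine (mul_le_mul_right (lintegral_enorm_pow_le_of_norm_le (f := fun w => w) hν
      (by positivity) 4 4) _).trans ?_
    refine (mul_le_mul_right (mul_le_mul_right hVe _) _).trans ?_
    rw [← ENNReal.ofReal_mul (by positivity), ← ENNReal.ofReal_mul (by positivity), ← hA]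
    apply ENNReal.ofReal_le_ofReal
    have := hR 2
    norm_num at this
    rw [mul_pow 2 (2 * √d) 4, this]
    norm_num
    calc _ = 4096 * A * |ℓ| ^ 8 * d ^ 4 * V := by ring
      _ ≤ _ := by gcongr
  have h2 : ∫⁻ g, ‖e g‖ₑ ^ 4 ∂(_root_.stdGaussian d) ≤ ENNReal.ofReal (4 * d * E) := by
    refine (lintegral_enorm_pow_le_of_norm_le (.of_forall he) (by positivity) 2 2).trans ?_
    refine (mul_le_mul_right hEe _).trans (le_of_eq ?_)
    have := hR 1
    norm_num at this
    rw [← ENNReal.ofReal_mul (by positivity), this]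
  have h3 := lintegral_norm_pow_stdGaussian hd 2
  refine (lintegral_smul_add_add_smul_pow_le
    (X := fun g => tiltMean ν ℓ g - ℓ • covApply ν g)
    (measurable_tiltMean.sub (measurable_covApply.const_smul ℓ)) hem b ξ 4).trans ?_
  refine (mul_le_mul_right (add_le_add (add_le_add (mul_le_mul_right h1 _)
    (mul_le_mul_right h2 _)) (mul_le_mul_right h3 _)) _).trans ?_
  rw [← ENNReal.ofReal_mul (by positivity), ← ENNReal.ofReal_mul (by positivity),
    ← ENNReal.ofReal_mul (by positivity), ← ENNReal.ofReal_add (by positivity) (by positivity),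
    ← ENNReal.ofReal_add (by positivity) (by positivity), ← ENNReal.ofReal_mul (by positivity)]
  apply ENNReal.ofReal_le_ofReal
  have hξ : |ξ| ^ 4 = ξ ^ 4 := Even.pow_abs (by decide) ξ
  have k1 : |b| ^ 4 * (4 ^ 6 * A * s ^ 4 * d ^ 4 * V) ≤ 4 ^ 6 * A * (s ^ 6 * d ^ 4 * V) := by
    calc _ ≤ s ^ 2 * (4 ^ 6 * A * s ^ 4 * d ^ 4 * V) := by gcongr
      _ = _ := by ring
  have k2 : |b| ^ 4 * (4 * d * E) ≤ 4 * (s ^ 2 * d * E) := by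
    calc _ ≤ s ^ 2 * (4 * d * E) := by gcongr
      _ = _ := by ring
  have p1 : 0 ≤ s ^ 6 * (d : ℝ) ^ 4 * V := by positivity
  have p2 : 0 ≤ s ^ 2 * (d : ℝ) * E := by positivity
  have p3 : 0 ≤ ξ ^ 4 * (d : ℝ) ^ 2 := mul_nonneg (Even.pow_nonneg (by decide) _) (by positivity)
  rw [hξ]
  refine le_trans (mul_le_mul_of_nonneg_left ?_ (by positivity)) (le_of_eq (mul_assoc _ _ _).symm)
  have q2 := mul_nonneg hA0.le p2
  have q3 := mul_nonneg hA0.le p3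
  norm_num [Nat.factorial] at *
  nlinarith

/-- The density, in whitened coordinates, of one exact reverse step with posterior `ν`. -/
def trueDensity (ν : Measure (Vec d)) (β₀ : ℝ) (x : Vec d) : ℝ≥0∞ :=
  ∫⁻ w, ENNReal.ofReal (Real.exp (β₀ * ⟪w, x⟫ - (β₀ * ‖w‖) ^ 2 / 2)) ∂ν

/-- The Cameron–Martin weight of one sampler step. -/
def stepWeight (D : Vec d → Vec d) (α β : ℝ) (x x' : Vec d) : ℝ :=
  Real.exp (⟪D (α • x + β • x'), β • x - α • x'⟫ - ‖D (α • x + β • x')‖ ^ 2 / 2)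

/-- The density, in whitened coordinates, of one sampler step. -/
def stepDensity (D : Vec d → Vec d) (α β : ℝ) (x : Vec d) : ℝ≥0∞ :=
  ∫⁻ x', ENNReal.ofReal (stepWeight D α β x x') ∂(_root_.stdGaussian d)

lemma lintegral_lintegral_reflection {α β : ℝ} (h : α ^ 2 + β ^ 2 = 1)
    {F : Vec d → Vec d → ℝ≥0∞} (hF : Measurable (Function.uncurry F)) :
    ∫⁻ x, ∫⁻ x', F (α • x + β • x') (β • x - α • x') ∂(_root_.stdGaussian d)
        ∂(_root_.stdGaussian d) =
      ∫⁻ g₁, ∫⁻ g₂, F g₁ g₂ ∂(_root_.stdGaussian d) ∂(_root_.stdGaussian d) := by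
  have e1 := lintegral_prod (μ := _root_.stdGaussian d) (ν := _root_.stdGaussian d)
    (Function.uncurry F) hF.aemeasurable
  have hm : Measurable (fun p : Vec d × Vec d => (α • p.1 + β • p.2, β • p.1 - α • p.2)) := by
    fun_prop
  have e2 := lintegral_prod (μ := _root_.stdGaussian d) (ν := _root_.stdGaussian d)
    (fun p : Vec d × Vec d => Function.uncurry F (α • p.1 + β • p.2, β • p.1 - α • p.2))
    (hF.comp hm).aemeasurable
  rw [← lintegral_map hF hm, map_reflection_stdGaussian h, e1] at e2
  exact e2.symm

lemma lintegral_exp_inner_sub_stdGaussian (w : Vec d) :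
    ∫⁻ x, ENNReal.ofReal (Real.exp (⟪w, x⟫ - ‖w‖ ^ 2 / 2)) ∂(_root_.stdGaussian d) = 1 := by
  have h := lintegral_stdGaussian_add w (f := fun _ => 1) measurable_const
  simpa using h.symm

lemma measurable_trueDensity {ν : Measure (Vec d)} [SFinite ν] {β₀ : ℝ} :
    Measurable (trueDensity ν β₀) := by
  unfold trueDensity
  exact Measurable.lintegral_prod_right (by fun_prop)

lemma lintegral_trueDensity (ν : Measure (Vec d)) [IsProbabilityMeasure ν] (β₀ : ℝ) :
    ∫⁻ x, trueDensity ν β₀ x ∂(_root_.stdGaussian d) = 1 := by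
  unfold trueDensity
  rw [lintegral_lintegral_swap (by fun_prop)]
  have : ∀ w : Vec d, ∫⁻ x, ENNReal.ofReal (Real.exp (β₀ * ⟪w, x⟫ - (β₀ * ‖w‖) ^ 2 / 2))
      ∂(_root_.stdGaussian d) = 1 := by
    intro w
    rw [← lintegral_exp_inner_sub_stdGaussian (β₀ • w)]
    simp only [inner_smul_left, norm_smul, mul_pow, Real.norm_eq_abs, sq_abs]
    rfl
  simp [this]

section

variable {D : Vec d → Vec d} {α β : ℝ}

lemma measurable_stepWeight (hD : Measurable D) :
    Measurable (fun p : Vec d × Vec d => stepWeight D α β p.1 p.2) := by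
  unfold stepWeight
  fun_prop

lemma measurable_stepDensity (hD : Measurable D) : Measurable (stepDensity D α β) := by
  unfold stepDensity
  exact Measurable.lintegral_prod_right (measurable_stepWeight hD).ennreal_ofReal

lemma stepWeight_pos (x x' : Vec d) : 0 < stepWeight D α β x x' := Real.exp_pos _

lemma stepDensity_ne_zero (hD : Measurable D) (x : Vec d) : stepDensity D α β x ≠ 0 := by
  unfold stepDensity
  have hm : Measurable (fun x' => ENNReal.ofReal (stepWeight D α β x x')) :=
    ((measurable_stepWeight hD).comp (measurable_const.prodMk measurable_id)).ennreal_ofReal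
  rw [Ne, lintegral_eq_zero_iff hm]
  intro h
  have : ∀ᵐ x' ∂(_root_.stdGaussian d), False := by
    filter_upwards [h] with x' hx'
    simp [(stepWeight_pos x x').not_ge] at hx'
  simp only [Filter.eventually_false_iff_eq_bot, ae_eq_bot] at this
  exact IsProbabilityMeasure.ne_zero (_root_.stdGaussian d) this

lemma lintegral_stepDensity (hD : Measurable D) (h : α ^ 2 + β ^ 2 = 1) :
    ∫⁻ x, stepDensity D α β x ∂(_root_.stdGaussian d) = 1 := by
  unfold stepDensity stepWeight
  rw [lintegral_lintegral_reflection h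
    (F := fun g₁ g₂ => ENNReal.ofReal (Real.exp (⟪D g₁, g₂⟫ - ‖D g₁‖ ^ 2 / 2)))
    (by simp only [Function.uncurry_def]; fun_prop)]
  simp [lintegral_exp_inner_sub_stdGaussian]

lemma lintegral_inv_stepDensity_sq_le (hD : Measurable D) (h : α ^ 2 + β ^ 2 = 1) :
    ∫⁻ x, (stepDensity D α β x)⁻¹ ^ 2 ∂(_root_.stdGaussian d) ≤
      ∫⁻ g, ENNReal.ofReal (Real.exp (3 * ‖D g‖ ^ 2)) ∂(_root_.stdGaussian d) := by
  calc _ ≤ ∫⁻ x, ∫⁻ x', (ENNReal.ofReal (stepWeight D α β x x'))⁻¹ ^ 2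
        ∂(_root_.stdGaussian d) ∂(_root_.stdGaussian d) := by
        apply lintegral_mono; intro x
        have hm : Measurable (fun x' => ENNReal.ofReal (stepWeight D α β x x')) :=
          ((measurable_stepWeight hD).comp (measurable_const.prodMk measurable_id)).ennreal_ofReal
        exact inv_lintegral_sq_le _ hm.aemeasurable
          (fun x' => by simp [stepWeight_pos]) (fun _ => ENNReal.ofReal_ne_top)
    _ = ∫⁻ x, ∫⁻ x', ENNReal.ofReal (Real.exp (⟪(-2 : ℝ) • D (α • x + β • x'), β • x - α • x'⟫
          + ‖D (α • x + β • x')‖ ^ 2)) ∂(_root_.stdGaussian d) ∂(_root_.stdGaussian d) := by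
        congr with x; congr with x'
        unfold stepWeight
        rw [← ENNReal.ofReal_inv_of_pos (Real.exp_pos _), ← Real.exp_neg,
          ← ENNReal.ofReal_pow (Real.exp_pos _).le, ← Real.exp_nat_mul, inner_smul_left]
        congr 2
        simp only [conj_trivial]; push_cast; ring
    _ = ∫⁻ g₁, ∫⁻ g₂, ENNReal.ofReal (Real.exp (⟪(-2 : ℝ) • D g₁, g₂⟫ + ‖D g₁‖ ^ 2))
          ∂(_root_.stdGaussian d) ∂(_root_.stdGaussian d) :=
        lintegral_lintegral_reflection h
          (F := fun g₁ g₂ => ENNReal.ofReal (Real.exp (⟪(-2 : ℝ) • D g₁, g₂⟫ + ‖D g₁‖ ^ 2)))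
          (by simp only [Function.uncurry_def]; fun_prop)
    _ = _ := by
        congr with g
        simp_rw [Real.exp_add, ENNReal.ofReal_mul (Real.exp_pos _).le]
        rw [lintegral_mul_const _ (by fun_prop), lintegral_exp_inner_stdGaussian,
          ← ENNReal.ofReal_mul (Real.exp_pos _).le, ← Real.exp_add, norm_smul]
        congr 2
        norm_num; ring

end

lemma lintegral_enorm_integral_pow_le {Ω Ω' : Type*} [MeasurableSpace Ω] [MeasurableSpace Ω']
    (μ : Measure Ω) (ν : Measure Ω') [IsProbabilityMeasure ν] {f : Ω → Ω' → ℝ}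
    (hf : Measurable (Function.uncurry f)) {n : ℕ} (hn : 1 ≤ n) :
    ∫⁻ x, ‖∫ y, f x y ∂ν‖ₑ ^ n ∂μ ≤ ∫⁻ x, ∫⁻ y, ‖f x y‖ₑ ^ n ∂ν ∂μ := by
  apply lintegral_mono; intro x
  have hm : Measurable (fun y => f x y) := hf.comp (measurable_const.prodMk measurable_id)
  exact (pow_le_pow_left₀ (zero_le) (enorm_integral_le_lintegral_enorm _) n).trans
    (lintegral_pow_le_of_isProbabilityMeasure ν hm.enorm.aemeasurable hn)

lemma ae_integrable_of_lintegral_pow {Ω Ω' : Type*} [MeasurableSpace Ω] [MeasurableSpace Ω']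
    (μ : Measure Ω) (ν : Measure Ω') [IsProbabilityMeasure ν] {f : Ω → Ω' → ℝ}
    (hf : Measurable (Function.uncurry f)) {n : ℕ} (hn : 1 ≤ n)
    (h : ∫⁻ x, ∫⁻ y, ‖f x y‖ₑ ^ n ∂ν ∂μ ≠ ∞) : ∀ᵐ x ∂μ, Integrable (f x) ν := by
  filter_upwards [ae_lt_top (Measurable.lintegral_prod_right (hf.enorm.pow_const n)) h] with x hx
  have hm : Measurable (fun y => f x y) := hf.comp (measurable_const.prodMk measurable_id)
  refine ⟨hm.aestronglyMeasurable, ?_⟩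
  have h1 := lintegral_pow_le_of_isProbabilityMeasure ν hm.enorm.aemeasurable hn
  have h2 := h1.trans_lt hx
  rw [hasFiniteIntegral_def]
  by_contra h3
  rw [not_lt, top_le_iff] at h3
  rw [h3, ENNReal.top_pow (by omega)] at h2
  exact lt_irrefl _ h2

lemma integral_stdGaussian_inner (w : Vec d) {f : ℝ → ℝ} (hf : Continuous f) :
    ∫ x, f ⟪w, x⟫ ∂(_root_.stdGaussian d) = ∫ t, f (‖w‖ * t) ∂(gaussianReal 0 1) := by
  rw [← integral_map (f := f) (φ := fun x : Vec d => ⟪w, x⟫) (by fun_prop) (by fun_prop),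
    map_inner_stdGaussian, integral_map (by fun_prop) (by fun_prop)]

lemma integral_sq_gaussianReal : ∫ t, t ^ 2 ∂(gaussianReal 0 1) = 1 := by
  have h := variance_eq_sub (memLp_id_gaussianReal (μ := 0) (v := 1) 2)
  rw [variance_id_gaussianReal] at h
  simpa [integral_id_gaussianReal] using h.symm

lemma integral_inner_stdGaussian (w : Vec d) : ∫ x, ⟪w, x⟫ ∂(_root_.stdGaussian d) = 0 := by
  rw [integral_stdGaussian_inner w (f := fun z => z) (by fun_prop), integral_const_mul,
    integral_id_gaussianReal, mul_zero]

lemma integral_inner_sq_stdGaussian (w : Vec d) :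
    ∫ x, ⟪w, x⟫ ^ 2 ∂(_root_.stdGaussian d) = ‖w‖ ^ 2 := by
  rw [integral_stdGaussian_inner w (f := fun z => z ^ 2) (by fun_prop)]
  simp_rw [mul_pow]
  rw [integral_const_mul, integral_sq_gaussianReal, mul_one]

lemma integrable_norm_sq_stdGaussian : Integrable (fun x => ‖x‖ ^ 2) (_root_.stdGaussian d) := by
  rcases Nat.eq_zero_or_pos d with rfl | hd
  · have : ∀ x : Vec 0, ‖x‖ ^ 2 = 0 := fun x => by simp [Subsingleton.elim x 0]
    simp [this]
  refine ⟨by fun_prop, ?_⟩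
  rw [hasFiniteIntegral_def]
  have h := lintegral_norm_pow_stdGaussian hd 1
  simp only [mul_one] at h
  refine lt_of_le_of_lt (le_of_eq ?_) (h.trans_lt ENNReal.ofReal_lt_top)
  congr with x
  rw [enorm_pow, enorm_norm]

lemma integrable_inner_sq_stdGaussian (w : Vec d) :
    Integrable (fun x => ⟪w, x⟫ ^ 2) (_root_.stdGaussian d) := by
  refine (integrable_norm_sq_stdGaussian.const_mul (‖w‖ ^ 2)).mono' (by fun_prop)
    (.of_forall fun x => ?_)
  rw [Real.norm_eq_abs, abs_of_nonneg (sq_nonneg _), ← mul_pow, ← sq_abs]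
  gcongr
  exact abs_real_inner_le_norm w x

lemma integrable_inner_stdGaussian (w : Vec d) :
    Integrable (fun x => ⟪w, x⟫) (_root_.stdGaussian d) := by
  refine ((integrable_const (1 : ℝ)).add (integrable_inner_sq_stdGaussian w)).mono' (by fun_prop)
    (.of_forall fun x => ?_)
  rw [Real.norm_eq_abs]
  simp only [Pi.add_apply]
  nlinarith [sq_abs (⟪w, x⟫ : ℝ), sq_nonneg (|(⟪w, x⟫ : ℝ)| - 1)]

section

variable {ν : Measure (Vec d)} [IsProbabilityMeasure ν] {R α β : ℝ}

lemma inner_covApply (hν : ∀ᵐ w ∂ν, ‖w‖ ≤ R) (g h : Vec d) :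
    ⟪covApply ν g, h⟫ = ∫ w, ⟪w, g⟫ * ⟪w, h⟫ ∂ν := by
  unfold covApply
  rw [real_inner_comm, ← integral_inner (integrable_of_continuous_of_bounded_support hν
      (by fun_prop))]
  congr with w
  rw [inner_smul_right, real_inner_comm w h]

lemma integrable_prod_inner_mul_inner (hν : ∀ᵐ w ∂ν, ‖w‖ ≤ R) (hR : 0 ≤ R) (x : Vec d) :
    Integrable (Function.uncurry fun (x' w : Vec d) =>
      (⟪w, α • x + β • x'⟫ : ℝ) * ⟪w, β • x - α • x'⟫) ((_root_.stdGaussian d).prod ν) := by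
  have hb : Integrable (fun p : Vec d × Vec d =>
      2 * R ^ 2 * (((|α| + |β|) * ‖x‖) ^ 2 + (|α| + |β|) ^ 2 * ‖p.1‖ ^ 2))
      ((_root_.stdGaussian d).prod ν) :=
    (((integrable_const _).add (integrable_norm_sq_stdGaussian.const_mul _)).const_mul _).comp_fst ν
  refine hb.mono' (by simp only [Function.uncurry_def]; fun_prop) ?_
  have hν' : ∀ᵐ p ∂((_root_.stdGaussian d).prod ν), ‖p.2‖ ≤ R :=
    Measure.quasiMeasurePreserving_snd.ae hν
  filter_upwards [hν'] with p hp
  have ha := abs_nonneg α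
  have hb := abs_nonneg β
  have hx := norm_nonneg x
  have hx' := norm_nonneg p.1
  have h1 : ‖α • x + β • p.1‖ ≤ (|α| + |β|) * ‖x‖ + (|α| + |β|) * ‖p.1‖ := by
    refine (norm_add_le _ _).trans ?_
    rw [norm_smul, norm_smul, Real.norm_eq_abs, Real.norm_eq_abs]
    nlinarith
  have h2 : ‖β • x - α • p.1‖ ≤ (|α| + |β|) * ‖x‖ + (|α| + |β|) * ‖p.1‖ := by
    refine (norm_sub_le _ _).trans ?_
    rw [norm_smul, norm_smul, Real.norm_eq_abs, Real.norm_eq_abs]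
    nlinarith
  simp only [Function.uncurry_def, norm_mul]
  calc _ ≤ (R * ((|α| + |β|) * ‖x‖ + (|α| + |β|) * ‖p.1‖)) *
        (R * ((|α| + |β|) * ‖x‖ + (|α| + |β|) * ‖p.1‖)) := by
        gcongr
        · exact (norm_inner_le_norm _ _).trans (by gcongr)
        · exact (norm_inner_le_norm _ _).trans (by gcongr)
    _ = R ^ 2 * ((|α| + |β|) * ‖x‖ + (|α| + |β|) * ‖p.1‖) ^ 2 := by ring
    _ ≤ R ^ 2 * (2 * (((|α| + |β|) * ‖x‖) ^ 2 + ((|α| + |β|) * ‖p.1‖) ^ 2)) := by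
        gcongr; exact add_sq_le
    _ = _ := by ring

lemma integrable_inner_covApply (hν : ∀ᵐ w ∂ν, ‖w‖ ≤ R) (hR : 0 ≤ R) (x : Vec d) :
    Integrable (fun x' => (⟪covApply ν (α • x + β • x'), β • x - α • x'⟫ : ℝ))
      (_root_.stdGaussian d) := by
  simp_rw [inner_covApply hν]
  exact (integrable_prod_inner_mul_inner hν hR x).integral_prod_left

lemma integral_inner_covApply (hν : ∀ᵐ w ∂ν, ‖w‖ ≤ R) (hR : 0 ≤ R) (x : Vec d) :
    ∫ x', (⟪covApply ν (α • x + β • x'), β • x - α • x'⟫ : ℝ) ∂(_root_.stdGaussian d) =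
      α * β * ∫ w, (⟪w, x⟫ ^ 2 - ‖w‖ ^ 2) ∂ν := by
  simp_rw [inner_covApply hν]
  rw [integral_integral_swap (integrable_prod_inner_mul_inner hν hR x), ← integral_const_mul]
  congr with w
  have e : ∀ x' : Vec d, (⟪w, α • x + β • x'⟫ : ℝ) * ⟪w, β • x - α • x'⟫ =
      α * β * ⟪w, x⟫ ^ 2 + (β ^ 2 - α ^ 2) * ⟪w, x⟫ * ⟪w, x'⟫ - α * β * ⟪w, x'⟫ ^ 2 := by
    intro x'
    simp only [inner_add_right, inner_sub_right, inner_smul_right]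
    ring
  simp_rw [e]
  have i1 := (integrable_inner_stdGaussian w).const_mul ((β ^ 2 - α ^ 2) * ⟪w, x⟫)
  have i2 := (integrable_inner_sq_stdGaussian w).const_mul (α * β)
  have i3 : Integrable (fun x' => α * β * ⟪w, x⟫ ^ 2 + (β ^ 2 - α ^ 2) * ⟪w, x⟫ * ⟪w, x'⟫)
      (_root_.stdGaussian d) := (integrable_const _).add i1
  rw [integral_sub i3 i2, integral_add (integrable_const _) i1,
    integral_const, integral_const_mul, integral_const_mul, integral_inner_stdGaussian,
    integral_inner_sq_stdGaussian]
  simp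
  ring

end

section

variable {ν : Measure (Vec d)} [IsProbabilityMeasure ν] {e : Vec d → Vec d}
  {R α β β₀ b ℓ ξ s : ℝ}

lemma toReal_trueDensity (hν : ∀ᵐ w ∂ν, ‖w‖ ≤ R) (x : Vec d) :
    (trueDensity ν β₀ x).toReal = ∫ w, Real.exp (β₀ * ⟪w, x⟫ - (β₀ * ‖w‖) ^ 2 / 2) ∂ν := by
  unfold trueDensity
  rw [← ofReal_integral_eq_lintegral_ofReal
    (integrable_of_continuous_of_bounded_support hν (by fun_prop))
    (.of_forall fun w => (Real.exp_pos _).le), ENNReal.toReal_ofReal]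
  exact integral_nonneg fun w => (Real.exp_pos _).le

lemma toReal_trueDensity_sub_one (hν : ∀ᵐ w ∂ν, ‖w‖ ≤ R) (hmean : ∫ w, w ∂ν = 0) (x : Vec d) :
    (trueDensity ν β₀ x).toReal - 1 =
      ∫ w, (Real.exp (β₀ * ⟪w, x⟫ - (β₀ * ‖w‖) ^ 2 / 2) - 1 - β₀ * ⟪w, x⟫
        - β₀ ^ 2 / 2 * (⟪w, x⟫ ^ 2 - ‖w‖ ^ 2)) ∂ν
      + β₀ ^ 2 / 2 * ∫ w, (⟪w, x⟫ ^ 2 - ‖w‖ ^ 2) ∂ν := by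
  have hi : ∀ {f : Vec d → ℝ}, Continuous f → Integrable f ν :=
    fun hf => integrable_of_continuous_of_bounded_support hν hf
  rw [toReal_trueDensity hν, integral_sub (hi (by fun_prop)) (hi (by fun_prop)),
    integral_sub (hi (by fun_prop)) (hi (by fun_prop)),
    integral_sub (hi (by fun_prop)) (hi (by fun_prop)), integral_const_mul, integral_const_mul,
    integral_inner_eq_zero hν hmean]
  simp

lemma trueDensity_sub_stepDensity (hν : ∀ᵐ w ∂ν, ‖w‖ ≤ R) (hR : 0 ≤ R) (hmean : ∫ w, w ∂ν = 0)
    (x : Vec d)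
    (hN : Integrable (stepWeight (drift ν e b ℓ ξ) α β x) (_root_.stdGaussian d))
    (hρ : Integrable (fun x' => (⟪driftRem ν e b ℓ ξ (α • x + β • x'), β • x - α • x'⟫ : ℝ))
      (_root_.stdGaussian d)) :
    (trueDensity ν β₀ x).toReal - (stepDensity (drift ν e b ℓ ξ) α β x).toReal =
      ∫ w, (Real.exp (β₀ * ⟪w, x⟫ - (β₀ * ‖w‖) ^ 2 / 2) - 1 - β₀ * ⟪w, x⟫
        - β₀ ^ 2 / 2 * (⟪w, x⟫ ^ 2 - ‖w‖ ^ 2)) ∂ν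
      + (β₀ ^ 2 / 2 - b * ℓ * (α * β)) * ∫ w, (⟪w, x⟫ ^ 2 - ‖w‖ ^ 2) ∂ν
      - ∫ x', (stepWeight (drift ν e b ℓ ξ) α β x x' - 1
          - ⟪drift ν e b ℓ ξ (α • x + β • x'), β • x - α • x'⟫) ∂(_root_.stdGaussian d)
      - ∫ x', ⟪driftRem ν e b ℓ ξ (α • x + β • x'), β • x - α • x'⟫ ∂(_root_.stdGaussian d) := by
  have hp : (stepDensity (drift ν e b ℓ ξ) α β x).toReal =
      ∫ x', stepWeight (drift ν e b ℓ ξ) α β x x' ∂(_root_.stdGaussian d) := by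
    unfold stepDensity
    rw [← ofReal_integral_eq_lintegral_ofReal hN (.of_forall fun x' => (stepWeight_pos x x').le),
      ENNReal.toReal_ofReal]
    exact integral_nonneg fun x' => (stepWeight_pos x x').le
  have hc := (integrable_inner_covApply (α := α) (β := β) hν hR x).const_mul (b * ℓ)
  have hDe : ∀ x', (⟪drift ν e b ℓ ξ (α • x + β • x'), β • x - α • x'⟫ : ℝ) =
      b * ℓ * ⟪covApply ν (α • x + β • x'), β • x - α • x'⟫ +
        ⟪driftRem ν e b ℓ ξ (α • x + β • x'), β • x - α • x'⟫ := by
    intro x'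
    rw [drift_eq, inner_add_left, inner_smul_left]; rfl
  have hD : Integrable (fun x' => (⟪drift ν e b ℓ ξ (α • x + β • x'), β • x - α • x'⟫ : ℝ))
      (_root_.stdGaussian d) := by
    simp_rw [hDe]; exact hc.add hρ
  have hDi : ∫ x', (⟪drift ν e b ℓ ξ (α • x + β • x'), β • x - α • x'⟫ : ℝ)
      ∂(_root_.stdGaussian d) = b * ℓ * (α * β * ∫ w, (⟪w, x⟫ ^ 2 - ‖w‖ ^ 2) ∂ν) +
      ∫ x', ⟪driftRem ν e b ℓ ξ (α • x + β • x'), β • x - α • x'⟫ ∂(_root_.stdGaussian d) := by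
    simp_rw [hDe]
    rw [integral_add hc hρ, integral_const_mul, integral_inner_covApply hν hR]
  have hF : ∫ x', (stepWeight (drift ν e b ℓ ξ) α β x x' - 1
          - ⟪drift ν e b ℓ ξ (α • x + β • x'), β • x - α • x'⟫) ∂(_root_.stdGaussian d) =
      (stepDensity (drift ν e b ℓ ξ) α β x).toReal - 1 -
        (b * ℓ * (α * β * ∫ w, (⟪w, x⟫ ^ 2 - ‖w‖ ^ 2) ∂ν) +
      ∫ x', ⟪driftRem ν e b ℓ ξ (α • x + β • x'), β • x - α • x'⟫ ∂(_root_.stdGaussian d)) := by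
    have hN1 : Integrable (fun x' => stepWeight (drift ν e b ℓ ξ) α β x x' - 1)
        (_root_.stdGaussian d) := hN.sub (integrable_const _)
    rw [integral_sub hN1 hD,
      integral_sub hN (integrable_const _), hDi, hp]
    simp
  have hq := toReal_trueDensity_sub_one (β₀ := β₀) hν hmean x
  rw [hF]
  linarith

lemma lintegral_inner_driftRem_pow_le (hem : Measurable e) (h : α ^ 2 + β ^ 2 = 1) :
    ∫⁻ x, ∫⁻ x', ‖(⟪driftRem ν e b ℓ ξ (α • x + β • x'), β • x - α • x'⟫ : ℝ)‖ₑ ^ 4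
        ∂(_root_.stdGaussian d) ∂(_root_.stdGaussian d) ≤
      ENNReal.ofReal (2 * Real.exp 8) *
        ∫⁻ g, ‖driftRem ν e b ℓ ξ g‖ₑ ^ 4 ∂(_root_.stdGaussian d) := by
  rw [lintegral_lintegral_reflection h
    (F := fun g₁ g₂ => ‖(⟪driftRem ν e b ℓ ξ g₁, g₂⟫ : ℝ)‖ₑ ^ 4)
    (by simp only [Function.uncurry_def]; fun_prop), ← lintegral_const_mul _ (by fun_prop)]
  apply lintegral_mono; intro g
  refine (lintegral_inner_pow_four_le _).trans (le_of_eq ?_)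
  rw [ENNReal.ofReal_mul (by positivity), ENNReal.ofReal_pow (norm_nonneg _), ofReal_norm]

lemma lintegral_stepWeight_remainder_pow_le (hd : 1 ≤ d) (hν : ∀ᵐ w ∂ν, ‖w‖ ≤ 2 * √d)
    (hem : Measurable e) (he : ∀ g, ‖e g‖ ≤ 2 * √d) (hb : b ^ 2 ≤ s)
    (hs : s * d ≤ 1 / 1024) (hξ : ξ ^ 2 * d ≤ 1 / 256) (h : α ^ 2 + β ^ 2 = 1) :
    ∫⁻ x, ∫⁻ x', ‖stepWeight (drift ν e b ℓ ξ) α β x x' - 1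
          - ⟪drift ν e b ℓ ξ (α • x + β • x'), β • x - α • x'⟫‖ₑ ^ 4
        ∂(_root_.stdGaussian d) ∂(_root_.stdGaussian d) ≤
      ENNReal.ofReal (512 * Real.exp 64) *
        ((∫⁻ g, ‖drift ν e b ℓ ξ g‖ₑ ^ 16 ∂(_root_.stdGaussian d)) ^ (1 / 2 : ℝ) *
          ENNReal.ofReal (2 * Real.exp 1) ^ (1 / 2 : ℝ)) := by
  unfold stepWeight
  rw [lintegral_lintegral_reflection h
    (F := fun g₁ g₂ => ‖Real.exp (⟪drift ν e b ℓ ξ g₁, g₂⟫ - ‖drift ν e b ℓ ξ g₁‖ ^ 2 / 2) - 1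
      - ⟪drift ν e b ℓ ξ g₁, g₂⟫‖ₑ ^ 4) (by simp only [Function.uncurry_def]; fun_prop)]
  calc _ ≤ ∫⁻ g, ENNReal.ofReal (512 * Real.exp 64) * (‖drift ν e b ℓ ξ g‖ₑ ^ 8 *
        ENNReal.ofReal (Real.exp (16 * ‖drift ν e b ℓ ξ g‖ ^ 2))) ∂(_root_.stdGaussian d) := by
        apply lintegral_mono; intro g
        refine (lintegral_exp_inner_remainder_le _).trans (le_of_eq ?_)
        dsimp only
        rw [ENNReal.ofReal_mul (p := 512 * Real.exp 64) (by positivity),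
          ENNReal.ofReal_mul (p := ‖drift ν e b ℓ ξ g‖ ^ 8) (by positivity),
          ENNReal.ofReal_pow (norm_nonneg _), ofReal_norm]
    _ ≤ _ := by
        rw [lintegral_const_mul _ (by fun_prop)]
        gcongr
        refine (lintegral_mul_le_sqrt_mul_sqrt _ (by fun_prop) (by fun_prop)).trans ?_
        simp_rw [← pow_mul]
        gcongr
        refine le_trans (le_of_eq ?_)
          (lintegral_exp_norm_drift_sq_le (c := 32) (ℓ := ℓ) (ξ := ξ) hd hν he hb
              (by norm_num) hs hξ)
        congr with g
        rw [← ENNReal.ofReal_pow (Real.exp_pos _).le, ← Real.exp_nat_mul]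
        congr 2; push_cast; ring

lemma lintegral_integral_hermiteTwo_remainder_le (hd : 1 ≤ d) (hν : ∀ᵐ w ∂ν, ‖w‖ ≤ 2 * √d)
    (hβ : 0 ≤ β₀) (hβs : β₀ ^ 2 ≤ s) (hs : s * d ≤ 1 / 1024) {V : ℝ} (hV : 0 ≤ V)
    (hVe : ∫⁻ w, ‖w‖ₑ ^ 4 ∂ν ≤ ENNReal.ofReal V) :
    ∫⁻ x, ‖∫ w, (Real.exp (β₀ * ⟪w, x⟫ - (β₀ * ‖w‖) ^ 2 / 2) - 1 - β₀ * ⟪w, x⟫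
        - β₀ ^ 2 / 2 * (⟪w, x⟫ ^ 2 - ‖w‖ ^ 2)) ∂ν‖ₑ ^ 4 ∂(_root_.stdGaussian d) ≤
      ENNReal.ofReal (4 ^ 8 * (2 * Real.exp (24 ^ 2 / 2)) * (s ^ 6 * d ^ 4 * V)) := by
  have hd' : (0 : ℝ) < d := by exact_mod_cast hd
  have hs0 : 0 ≤ s := (sq_nonneg _).trans hβs
  have h1 := abs_mul_two_sqrt_le_one hd hβs hs
  rw [abs_of_nonneg hβ] at h1
  have h12 : β₀ ^ 12 ≤ s ^ 6 := by rw [show β₀ ^ 12 = (β₀ ^ 2) ^ 6 by ring]; gcongr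
  refine (lintegral_enorm_integral_pow_le _ _ (by simp only [Function.uncurry_def]; fun_prop)
    (by norm_num)).trans ?_
  rw [lintegral_lintegral_swap (by fun_prop)]
  calc _ ≤ ∫⁻ w, ENNReal.ofReal (256 * β₀ ^ 12 * (2 * Real.exp (24 ^ 2 / 2))) * ‖w‖ₑ ^ (8 + 4)
      ∂ν := by
        apply lintegral_mono_ae
        filter_upwards [hν] with w hw
        refine (lintegral_hermiteTwo_remainder_le hβ w ((by gcongr : _ ≤ _).trans h1)).trans
          (le_of_eq ?_)
        rw [← ofReal_norm, ← ENNReal.ofReal_pow (norm_nonneg _), ← ENNReal.ofReal_mul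
            (by positivity)]
        congr 1; ring
    _ ≤ ENNReal.ofReal (256 * β₀ ^ 12 * (2 * Real.exp (24 ^ 2 / 2))) *
        (ENNReal.ofReal ((2 * √d) ^ 8) * ENNReal.ofReal V) := by
        rw [lintegral_const_mul' _ _ ENNReal.ofReal_ne_top]
        gcongr
        exact (lintegral_enorm_pow_le_of_norm_le (f := fun w => w) hν (by positivity) 8 4).trans
          (by gcongr)
    _ ≤ _ := by
        rw [← ENNReal.ofReal_mul (by positivity), ← ENNReal.ofReal_mul (by positivity)]
        apply ENNReal.ofReal_le_ofReal
        have hR : (2 * √d) ^ 8 = (4 * d : ℝ) ^ 4 := by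
          rw [show (2 * √(d : ℝ)) ^ 8 = (4 * √d ^ 2) ^ 4 by ring, Real.sq_sqrt hd'.le]
        rw [hR]
        calc _ ≤ 256 * s ^ 6 * (2 * Real.exp (24 ^ 2 / 2)) * ((4 * d) ^ 4 * V) := by gcongr
          _ = _ := by ring

lemma lintegral_integral_hermiteTwo_le (hν : ∀ᵐ w ∂ν, ‖w‖ ≤ 2 * √d) :
    ∫⁻ x, ‖∫ w, (⟪w, x⟫ ^ 2 - ‖w‖ ^ 2 : ℝ) ∂ν‖ₑ ^ 4 ∂(_root_.stdGaussian d) ≤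
      ENNReal.ofReal (256 * (2 * Real.exp (8 ^ 2 / 2)) * d ^ 4) := by
  refine (lintegral_enorm_integral_pow_le _ _ (by simp only [Function.uncurry_def]; fun_prop)
    (by norm_num)).trans ?_
  rw [lintegral_lintegral_swap (by fun_prop)]
  calc _ ≤ ∫⁻ w, ENNReal.ofReal (256 * (2 * Real.exp (8 ^ 2 / 2)) * d ^ 4) ∂ν := by
        apply lintegral_mono_ae
        filter_upwards [hν] with w hw
        refine (lintegral_hermiteTwo_le w).trans (ENNReal.ofReal_le_ofReal ?_)
        have hR : (2 * √d) ^ 8 = (4 * d : ℝ) ^ 4 := by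
          rw [show (2 * √(d : ℝ)) ^ 8 = (4 * √d ^ 2) ^ 4 by ring, Real.sq_sqrt (by positivity)]
        calc _ ≤ (2 * √d) ^ 8 * (2 * Real.exp (8 ^ 2 / 2)) := by gcongr
          _ = _ := by rw [hR]; ring
    _ = _ := by simp

end

lemma ENNReal.ofReal_rpow_half {x : ℝ} (hx : 0 ≤ x) :
    ENNReal.ofReal x ^ (1 / 2 : ℝ) = ENNReal.ofReal (√x) := by
  rw [ENNReal.ofReal_rpow_of_nonneg hx (by norm_num), Real.sqrt_eq_rpow]

lemma sqrt_add_add_le {x y z : ℝ} (hx : 0 ≤ x) (hy : 0 ≤ y) (hz : 0 ≤ z) :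
    √(x + y + z) ≤ √x + √y + √z := by
  rw [Real.sqrt_le_left (by positivity)]
  nlinarith [Real.sq_sqrt hx, Real.sq_sqrt hy, Real.sq_sqrt hz, Real.sqrt_nonneg x,
    Real.sqrt_nonneg y, Real.sqrt_nonneg z, mul_nonneg (Real.sqrt_nonneg x) (Real.sqrt_nonneg y),
    mul_nonneg (Real.sqrt_nonneg x) (Real.sqrt_nonneg z),
    mul_nonneg (Real.sqrt_nonneg y) (Real.sqrt_nonneg z)]

lemma ENNReal.add_four_pow_le (a b c d : ℝ≥0∞) :
    (a + b + c + d) ^ 4 ≤ 3 ^ 8 * (a ^ 4 + b ^ 4 + c ^ 4 + d ^ 4) := by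
  have h1 := ENNReal.add_add_pow_le (a + b) c d 4
  have h2 := ENNReal.add_add_pow_le a b 0 4
  simp only [add_zero, ne_eq, OfNat.ofNat_ne_zero, not_false_eq_true, zero_pow] at h2
  calc _ ≤ 3 ^ 4 * (3 ^ 4 * (a ^ 4 + b ^ 4) + c ^ 4 + d ^ 4) := h1.trans (by gcongr)
    _ ≤ 3 ^ 4 * (3 ^ 4 * (a ^ 4 + b ^ 4) + 3 ^ 4 * c ^ 4 + 3 ^ 4 * d ^ 4) := by
        gcongr <;> exact le_mul_of_one_le_left' (by norm_num)
    _ = _ := by ring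

/-- The quantity controlling the chi-square error of one step. -/
def stepError (d : ℕ) (s η ξ E V : ℝ) : ℝ :=
  √(s ^ 6 * d ^ 4 * V) + (s ^ 2 * η ^ 2 * d ^ 2 + s ^ 4 * d ^ 4 + ξ ^ 2 * d)
      + √(√(s ^ 4 * d ^ 3 * E))

lemma exists_sqrt_le_stepError (k₁ k₂ k₃ k₄ C₁ C₂ : ℝ) (h₁ : 0 < k₁) (h₂ : 0 < k₂) (h₃ : 0 < k₃)
    (h₄ : 0 < k₄) (hC₁ : 0 < C₁) (hC₂ : 0 < C₂) :
    ∃ C : ℝ, 0 < C ∧ ∀ (d : ℕ), 1 ≤ d → ∀ (s η ξ E V : ℝ), 0 ≤ s → 0 ≤ η → 0 ≤ E → 0 ≤ V →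
      E ≤ 4 * d → ξ ^ 2 * d ≤ 1 / 256 →
      √(k₁ * (s ^ 6 * d ^ 4 * V) + (s * η) ^ 4 * (k₂ * d ^ 4)
        + k₃ * √(C₁ * (s ^ 16 * d ^ 16 + s ^ 4 * d ^ 3 * E + ξ ^ 16 * d ^ 8))
        + k₄ * (C₂ * (s ^ 6 * d ^ 4 * V + s ^ 2 * d * E + ξ ^ 4 * d ^ 2))) ≤
        C * stepError d s η ξ E V := by
  obtain ⟨K, hK⟩ : ∃ K : ℝ, K = k₁ + k₂ + 2 * k₃ * √C₁ + 3 * (k₄ * C₂) := ⟨_, rfl⟩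
  have hK0 : 0 < K := by rw [hK]; positivity
  refine ⟨√K, by positivity, ?_⟩
  intro d hd s η ξ E V hs hη hE hV hEd hξ
  have hd' : (0 : ℝ) < d := by exact_mod_cast hd
  obtain ⟨P, hP⟩ : ∃ P : ℝ, P = s ^ 6 * d ^ 4 * V := ⟨_, rfl⟩
  obtain ⟨W, hW⟩ : ∃ W : ℝ, W = s ^ 4 * d ^ 3 * E := ⟨_, rfl⟩
  obtain ⟨Q₁, hQ₁⟩ : ∃ Q : ℝ, Q = s ^ 2 * η ^ 2 * d ^ 2 := ⟨_, rfl⟩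
  obtain ⟨Q₂, hQ₂⟩ : ∃ Q : ℝ, Q = s ^ 4 * d ^ 4 := ⟨_, rfl⟩
  obtain ⟨Q₃, hQ₃⟩ : ∃ Q : ℝ, Q = ξ ^ 2 * d := ⟨_, rfl⟩
  have hP0 : 0 ≤ P := by rw [hP]; positivity
  have hW0 : 0 ≤ W := by rw [hW]; positivity
  have hQ₁0 : 0 ≤ Q₁ := by rw [hQ₁]; positivity
  have hQ₂0 : 0 ≤ Q₂ := by rw [hQ₂]; positivity
  have hQ₃0 : 0 ≤ Q₃ := by rw [hQ₃]; positivity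
  have e1 : √(C₁ * (s ^ 16 * d ^ 16 + s ^ 4 * d ^ 3 * E + ξ ^ 16 * d ^ 8)) ≤
      √C₁ * (Q₂ ^ 2 + √W + Q₃ ^ 2) := by
    rw [Real.sqrt_mul hC₁.le]
    gcongr
    have a1 : s ^ 16 * d ^ 16 = (Q₂ ^ 2) ^ 2 := by rw [hQ₂]; ring
    have a2 : ξ ^ 16 * d ^ 8 = (Q₃ ^ 4) ^ 2 := by rw [hQ₃]; ring
    rw [a1, a2, ← hW]
    refine (sqrt_add_add_le (by positivity) hW0 (by positivity)).trans ?_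
    rw [Real.sqrt_sq (by positivity), Real.sqrt_sq (by positivity)]
    gcongr 1
    rw [← hQ₃] at hξ
    exact pow_le_pow_of_le_one hQ₃0 (by linarith) (by norm_num)
  have e2 : s ^ 2 * d * E ≤ 2 * √W := by
    have : s ^ 2 * d * E ≤ √(2 ^ 2 * W) := by
      apply Real.le_sqrt_of_sq_le
      rw [hW]
      have : 0 ≤ s ^ 4 * d ^ 2 * E := by positivity
      nlinarith
    rwa [Real.sqrt_mul (by norm_num), Real.sqrt_sq (by norm_num)] at this
  have e3 : (s * η) ^ 4 * (k₂ * d ^ 4) = k₂ * Q₁ ^ 2 := by rw [hQ₁]; ring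
  have e4 : ξ ^ 4 * d ^ 2 = Q₃ ^ 2 := by rw [hQ₃]; ring
  have hW' := Real.sqrt_nonneg W
  have hC' := Real.sqrt_nonneg C₁
  have hT : k₁ * (s ^ 6 * d ^ 4 * V) + (s * η) ^ 4 * (k₂ * d ^ 4)
        + k₃ * √(C₁ * (s ^ 16 * d ^ 16 + s ^ 4 * d ^ 3 * E + ξ ^ 16 * d ^ 8))
        + k₄ * (C₂ * (s ^ 6 * d ^ 4 * V + s ^ 2 * d * E + ξ ^ 4 * d ^ 2)) ≤
      K * (P + (Q₁ + Q₂ + Q₃) ^ 2 + √W) := by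
    rw [e3, e4, ← hP]
    obtain ⟨m, hm⟩ : ∃ m, m = k₃ * √C₁ := ⟨_, rfl⟩
    obtain ⟨n, hn⟩ : ∃ n, n = k₄ * C₂ := ⟨_, rfl⟩
    have hm0 : 0 ≤ m := by rw [hm]; positivity
    have hn0 : 0 ≤ n := by rw [hn]; positivity
    have f1 : k₃ * √(C₁ * (s ^ 16 * d ^ 16 + s ^ 4 * d ^ 3 * E + ξ ^ 16 * d ^ 8)) ≤
        m * (Q₂ ^ 2 + √W + Q₃ ^ 2) := by
      calc _ ≤ k₃ * (√C₁ * (Q₂ ^ 2 + √W + Q₃ ^ 2)) := by gcongr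
        _ = _ := by rw [hm]; ring
    have f2 : k₄ * (C₂ * (P + s ^ 2 * d * E + Q₃ ^ 2)) ≤ n * (P + 2 * √W + Q₃ ^ 2) := by
      calc _ ≤ k₄ * (C₂ * (P + 2 * √W + Q₃ ^ 2)) := by gcongr
        _ = _ := by rw [hn]; ring
    have hKe : K = k₁ + k₂ + 2 * m + 3 * n := by rw [hK, hm, hn]; ring
    have g1 : Q₁ ^ 2 + Q₂ ^ 2 + Q₃ ^ 2 ≤ (Q₁ + Q₂ + Q₃) ^ 2 := by
      nlinarith [mul_nonneg hQ₁0 hQ₂0, mul_nonneg hQ₁0 hQ₃0, mul_nonneg hQ₂0 hQ₃0]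
    have s1 := sq_nonneg Q₁
    have s2 := sq_nonneg Q₂
    have s3 := sq_nonneg Q₃
    set U := (Q₁ + Q₂ + Q₃) ^ 2
    have hU : 0 ≤ U := by positivity
    have t1 : k₁ * P ≤ k₁ * (P + U + √W) := by gcongr; linarith
    have t2 : k₂ * Q₁ ^ 2 ≤ k₂ * (P + U + √W) := by gcongr; linarith
    have t3 : m * (Q₂ ^ 2 + √W + Q₃ ^ 2) ≤ m * (P + U + √W) := mul_le_mul_of_nonneg_left
        (by linarith) hm0
    have t4 : n * (P + 2 * √W + Q₃ ^ 2) ≤ n * (3 * (P + U + √W)) := mul_le_mul_of_nonneg_left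
        (by linarith) hn0
    have t5 : 0 ≤ m * (P + U + √W) := by positivity
    rw [hKe]
    linarith
  have hP' : √P = √(s ^ 6 * d ^ 4 * V) := by rw [hP]
  calc _ ≤ √(K * (P + (Q₁ + Q₂ + Q₃) ^ 2 + √W)) := Real.sqrt_le_sqrt hT
    _ = √K * √(P + (Q₁ + Q₂ + Q₃) ^ 2 + √W) := Real.sqrt_mul hK0.le _
    _ ≤ √K * (√P + √((Q₁ + Q₂ + Q₃) ^ 2) + √(√W)) := by
        gcongr; exact sqrt_add_add_le hP0 (by positivity) hW'
    _ = _ := by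
        rw [Real.sqrt_sq (by positivity), hP, hW, hQ₁, hQ₂, hQ₃]; rfl

lemma enorm_add_sub_sub_pow_le (a b c f : ℝ) :
    ‖a + b - c - f‖ₑ ^ 4 ≤ 3 ^ 8 * (‖a‖ₑ ^ 4 + ‖b‖ₑ ^ 4 + ‖c‖ₑ ^ 4 + ‖f‖ₑ ^ 4) := by
  refine le_trans (pow_le_pow_left' ?_ 4) (ENNReal.add_four_pow_le _ _ _ _)
  refine enorm_sub_le.trans (add_le_add_left (enorm_sub_le.trans (add_le_add_left ?_ _)) _)
  exact enorm_add_le _ _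

theorem exists_chiSq_step_le : ∃ C : ℝ, 0 < C ∧ ∀ (d : ℕ), 1 ≤ d →
    ∀ (ν : Measure (Vec d)) [IsProbabilityMeasure ν] (e : Vec d → Vec d)
      (α β β₀ b ℓ ξ s η E V : ℝ),
    (∀ᵐ w ∂ν, ‖w‖ ≤ 2 * √d) → ∫ w, w ∂ν = 0 → Measurable e → (∀ g, ‖e g‖ ≤ 2 * √d) →
    α ^ 2 + β ^ 2 = 1 → 0 ≤ β₀ → β₀ ^ 2 ≤ s → b ^ 2 ≤ s → ℓ ^ 2 ≤ s →
    |β₀ ^ 2 / 2 - b * ℓ * (α * β)| ≤ s * η →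
    s * d ≤ 1 / 1024 → ξ ^ 2 * d ≤ 1 / 256 → 0 ≤ η → 0 ≤ E → 0 ≤ V → E ≤ 4 * d →
    ∫⁻ g, ‖e g‖ₑ ^ 2 ∂(_root_.stdGaussian d) ≤ ENNReal.ofReal E →
    ∫⁻ w, ‖w‖ₑ ^ 4 ∂ν ≤ ENNReal.ofReal V →
    ∫⁻ x, ENNReal.ofReal (((trueDensity ν β₀ x).toReal -
        (stepDensity (drift ν e b ℓ ξ) α β x).toReal) ^ 2 /
        (stepDensity (drift ν e b ℓ ξ) α β x).toReal) ∂(_root_.stdGaussian d) ≤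
      ENNReal.ofReal (C * stepError d s η ξ E V) := by
  obtain ⟨C₁, hC₁, H₁⟩ := exists_lintegral_drift_pow_le
  obtain ⟨C₂, hC₂, H₂⟩ := exists_lintegral_driftRem_pow_le
  obtain ⟨k₁, hk₁⟩ : ∃ k : ℝ, k = 4 ^ 8 * (2 * Real.exp (24 ^ 2 / 2)) := ⟨_, rfl⟩
  obtain ⟨k₂, hk₂⟩ : ∃ k : ℝ, k = 256 * (2 * Real.exp (8 ^ 2 / 2)) := ⟨_, rfl⟩
  obtain ⟨k₃, hk₃⟩ : ∃ k : ℝ, k = 512 * Real.exp 64 * √(2 * Real.exp 1) := ⟨_, rfl⟩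
  obtain ⟨k₄, hk₄⟩ : ∃ k : ℝ, k = 2 * Real.exp 8 := ⟨_, rfl⟩
  have hk₁0 : 0 < k₁ := by rw [hk₁]; positivity
  have hk₂0 : 0 < k₂ := by rw [hk₂]; positivity
  have hk₃0 : 0 < k₃ := by rw [hk₃]; positivity
  have hk₄0 : 0 < k₄ := by rw [hk₄]; positivity
  obtain ⟨C, hC, H⟩ := exists_sqrt_le_stepError k₁ k₂ k₃ k₄ C₁ C₂ hk₁0 hk₂0 hk₃0 hk₄0 hC₁ hC₂
  refine ⟨√(3 ^ 8) * C * √(2 * Real.exp 1), by positivity, ?_⟩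
  intro d hd ν _ e α β β₀ b ℓ ξ s η E V hν hmean hem he hαβ hβ hβs hb hℓ hδ hs hξ hη hE hV hEd
      hEe hVe
  have hs0 : 0 ≤ s := (sq_nonneg _).trans hb
  have hR : (0 : ℝ) ≤ 2 * √d := by positivity
  have hDm : Measurable (drift ν e b ℓ ξ) := measurable_drift hem
  have hρm : Measurable (driftRem ν e b ℓ ξ) := measurable_driftRem hem
  have I1 := lintegral_integral_hermiteTwo_remainder_le hd hν hβ hβs hs hV hVe
  have I2 := lintegral_integral_hermiteTwo_le hν
  have I3 := lintegral_stepWeight_remainder_pow_le (ℓ := ℓ) hd hν hem he hb hs hξ hαβ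
  have I4 := lintegral_inner_driftRem_pow_le (ν := ν) (b := b) (ℓ := ℓ) (ξ := ξ) hem hαβ
  have h1 := H₁ d hd ν e b ℓ ξ s E hν hmean hem he hb hℓ hs hE hEe
  have h2 := H₂ d hd ν e b ℓ ξ s E V hν hmean hem he hb hℓ hs hE hV hEe hVe
  have I3' := I3.trans (by gcongr : _ ≤ ENNReal.ofReal (512 * Real.exp 64) *
    (ENNReal.ofReal (C₁ * (s ^ 16 * d ^ 16 + s ^ 4 * d ^ 3 * E + ξ ^ 16 * d ^ 8)) ^ (1 / 2 : ℝ) *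
      ENNReal.ofReal (2 * Real.exp 1) ^ (1 / 2 : ℝ)))
  have I4' := I4.trans (mul_le_mul_right h2 _)
  have px : 0 ≤ ξ ^ 16 * (d : ℝ) ^ 8 := mul_nonneg (Even.pow_nonneg (by decide) _) (by positivity)
  rw [ENNReal.ofReal_rpow_half (by positivity), ENNReal.ofReal_rpow_half (by positivity),
    ← ENNReal.ofReal_mul (by positivity), ← ENNReal.ofReal_mul (by positivity)] at I3'
  rw [← ENNReal.ofReal_mul (by positivity), ← hk₄] at I4'
  rw [← hk₁] at I1
  rw [← hk₂] at I2
  have hNm := measurable_stepWeight (α := α) (β := β) hDm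
  have hFm : Measurable (Function.uncurry fun x x' : Vec d =>
      stepWeight (drift ν e b ℓ ξ) α β x x' - 1
        - (⟪drift ν e b ℓ ξ (α • x + β • x'), β • x - α • x'⟫ : ℝ)) := by
    simp only [Function.uncurry_def]
    exact (hNm.sub measurable_const).sub (by fun_prop)
  have hGm : Measurable (Function.uncurry fun x x' : Vec d =>
      (⟪driftRem ν e b ℓ ξ (α • x + β • x'), β • x - α • x'⟫ : ℝ)) := by
    simp only [Function.uncurry_def]; fun_prop
  have J3 := (lintegral_enorm_integral_pow_le (_root_.stdGaussian d) (_root_.stdGaussian d)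
    hFm (n := 4) (by norm_num)).trans I3'
  have J4 := (lintegral_enorm_integral_pow_le (_root_.stdGaussian d) (_root_.stdGaussian d)
    hGm (n := 4) (by norm_num)).trans I4'
  have hGi := ae_integrable_of_lintegral_pow (_root_.stdGaussian d) (_root_.stdGaussian d)
    hGm (n := 4) (by norm_num) (I4'.trans_lt ENNReal.ofReal_lt_top).ne
  have hNi : ∀ᵐ x ∂(_root_.stdGaussian d),
      Integrable (stepWeight (drift ν e b ℓ ξ) α β x) (_root_.stdGaussian d) := by
    filter_upwards [ae_lt_top (measurable_stepDensity (α := α) (β := β) hDm)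
      (by rw [lintegral_stepDensity hDm hαβ]; simp)] with x hx
    refine ⟨(hNm.comp (measurable_const.prodMk measurable_id)).aestronglyMeasurable, ?_⟩
    rw [hasFiniteIntegral_iff_ofReal (.of_forall fun x' => (stepWeight_pos x x').le)]
    exact hx
  have hSm : Measurable (fun x => ∫ w, (⟪w, x⟫ ^ 2 - ‖w‖ ^ 2 : ℝ) ∂ν) := by
    apply StronglyMeasurable.measurable
    exact StronglyMeasurable.integral_prod_right
      (f := fun x w : Vec d => (⟪w, x⟫ ^ 2 - ‖w‖ ^ 2 : ℝ))
      (Continuous.stronglyMeasurable (by fun_prop))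
  have hFi : Measurable (fun x => ∫ x', (stepWeight (drift ν e b ℓ ξ) α β x x' - 1
        - (⟪drift ν e b ℓ ξ (α • x + β • x'), β • x - α • x'⟫ : ℝ)) ∂(_root_.stdGaussian d)) :=
    (hFm.stronglyMeasurable.integral_prod_right).measurable
  have hAm : Measurable (fun x => ∫ w, (Real.exp (β₀ * ⟪w, x⟫ - (β₀ * ‖w‖) ^ 2 / 2) - 1
      - β₀ * ⟪w, x⟫ - β₀ ^ 2 / 2 * (⟪w, x⟫ ^ 2 - ‖w‖ ^ 2)) ∂ν) := by
    apply StronglyMeasurable.measurable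
    exact StronglyMeasurable.integral_prod_right
      (f := fun x w : Vec d => (Real.exp (β₀ * ⟪w, x⟫ - (β₀ * ‖w‖) ^ 2 / 2) - 1
      - β₀ * ⟪w, x⟫ - β₀ ^ 2 / 2 * (⟪w, x⟫ ^ 2 - ‖w‖ ^ 2)))
      (Continuous.stronglyMeasurable (by fun_prop))
  have hL4 : ∫⁻ x, ‖(trueDensity ν β₀ x).toReal -
        (stepDensity (drift ν e b ℓ ξ) α β x).toReal‖ₑ ^ 4 ∂(_root_.stdGaussian d) ≤
      ENNReal.ofReal (3 ^ 8 * (k₁ * (s ^ 6 * d ^ 4 * V) + (s * η) ^ 4 * (k₂ * d ^ 4)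
        + k₃ * √(C₁ * (s ^ 16 * d ^ 16 + s ^ 4 * d ^ 3 * E + ξ ^ 16 * d ^ 8))
        + k₄ * (C₂ * (s ^ 6 * d ^ 4 * V + s ^ 2 * d * E + ξ ^ 4 * d ^ 2)))) := by
    calc _ ≤ ∫⁻ x, 3 ^ 8 * (
          ‖∫ w, (Real.exp (β₀ * ⟪w, x⟫ - (β₀ * ‖w‖) ^ 2 / 2) - 1 - β₀ * ⟪w, x⟫
            - β₀ ^ 2 / 2 * (⟪w, x⟫ ^ 2 - ‖w‖ ^ 2)) ∂ν‖ₑ ^ 4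
          + ENNReal.ofReal ((s * η) ^ 4) * ‖∫ w, (⟪w, x⟫ ^ 2 - ‖w‖ ^ 2 : ℝ) ∂ν‖ₑ ^ 4
          + ‖∫ x', (stepWeight (drift ν e b ℓ ξ) α β x x' - 1
            - (⟪drift ν e b ℓ ξ (α • x + β • x'), β • x - α • x'⟫ : ℝ))
                ∂(_root_.stdGaussian d)‖ₑ ^ 4
          + ‖∫ x', (⟪driftRem ν e b ℓ ξ (α • x + β • x'), β • x - α • x'⟫ : ℝ)
            ∂(_root_.stdGaussian d)‖ₑ ^ 4) ∂(_root_.stdGaussian d) := by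
          apply lintegral_mono_ae
          filter_upwards [hGi, hNi] with x hx1 hx2
          rw [trueDensity_sub_stepDensity hν hR hmean x hx2 hx1]
          refine (enorm_add_sub_sub_pow_le _ _ _ _).trans ?_
          · gcongr
            rw [enorm_mul, mul_pow]
            gcongr
            rw [enorm_pow_eq_ofReal_abs_pow]
            gcongr
      _ ≤ 3 ^ 8 * (ENNReal.ofReal (k₁ * (s ^ 6 * d ^ 4 * V))
          + ENNReal.ofReal ((s * η) ^ 4) * ENNReal.ofReal (k₂ * d ^ 4)
          + ENNReal.ofReal (512 * Real.exp 64 *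
            (√(C₁ * (s ^ 16 * d ^ 16 + s ^ 4 * d ^ 3 * E + ξ ^ 16 * d ^ 8)) *
              √(2 * Real.exp 1)))
          + ENNReal.ofReal (k₄ * (C₂ * (s ^ 6 * d ^ 4 * V + s ^ 2 * d * E + ξ ^ 4 * d ^ 2)))) := by
          rw [lintegral_const_mul' _ _ (by simp), lintegral_add_left (by fun_prop),
            lintegral_add_left (by fun_prop), lintegral_add_left (by fun_prop),
            lintegral_const_mul' _ _ ENNReal.ofReal_ne_top]
          gcongr
      _ = _ := by
          have p4 : 0 ≤ ξ ^ 4 := Even.pow_nonneg (by decide) _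
          rw [show (3 : ℝ≥0∞) ^ 8 = ENNReal.ofReal (3 ^ 8) by
              rw [ENNReal.ofReal_pow (by norm_num)]; norm_num,
            ← ENNReal.ofReal_mul (by positivity),
            ← ENNReal.ofReal_add (by positivity) (by positivity),
            ← ENNReal.ofReal_add (by positivity) (by positivity),
            ← ENNReal.ofReal_add (by positivity) (by positivity),
            ← ENNReal.ofReal_mul (by positivity)]
          congr 1
          rw [hk₃]; ring
  have hp2 := (lintegral_inv_stepDensity_sq_le hDm hαβ).trans
    (lintegral_exp_norm_drift_sq_le (ℓ := ℓ) (c := 3) hd hν he hb (by norm_num) hs hξ)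
  have hχ := lintegral_chiSq_le (_root_.stdGaussian d) (measurable_trueDensity (ν := ν) (β₀ := β₀))
    (measurable_stepDensity (α := α) (β := β) hDm) (stepDensity_ne_zero hDm)
    (ae_lt_top (measurable_stepDensity hDm) (by rw [lintegral_stepDensity hDm hαβ]; simp))
  refine hχ.trans ?_
  refine (mul_le_mul' (ENNReal.rpow_le_rpow hL4 (by norm_num))
    (ENNReal.rpow_le_rpow hp2 (by norm_num))).trans ?_
  have p4 : 0 ≤ ξ ^ 4 := Even.pow_nonneg (by decide) _
  rw [ENNReal.ofReal_rpow_half (by positivity), ENNReal.ofReal_rpow_half (by positivity),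
    ← ENNReal.ofReal_mul (by positivity)]
  apply ENNReal.ofReal_le_ofReal
  rw [Real.sqrt_mul (by norm_num)]
  have := H d hd s η ξ E V hs0 hη hE hV hEd hξ
  calc _ ≤ √(3 ^ 8) * (C * stepError d s η ξ E V) * √(2 * Real.exp 1) := by gcongr
    _ = _ := by ring

/-- Law of `l • θ + σ • g` with `θ ∼ q` and `g` standard Gaussian, independent. -/
def mixLaw (q : Measure (Vec d)) (l σ : ℝ) : Measure (Vec d) :=
  Measure.map (fun p : Vec d × Vec d => l • p.1 + σ • p.2) (q.prod (_root_.stdGaussian d))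

/-- Log-likelihood of `θ` given `y = l • θ + σ • g`, up to a term depending on `y` only. -/
def logLik (l σ : ℝ) (y θ : Vec d) : ℝ := l / σ ^ 2 * ⟪θ, y⟫ - (l * ‖θ‖ / σ) ^ 2 / 2

/-- Posterior law of `θ` given `l • θ + σ • g = y`. -/
def post (q : Measure (Vec d)) (l σ : ℝ) (y : Vec d) : Measure (Vec d) :=
  q.tilted (logLik l σ y)

def postNorm (q : Measure (Vec d)) (l σ : ℝ) (y : Vec d) : ℝ :=
  ∫ θ, Real.exp (logLik l σ y θ) ∂q

def postMean (q : Measure (Vec d)) (l σ : ℝ) (y : Vec d) : Vec d :=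
  ∫ θ, θ ∂(post q l σ y)

/-- Centred posterior law. -/
def postCentred (q : Measure (Vec d)) (l σ : ℝ) (y : Vec d) : Measure (Vec d) :=
  (post q l σ y).map (fun θ => θ - postMean q l σ y)

lemma continuous_logLik (l σ : ℝ) :
    Continuous (fun p : Vec d × Vec d => logLik l σ p.1 p.2) := by
  unfold logLik; fun_prop

lemma continuous_logLik_right (l σ : ℝ) (y : Vec d) : Continuous (logLik l σ y) := by
  unfold logLik; fun_prop

lemma measurable_logLik (l σ : ℝ) :
    Measurable (fun p : Vec d × Vec d => logLik l σ p.1 p.2) :=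
  (continuous_logLik l σ).measurable

lemma lintegral_mixLaw (q : Measure (Vec d)) [SFinite q] (l σ : ℝ) {f : Vec d → ℝ≥0∞}
    (hf : Measurable f) :
    ∫⁻ y, f y ∂(mixLaw q l σ) = ∫⁻ θ, ∫⁻ g, f (l • θ + σ • g) ∂(_root_.stdGaussian d) ∂q := by
  rw [mixLaw, lintegral_map hf (by fun_prop), lintegral_prod _ (by fun_prop)]

instance (q : Measure (Vec d)) [IsProbabilityMeasure q] (l σ : ℝ) :
    IsProbabilityMeasure (mixLaw q l σ) :=
  Measure.isProbabilityMeasure_map (by fun_prop)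

lemma ae_post {q : Measure (Vec d)} {R l σ : ℝ} (hq : ∀ᵐ θ ∂q, ‖θ‖ ≤ R) (y : Vec d) :
    ∀ᵐ θ ∂(post q l σ y), ‖θ‖ ≤ R :=
  (tilted_absolutelyContinuous q _).ae_le hq

lemma postMean_eq {q : Measure (Vec d)} {l σ : ℝ} (y : Vec d) :
    postMean q l σ y =
      (postNorm q l σ y)⁻¹ • ∫ θ, Real.exp (logLik l σ y θ) • θ ∂q := by
  rw [postMean, post, integral_tilted, ← integral_smul]
  simp_rw [smul_smul, div_eq_inv_mul]
  rfl

section Posterior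

variable {q : Measure (Vec d)} [IsProbabilityMeasure q] {R : ℝ} {l σ : ℝ}

lemma integrable_exp_logLik (hq : ∀ᵐ θ ∂q, ‖θ‖ ≤ R) (y : Vec d) :
    Integrable (fun θ => Real.exp (logLik l σ y θ)) q :=
  integrable_of_continuous_of_bounded_support hq
    (Real.continuous_exp.comp (continuous_logLik_right l σ y))

lemma isProbabilityMeasure_post (hq : ∀ᵐ θ ∂q, ‖θ‖ ≤ R) (y : Vec d) :
    IsProbabilityMeasure (post q l σ y) :=
  isProbabilityMeasure_tilted (integrable_exp_logLik hq y)

lemma postNorm_pos (hq : ∀ᵐ θ ∂q, ‖θ‖ ≤ R) (y : Vec d) : 0 < postNorm q l σ y :=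
  integral_exp_pos (integrable_exp_logLik hq y)

lemma measurable_postNorm : Measurable (postNorm q l σ) := by
  apply StronglyMeasurable.measurable
  exact StronglyMeasurable.integral_prod_right
    (f := fun y θ : Vec d => Real.exp (logLik l σ y θ))
    (Real.continuous_exp.comp (continuous_logLik l σ)).stronglyMeasurable

lemma lintegral_post (hq : ∀ᵐ θ ∂q, ‖θ‖ ≤ R) (y : Vec d) (f : Vec d → ℝ≥0∞) :
    ∫⁻ θ, f θ ∂(post q l σ y) =
      (∫⁻ θ, ENNReal.ofReal (Real.exp (logLik l σ y θ)) * f θ ∂q) /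
        ENNReal.ofReal (postNorm q l σ y) := by
  have hZ := postNorm_pos (l := l) (σ := σ) hq y
  have hZ' : (ENNReal.ofReal (postNorm q l σ y))⁻¹ ≠ ∞ := by simpa using hZ
  rw [post, lintegral_tilted, div_eq_mul_inv, ← lintegral_mul_const' _ _ hZ']
  refine lintegral_congr fun θ => ?_
  change ENNReal.ofReal (_ / postNorm q l σ y) * _ = _
  rw [ENNReal.ofReal_div_of_pos hZ, div_eq_mul_inv, mul_right_comm]

lemma ofReal_postNorm (hq : ∀ᵐ θ ∂q, ‖θ‖ ≤ R) (y : Vec d) :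
    ENNReal.ofReal (postNorm q l σ y) =
      ∫⁻ θ, ENNReal.ofReal (Real.exp (logLik l σ y θ)) ∂q :=
  ofReal_integral_eq_lintegral_ofReal (integrable_exp_logLik hq y)
    (.of_forall fun _ => (Real.exp_pos _).le)

lemma measurable_lintegral_post {X : Type*} [MeasurableSpace X] (hq : ∀ᵐ θ ∂q, ‖θ‖ ≤ R)
    {F : X × Vec d → Vec d → ℝ≥0∞} (hF : Measurable (Function.uncurry F)) :
    Measurable (fun p : X × Vec d => ∫⁻ θ, F p θ ∂(post q l σ p.2)) := by
  simp_rw [lintegral_post hq]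
  refine Measurable.div ?_ (ENNReal.measurable_ofReal.comp (measurable_postNorm.comp
      measurable_snd))
  refine Measurable.lintegral_prod_right
    (f := fun (p : X × Vec d) θ => ENNReal.ofReal (Real.exp (logLik l σ p.2 θ)) * F p θ) ?_
  have h : Measurable (fun z : (X × Vec d) × Vec d => (z.1.2, z.2)) := by fun_prop
  have h2 := (measurable_logLik l σ).comp h
  exact (ENNReal.measurable_ofReal.comp (Real.measurable_exp.comp h2)).mul hF

lemma measurable_postMean : Measurable (postMean q l σ) := by
  have : postMean q l σ = fun y =>
      (postNorm q l σ y)⁻¹ • ∫ θ, Real.exp (logLik l σ y θ) • θ ∂q := funext postMean_eq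
  rw [this]
  refine Measurable.fun_smul measurable_postNorm.inv ?_
  apply StronglyMeasurable.measurable
  refine StronglyMeasurable.integral_prod_right
    (f := fun y θ : Vec d => Real.exp (logLik l σ y θ) • θ) ?_
  exact ((Real.continuous_exp.comp (continuous_logLik l σ)).smul
    continuous_snd).stronglyMeasurable

lemma norm_postMean_le (hq : ∀ᵐ θ ∂q, ‖θ‖ ≤ R) (y : Vec d) : ‖postMean q l σ y‖ ≤ R := by
  have := isProbabilityMeasure_post (l := l) (σ := σ) hq y
  simpa [postMean] using norm_integral_le_of_norm_le_const (ae_post (l := l) (σ := σ) hq y)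

lemma lintegral_lintegral_mix (hσ : σ ≠ 0)
    {G : Vec d → Vec d → ℝ≥0∞} (hG : Measurable (fun p : Vec d × Vec d => G p.1 p.2)) :
    ∫⁻ θ, ∫⁻ g, G (l • θ + σ • g) θ ∂(_root_.stdGaussian d) ∂q =
    ∫⁻ x, ∫⁻ θ, ENNReal.ofReal (Real.exp (logLik l σ (σ • x) θ)) * G (σ • x) θ ∂q
      ∂(_root_.stdGaussian d) := by
  have h : Measurable (fun p : Vec d × Vec d => (σ • p.2, p.1)) := by fun_prop
  have h2 := (measurable_logLik l σ).comp h
  have hm : Measurable (Function.uncurry fun θ x : Vec d =>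
      ENNReal.ofReal (Real.exp (logLik l σ (σ • x) θ)) * G (σ • x) θ) :=
    (ENNReal.measurable_ofReal.comp (Real.measurable_exp.comp h2)).mul (hG.comp h)
  refine Eq.trans (lintegral_congr fun θ => ?_)
    (lintegral_lintegral_swap (μ := q) (ν := _root_.stdGaussian d) hm.aemeasurable)
  have hGθ : Measurable fun x : Vec d => G (σ • x) θ :=
    hG.comp (f := fun x : Vec d => (σ • x, θ)) (by fun_prop)
  have h := lintegral_stdGaussian_add ((l / σ) • θ) hGθ
  refine (lintegral_congr fun x => ?_).trans (h.trans (lintegral_congr fun x => ?_))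
  · congr 1
    rw [smul_add, smul_smul, mul_div_cancel₀ _ hσ, add_comm]
  · congr 3
    rw [logLik, inner_smul_left, inner_smul_right, norm_smul, Real.norm_eq_abs, mul_pow, sq_abs]
    simp only [conj_trivial]
    field_simp

/-- Bayes' rule. -/
lemma lintegral_lintegral_post (hq : ∀ᵐ θ ∂q, ‖θ‖ ≤ R) (hσ : σ ≠ 0)
    {F : Vec d → Vec d → ℝ≥0∞} (hF : Measurable (Function.uncurry F)) :
    ∫⁻ y, ∫⁻ θ, F y θ ∂(post q l σ y) ∂(mixLaw q l σ) =
      ∫⁻ θ, ∫⁻ g, F (l • θ + σ • g) θ ∂(_root_.stdGaussian d) ∂q := by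
  have hFm : Measurable (fun y => ∫⁻ θ, F y θ ∂(post q l σ y)) :=
    (measurable_lintegral_post (X := Unit) hq (F := fun p θ => F p.2 θ)
      (hF.comp (f := fun z : (Unit × Vec d) × Vec d => (z.1.2, z.2)) (by fun_prop))).comp
      (f := fun y => ((), y)) (by fun_prop)
  rw [lintegral_mixLaw q l σ hFm, lintegral_lintegral_mix hσ hF,
    lintegral_lintegral_mix hσ (G := fun y _ => ∫⁻ θ, F y θ ∂(post q l σ y))
        (hFm.comp measurable_fst)]
  refine lintegral_congr fun x => ?_
  have hexp : Measurable fun θ => ENNReal.ofReal (Real.exp (logLik l σ (σ • x) θ)) :=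
    ENNReal.measurable_ofReal.comp
      (Real.measurable_exp.comp (continuous_logLik_right l σ _).measurable)
  rw [lintegral_mul_const _ hexp, ← ofReal_postNorm hq, lintegral_post hq]
  exact ENNReal.mul_div_cancel (by simpa using postNorm_pos hq _) ENNReal.ofReal_ne_top

end Posterior

section Score

variable {q : Measure (Vec d)} [IsProbabilityMeasure q] {R : ℝ} {l σ : ℝ}

lemma hasFDerivAt_postNorm (hq : ∀ᵐ θ ∂q, ‖θ‖ ≤ R) (y : Vec d) :
    HasFDerivAt (postNorm q l σ)
      (∫ θ, (Real.exp (logLik l σ y θ) * (l / σ ^ 2)) • innerSL ℝ θ ∂q) y := by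
  have hF : ∀ x θ : Vec d, HasFDerivAt (fun y => Real.exp (logLik l σ y θ))
      ((Real.exp (logLik l σ x θ) * (l / σ ^ 2)) • innerSL ℝ θ) x := by
    intro x θ
    have h1 : HasFDerivAt (fun y : Vec d => (⟪θ, y⟫ : ℝ)) (innerSL ℝ θ) x :=
      (innerSL ℝ θ).hasFDerivAt
    have h2 : HasFDerivAt (fun y : Vec d => logLik l σ y θ) ((l / σ ^ 2) • innerSL ℝ θ) x := by
      unfold logLik
      exact (h1.const_mul _).sub_const _
    have h3 := h2.exp
    rwa [smul_smul] at h3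
  refine hasFDerivAt_integral_of_dominated_of_fderiv_le (μ := q)
    (F := fun y θ => Real.exp (logLik l σ y θ))
    (F' := fun y θ => (Real.exp (logLik l σ y θ) * (l / σ ^ 2)) • innerSL ℝ θ)
    (bound := fun _ => Real.exp (|l / σ ^ 2| * (R * (‖y‖ + 1))) * |l / σ ^ 2| * R)
    (Metric.ball_mem_nhds y one_pos) ?_ (integrable_exp_logLik hq y) ?_ ?_ (integrable_const _)
    (.of_forall fun θ x _ => hF x θ)
  · refine .of_forall fun x => ?_
    exact (integrable_exp_logLik hq x).aestronglyMeasurable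
  · refine Continuous.aestronglyMeasurable ?_
    have := continuous_logLik_right l σ y
    fun_prop
  · filter_upwards [hq] with θ hθ x hx
    have hR : 0 ≤ R := (norm_nonneg _).trans hθ
    have hx' : ‖x‖ ≤ ‖y‖ + 1 := by
      rw [Metric.mem_ball, dist_eq_norm] at hx
      linarith [norm_le_norm_add_norm_sub' x y]
    rw [norm_smul, innerSL_apply_norm, norm_mul, Real.norm_eq_abs, Real.norm_eq_abs, Real.abs_exp]
    gcongr
    rw [logLik]
    have h1 : l / σ ^ 2 * ⟪θ, x⟫ ≤ |l / σ ^ 2| * (R * (‖y‖ + 1)) := by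
      refine (le_abs_self _).trans ?_
      rw [abs_mul]
      gcongr
      exact (abs_real_inner_le_norm θ x).trans (by gcongr)
    linarith [sq_nonneg (l * ‖θ‖ / σ)]

lemma hasGradientAt_log_postNorm (hq : ∀ᵐ θ ∂q, ‖θ‖ ≤ R) (y : Vec d) :
    HasGradientAt (fun y => Real.log (postNorm q l σ y)) ((l / σ ^ 2) • postMean q l σ y) y := by
  have hZ := postNorm_pos (l := l) (σ := σ) hq y
  have h := (hasFDerivAt_postNorm (l := l) (σ := σ) hq y).log hZ.ne'
  rw [hasGradientAt_iff_hasFDerivAt]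
  refine h.congr_fderiv (Eq.symm ?_)
  have hi : Integrable (fun θ => (Real.exp (logLik l σ y θ) * (l / σ ^ 2)) • innerSL ℝ θ) q :=
    integrable_of_continuous_of_bounded_support hq
      (by have := continuous_logLik_right l σ y; fun_prop)
  have hi2 : Integrable (fun θ => Real.exp (logLik l σ y θ) • θ) q :=
    integrable_of_continuous_of_bounded_support hq
      (by have := continuous_logLik_right l σ y; fun_prop)
  ext v
  rw [InnerProductSpace.toDual_apply_apply, _root_.smul_apply,
    ContinuousLinearMap.integral_apply hi, postMean_eq, smul_smul, inner_smul_left,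
    real_inner_comm, ← integral_inner hi2]
  simp only [_root_.smul_apply, innerSL_apply_apply, smul_eq_mul, inner_smul_right,
    conj_trivial]
  rw [← integral_const_mul, ← integral_const_mul]
  refine integral_congr_ae (.of_forall fun θ => ?_)
  simp only [real_inner_comm]
  ring

lemma continuous_postNorm (hq : ∀ᵐ θ ∂q, ‖θ‖ ≤ R) : Continuous (postNorm q l σ) :=
  continuous_iff_continuousAt.2 fun y => (hasFDerivAt_postNorm hq y).continuousAt

lemma mixLaw_eq_withDensity (hq : ∀ᵐ θ ∂q, ‖θ‖ ≤ R) (hσ : 0 < σ) :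
    mixLaw q l σ = volume.withDensity fun y =>
      ENNReal.ofReal ((σ ^ d)⁻¹ * gaussDensity d (σ⁻¹ • y) * postNorm q l σ y) := by
  have hm := (continuous_gaussDensity (d := d)).measurable
  have hZ := measurable_postNorm (q := q) (l := l) (σ := σ)
  refine Measure.ext_of_lintegral _ fun f hf => ?_
  rw [lintegral_withDensity_eq_lintegral_mul _ (by fun_prop) hf, lintegral_mixLaw _ _ _ hf,
    lintegral_lintegral_mix hσ.ne' (G := fun y _ => f y) (hf.comp measurable_fst),
    stdGaussian_eq_withDensity, lintegral_withDensity_eq_lintegral_mul₀ (by fun_prop) ?_]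
  · have h1 : ∀ x : Vec d, ∫⁻ θ, ENNReal.ofReal (Real.exp (logLik l σ (σ • x) θ)) * f (σ • x) ∂q
        = ENNReal.ofReal (postNorm q l σ (σ • x)) * f (σ • x) := by
      intro x
      have hexp : Measurable fun θ => ENNReal.ofReal (Real.exp (logLik l σ (σ • x) θ)) :=
        ENNReal.measurable_ofReal.comp
          (Real.measurable_exp.comp (continuous_logLik_right l σ _).measurable)
      rw [lintegral_mul_const _ hexp, ← ofReal_postNorm hq]
    simp only [Pi.mul_apply, h1]
    have h2 := Measure.map_addHaar_smul (volume : Measure (Vec d)) hσ.ne'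
    have h3 : Measurable fun y => ENNReal.ofReal (gaussDensity d (σ⁻¹ • y)) *
        (ENNReal.ofReal (postNorm q l σ y) * f y) := by fun_prop
    have h4 := lintegral_map h3 (measurable_const_smul σ) (μ := (volume : Measure (Vec d)))
    rw [h2, lintegral_smul_measure] at h4
    simp only [smul_smul, inv_mul_cancel₀ hσ.ne', one_smul] at h4
    rw [← h4, smul_eq_mul, ← lintegral_const_mul _ h3]
    refine lintegral_congr fun y => ?_
    rw [ENNReal.ofReal_mul (by have := gaussDensity_pos (d := d) (σ⁻¹ • y); positivity),
      ENNReal.ofReal_mul (by positivity)]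
    simp only [finrank_euclideanSpace, Fintype.card_fin]
    rw [abs_of_pos (by positivity)]
    ring
  · refine Measurable.aemeasurable (Measurable.lintegral_prod_right (f := fun x θ : Vec d =>
      ENNReal.ofReal (Real.exp (logLik l σ (σ • x) θ)) * f (σ • x)) ?_)
    have h : Measurable (fun p : Vec d × Vec d => (σ • p.1, p.2)) := by fun_prop
    have h2 := (measurable_logLik l σ).comp h
    exact (ENNReal.measurable_ofReal.comp (Real.measurable_exp.comp h2)).mul
      (hf.comp (f := fun p : Vec d × Vec d => σ • p.1) (by fun_prop))

/-- Tweedie's formula. -/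
lemma gradient_log_density (hq : ∀ᵐ θ ∂q, ‖θ‖ ≤ R) (hσ : 0 < σ) {ρ : Vec d → ℝ}
    (hρ : mixLaw q l σ = volume.withDensity fun x => ENNReal.ofReal (ρ x))
    (hpos : ∀ x, 0 < ρ x) (hc : Continuous ρ) (y : Vec d) :
    gradient (fun y => Real.log (ρ y)) y = (σ ^ 2)⁻¹ • (l • postMean q l σ y - y) := by
  have hg := continuous_gaussDensity (d := d)
  have hZ := continuous_postNorm (l := l) (σ := σ) hq
  have hc' : Continuous fun y => (σ ^ d)⁻¹ * gaussDensity d (σ⁻¹ • y) * postNorm q l σ y := by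
    fun_prop
  rw [mixLaw_eq_withDensity hq hσ] at hρ
  have h1 := (withDensity_eq_iff_of_sigmaFinite (by fun_prop) (by fun_prop)).1 hρ
  have h2 : (fun y => (σ ^ d)⁻¹ * gaussDensity d (σ⁻¹ • y) * postNorm q l σ y) = ρ := by
    refine (Continuous.ae_eq_iff_eq volume hc' hc).1 ?_
    filter_upwards [h1] with x hx
    have := gaussDensity_pos (d := d) (σ⁻¹ • x)
    have := postNorm_pos (l := l) (σ := σ) hq x
    exact (ENNReal.ofReal_eq_ofReal_iff (by positivity) (hpos x).le).1 hx
  have h3 : (fun y => Real.log (ρ y)) = fun y =>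
      (Real.log ((σ ^ d)⁻¹ * (2 * Real.pi) ^ (-(d : ℝ) / 2)) - (σ ^ 2)⁻¹ / 2 * ‖y‖ ^ 2)
        + Real.log (postNorm q l σ y) := by
    ext y
    have := postNorm_pos (l := l) (σ := σ) hq y
    have hc : 0 < (σ ^ d)⁻¹ * (2 * Real.pi) ^ (-(d : ℝ) / 2) := by positivity
    have hn : ‖σ⁻¹ • y‖ ^ 2 = (σ ^ 2)⁻¹ * ‖y‖ ^ 2 := by
      rw [norm_smul, Real.norm_eq_abs, mul_pow, sq_abs, inv_pow]
    rw [← h2]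
    simp only [gaussDensity]
    rw [← mul_assoc, Real.log_mul (by positivity) this.ne', Real.log_mul hc.ne'
        (Real.exp_ne_zero _),
      Real.log_exp, hn]
    ring
  rw [h3]
  refine HasGradientAt.gradient ?_
  have h4 : HasGradientAt (fun y : Vec d =>
      Real.log ((σ ^ d)⁻¹ * (2 * Real.pi) ^ (-(d : ℝ) / 2)) - (σ ^ 2)⁻¹ / 2 * ‖y‖ ^ 2)
      (- ((σ ^ 2)⁻¹ • y)) y := by
    rw [hasGradientAt_iff_hasFDerivAt]
    have := ((hasStrictFDerivAt_norm_sq y).hasFDerivAt.const_mul ((σ ^ 2)⁻¹ / 2)).const_sub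
      (Real.log ((σ ^ d)⁻¹ * (2 * Real.pi) ^ (-(d : ℝ) / 2)))
    refine this.congr_fderiv (Eq.symm ?_)
    ext v
    simp
    ring
  rw [hasGradientAt_iff_hasFDerivAt] at h4 ⊢
  have h5 := hasGradientAt_log_postNorm (l := l) (σ := σ) hq y
  rw [hasGradientAt_iff_hasFDerivAt] at h5
  refine (h4.add h5).congr_fderiv ?_
  rw [← map_add]
  congr 1
  rw [smul_sub, smul_smul]
  module

end Score

lemma lintegral_trueDensity_mul (ν : Measure (Vec d)) [IsProbabilityMeasure ν] (β₀ : ℝ)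
    {h : Vec d → ℝ≥0∞} (hh : Measurable h) :
    ∫⁻ x, trueDensity ν β₀ x * h x ∂(_root_.stdGaussian d) =
      ∫⁻ w, ∫⁻ x, h (x + β₀ • w) ∂(_root_.stdGaussian d) ∂ν := by
  unfold trueDensity
  simp_rw [← fun x => lintegral_mul_const (μ := ν) (h x) (f := fun w : Vec d =>
    ENNReal.ofReal (Real.exp (β₀ * ⟪w, x⟫ - (β₀ * ‖w‖) ^ 2 / 2))) (by fun_prop)]
  rw [lintegral_lintegral_swap (by fun_prop)]
  refine lintegral_congr fun w => ?_
  rw [lintegral_stdGaussian_add _ hh]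
  refine lintegral_congr fun x => ?_
  rw [inner_smul_left, norm_smul, Real.norm_eq_abs, mul_pow, mul_pow, sq_abs, conj_trivial]

lemma lintegral_stepDensity_mul {D : Vec d → Vec d} {α β : ℝ} (hD : Measurable D)
    (hαβ : α ^ 2 + β ^ 2 = 1) {h : Vec d → ℝ≥0∞} (hh : Measurable h) :
    ∫⁻ x, stepDensity D α β x * h x ∂(_root_.stdGaussian d) =
      ∫⁻ g₁, ∫⁻ g₂, h (α • g₁ + β • (g₂ + D g₁)) ∂(_root_.stdGaussian d)
        ∂(_root_.stdGaussian d) := by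
  have hm : ∀ x, Measurable (fun x' => ENNReal.ofReal (stepWeight D α β x x')) := fun x =>
    ((measurable_stepWeight hD).comp
      (f := fun x' : Vec d => (x, x')) (by fun_prop)).ennreal_ofReal
  have h1 := lintegral_lintegral_reflection hαβ
    (F := fun g₁ g₂ => ENNReal.ofReal (Real.exp (⟪D g₁, g₂⟫ - ‖D g₁‖ ^ 2 / 2))
      * h (α • g₁ + β • g₂)) (by simp only [Function.uncurry_def]; fun_prop)
  have h2 : ∀ x, stepDensity D α β x * h x = ∫⁻ x', ENNReal.ofReal (Real.exp
      (⟪D (α • x + β • x'), β • x - α • x'⟫ - ‖D (α • x + β • x')‖ ^ 2 / 2))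
      * h (α • (α • x + β • x') + β • (β • x - α • x')) ∂(_root_.stdGaussian d) := by
    intro x
    rw [stepDensity, ← lintegral_mul_const _ (hm x)]
    refine lintegral_congr fun x' => ?_
    have : α • (α • x + β • x') + β • (β • x - α • x') = x := by
      calc _ = (α ^ 2 + β ^ 2) • x := by module
        _ = x := by rw [hαβ, one_smul]
    rw [this, stepWeight]
  rw [lintegral_congr h2, h1]
  refine lintegral_congr fun g₁ => ?_
  exact (lintegral_stdGaussian_add (D g₁) (f := fun g => h (α • g₁ + β • g)) (by fun_prop)).symm

lemma lintegral_postCentred {q : Measure (Vec d)} {l σ : ℝ} (y : Vec d)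
    {f : Vec d → ℝ≥0∞} (hf : Measurable f) :
    ∫⁻ w, f w ∂(postCentred q l σ y) = ∫⁻ θ, f (θ - postMean q l σ y) ∂(post q l σ y) := by
  rw [postCentred, lintegral_map hf (by fun_prop)]

section Posterior

variable {q : Measure (Vec d)} [IsProbabilityMeasure q] {R : ℝ} {l σ : ℝ}

lemma isProbabilityMeasure_postCentred (hq : ∀ᵐ θ ∂q, ‖θ‖ ≤ R) (y : Vec d) :
    IsProbabilityMeasure (postCentred q l σ y) := by
  have := isProbabilityMeasure_post (l := l) (σ := σ) hq y
  exact Measure.isProbabilityMeasure_map (by fun_prop)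

lemma ae_postCentred (hq : ∀ᵐ θ ∂q, ‖θ‖ ≤ R) (y : Vec d) :
    ∀ᵐ w ∂(postCentred q l σ y), ‖w‖ ≤ 2 * R := by
  rw [postCentred, ae_map_iff (by fun_prop) (measurableSet_le (by fun_prop) (by fun_prop))]
  filter_upwards [ae_post (l := l) (σ := σ) hq y] with θ hθ
  linarith [norm_sub_le θ (postMean q l σ y), norm_postMean_le (l := l) (σ := σ) hq y]

lemma integral_postCentred (hq : ∀ᵐ θ ∂q, ‖θ‖ ≤ R) (y : Vec d) :
    ∫ w, w ∂(postCentred q l σ y) = 0 := by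
  have := isProbabilityMeasure_post (l := l) (σ := σ) hq y
  rw [postCentred, integral_map (by fun_prop) (by fun_prop),
    integral_sub (integrable_of_continuous_of_bounded_support (ae_post hq y) continuous_id')
      (integrable_const _)]
  simp [postMean]

lemma tiltMean_postCentred (hq : ∀ᵐ θ ∂q, ‖θ‖ ≤ R) (ζ : ℝ) (y g : Vec d) :
    tiltMean (postCentred q l σ y) (l / σ ^ 2 * ζ) g =
      postMean q l σ (y + ζ • g) - postMean q l σ y := by
  have hP := isProbabilityMeasure_post (l := l) (σ := σ) hq y
  have hb := ae_post (l := l) (σ := σ) hq y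
  set ℓ := l / σ ^ 2 * ζ with hℓ
  set m := postMean q l σ y with hm
  have h1 : post q l σ (y + ζ • g) = (post q l σ y).tilted (fun θ => ℓ * ⟪θ, g⟫) := by
    rw [post, post, tilted_tilted (integrable_exp_logLik hq y)]
    congr 1
    ext θ
    simp only [logLik, Pi.add_apply, inner_add_right, inner_smul_right, hℓ]
    ring
  have h2 : postMean q l σ (y + ζ • g) =
      (∫ θ, Real.exp (ℓ * ⟪θ, g⟫) ∂(post q l σ y))⁻¹ •
        ∫ θ, Real.exp (ℓ * ⟪θ, g⟫) • θ ∂(post q l σ y) := by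
    rw [postMean, h1, integral_tilted, ← integral_smul]
    simp_rw [smul_smul, div_eq_inv_mul]
  have hi1 : Integrable (fun θ => Real.exp (ℓ * ⟪θ, g⟫)) (post q l σ y) :=
    integrable_of_continuous_of_bounded_support hb (by fun_prop)
  have hi2 : Integrable (fun θ => Real.exp (ℓ * ⟪θ, g⟫) • θ) (post q l σ y) :=
    integrable_of_continuous_of_bounded_support hb (by fun_prop)
  have hpos : 0 < ∫ θ, Real.exp (ℓ * ⟪θ, g⟫) ∂(post q l σ y) := integral_exp_pos hi1
  have h3 : ∀ θ : Vec d, Real.exp (ℓ * ⟪θ - m, g⟫) =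
      Real.exp (-(ℓ * ⟪m, g⟫)) * Real.exp (ℓ * ⟪θ, g⟫) := by
    intro θ
    rw [← Real.exp_add, inner_sub_left]
    congr 1; ring
  rw [tiltMean, postCentred, integral_map (by fun_prop) (by fun_prop),
    integral_map (by fun_prop) (by fun_prop), ← hm, h2]
  simp_rw [h3, mul_smul]
  rw [integral_const_mul, integral_smul]
  simp_rw [smul_sub]
  rw [integral_sub hi2 (hi1.smul_const _), integral_smul_const, smul_smul, mul_inv, mul_right_comm,
    inv_mul_cancel₀ (Real.exp_ne_zero _), one_mul, smul_sub, smul_smul,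
    inv_mul_cancel₀ hpos.ne', one_smul]

lemma lintegral_lintegral_postCentred_pow_le (hd : 1 ≤ d) (hq : ∀ᵐ θ ∂q, ‖θ‖ ≤ R) (hl : 0 < l)
    (hσ : 0 < σ) :
    ∫⁻ y, ∫⁻ w, ‖w‖ₑ ^ 4 ∂(postCentred q l σ y) ∂(mixLaw q l σ) ≤
      ENNReal.ofReal (1024 * ((σ / l) ^ 4 * d ^ 2)) := by
  have hstep : ∀ y, ∫⁻ w, ‖w‖ₑ ^ 4 ∂(postCentred q l σ y) ≤
      ∫⁻ θ, 16 * ‖θ - l⁻¹ • y‖ₑ ^ 4 ∂(post q l σ y) := by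
    intro y
    have hP := isProbabilityMeasure_post (l := l) (σ := σ) hq y
    have hb := ae_post (l := l) (σ := σ) hq y
    rw [lintegral_postCentred y (by fun_prop)]
    have hmean : ‖postMean q l σ y - l⁻¹ • y‖ₑ ^ 4 ≤
        ∫⁻ θ, ‖θ - l⁻¹ • y‖ₑ ^ 4 ∂(post q l σ y) := by
      have : postMean q l σ y - l⁻¹ • y = ∫ θ, (θ - l⁻¹ • y) ∂(post q l σ y) := by
        rw [integral_sub (integrable_of_continuous_of_bounded_support hb continuous_id')
          (integrable_const _)]
        simp [postMean]
      rw [this]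
      exact (pow_le_pow_left' (enorm_integral_le_lintegral_enorm _) 4).trans
        (lintegral_pow_le_of_isProbabilityMeasure _ (by fun_prop) (by norm_num))
    calc _ ≤ ∫⁻ θ, 8 * (‖θ - l⁻¹ • y‖ₑ ^ 4 + ‖postMean q l σ y - l⁻¹ • y‖ₑ ^ 4)
          ∂(post q l σ y) := by
          refine lintegral_mono fun θ => ?_
          have h1 : θ - postMean q l σ y =
            (θ - l⁻¹ • y) - (postMean q l σ y - l⁻¹ • y) := by abel
          rw [h1]
          refine (pow_le_pow_left' enorm_sub_le 4).trans ?_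
          have := ENNReal.rpow_add_le_mul_rpow_add_rpow ‖θ - l⁻¹ • y‖ₑ
            ‖postMean q l σ y - l⁻¹ • y‖ₑ (p := (4 : ℕ)) (by norm_num)
          simp only [ENNReal.rpow_natCast] at this
          rwa [show (((4 : ℕ) : ℝ) - 1) = ((3 : ℕ) : ℝ) by norm_num, ENNReal.rpow_natCast,
            show (2 : ℝ≥0∞) ^ 3 = 8 by norm_num] at this
      _ = 8 * (∫⁻ θ, ‖θ - l⁻¹ • y‖ₑ ^ 4 ∂(post q l σ y)
            + ‖postMean q l σ y - l⁻¹ • y‖ₑ ^ 4) := by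
          rw [lintegral_const_mul _ (by fun_prop), lintegral_add_right _ measurable_const]
          simp
      _ ≤ 8 * (∫⁻ θ, ‖θ - l⁻¹ • y‖ₑ ^ 4 ∂(post q l σ y)
            + ∫⁻ θ, ‖θ - l⁻¹ • y‖ₑ ^ 4 ∂(post q l σ y)) := by gcongr
      _ = _ := by
          rw [lintegral_const_mul _ (by fun_prop), ← two_mul, ← mul_assoc]; norm_num
  refine (lintegral_mono hstep).trans ?_
  rw [lintegral_lintegral_post hq hσ.ne' (by simp only [Function.uncurry_def]; fun_prop)]
  have h1 : ∀ θ g : Vec d, ‖θ - l⁻¹ • (l • θ + σ • g)‖ₑ ^ 4 =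
      ENNReal.ofReal ((σ / l) ^ 4) * ‖g‖ₑ ^ (2 * 2) := by
    intro θ g
    have : θ - l⁻¹ • (l • θ + σ • g) = -((σ / l) • g) := by
      rw [smul_add, smul_smul, inv_mul_cancel₀ hl.ne', one_smul, smul_smul]
      rw [sub_add_cancel_left, div_eq_inv_mul]
    rw [this, enorm_neg, enorm_smul, mul_pow, Real.enorm_eq_ofReal (by positivity),
      ENNReal.ofReal_pow (by positivity)]
  simp_rw [h1]
  rw [lintegral_const, measure_univ, mul_one, lintegral_const_mul _ (by fun_prop),
    lintegral_const_mul _ (by fun_prop)]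
  refine (mul_le_mul_right (mul_le_mul_right (lintegral_norm_pow_stdGaussian hd 2) _) _).trans ?_
  rw [← ENNReal.ofReal_mul (by positivity), show (16 : ℝ≥0∞) = ENNReal.ofReal 16 by norm_num,
    ← ENNReal.ofReal_mul (by norm_num)]
  apply ENNReal.ofReal_le_ofReal
  have : ((2 : ℕ).factorial : ℝ) = 2 := by norm_num [Nat.factorial]
  rw [this]
  linarith

end Posterior

lemma measurable_stepDensity_uncurry {X : Type*} [MeasurableSpace X] {D : X → Vec d → Vec d}
    (hD : Measurable (fun p : X × Vec d => D p.1 p.2)) (α β : ℝ) :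
    Measurable (fun p : X × Vec d => stepDensity (D p.1) α β p.2) := by
  unfold stepDensity stepWeight
  refine Measurable.lintegral_prod_right (f := fun (p : X × Vec d) (x' : Vec d) =>
    ENNReal.ofReal (Real.exp (⟪D p.1 (α • p.2 + β • x'), β • p.2 - α • x'⟫
      - ‖D p.1 (α • p.2 + β • x')‖ ^ 2 / 2))) ?_
  have h : Measurable (fun z : (X × Vec d) × Vec d => D z.1.1 (α • z.1.2 + β • z.2)) :=
    hD.comp (f := fun z : (X × Vec d) × Vec d => (z.1.1, α • z.1.2 + β • z.2)) (by fun_prop)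
  simp only [Function.uncurry_def]
  fun_prop

/-- The deviation of a score estimate from the score, on the scale of the posterior mean and
seen from the evaluation point `y + z₁ • g`. -/
def scoreError (q : Measure (Vec d)) (l σ z₁ : ℝ) (shat : Vec d → Vec d) (y g : Vec d) : Vec d :=
  (σ ^ 2 / l) • (shat (y + z₁ • g) -
    (σ ^ 2)⁻¹ • (l • postMean q l σ (y + z₁ • g) - (y + z₁ • g)))

/-- The normalised drift of the sampler started from `y`. -/
def stepDrift (q : Measure (Vec d)) (l σ z₁ b ξ : ℝ) (shat : Vec d → Vec d) (y : Vec d) :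
    Vec d → Vec d :=
  drift (postCentred q l σ y) (scoreError q l σ z₁ shat y) b (l / σ ^ 2 * z₁) ξ

section Step

variable {q : Measure (Vec d)} [IsProbabilityMeasure q] {R : ℝ} {l σ : ℝ}

lemma measurable_scoreError {shat : Vec d → Vec d} (hs : Measurable shat) (z₁ : ℝ) :
    Measurable (fun p : Vec d × Vec d => scoreError q l σ z₁ shat p.1 p.2) := by
  have hm := measurable_postMean (q := q) (l := l) (σ := σ)
  unfold scoreError
  fun_prop

lemma stepDrift_apply (hq : ∀ᵐ θ ∂q, ‖θ‖ ≤ R) (z₁ b ξ : ℝ) (shat : Vec d → Vec d) (y g : Vec d) :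
    stepDrift q l σ z₁ b ξ shat y g =
      b • (postMean q l σ (y + z₁ • g) - postMean q l σ y + scoreError q l σ z₁ shat y g) +
        ξ • g := by
  rw [stepDrift, drift, tiltMean_postCentred hq]

lemma measurable_stepDrift (hq : ∀ᵐ θ ∂q, ‖θ‖ ≤ R) {shat : Vec d → Vec d} (hs : Measurable shat)
    (z₁ b ξ : ℝ) :
    Measurable (fun p : Vec d × Vec d => stepDrift q l σ z₁ b ξ shat p.1 p.2) := by
  have hm := measurable_postMean (q := q) (l := l) (σ := σ)
  have he := measurable_scoreError (q := q) (l := l) (σ := σ) hs z₁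
  simp_rw [stepDrift_apply hq]
  fun_prop

lemma measurable_trueDensity_postCentred (hq : ∀ᵐ θ ∂q, ‖θ‖ ≤ R) (β₀ : ℝ) :
    Measurable (fun p : Vec d × Vec d => trueDensity (postCentred q l σ p.1) β₀ p.2) := by
  have hm := measurable_postMean (q := q) (l := l) (σ := σ)
  have h : ∀ p : Vec d × Vec d, trueDensity (postCentred q l σ p.1) β₀ p.2 =
      ∫⁻ θ, ENNReal.ofReal (Real.exp (β₀ * ⟪θ - postMean q l σ p.1, p.2⟫
        - (β₀ * ‖θ - postMean q l σ p.1‖) ^ 2 / 2)) ∂(post q l σ p.1) := fun p => by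
    rw [trueDensity, lintegral_postCentred _ (by fun_prop)]
  simp_rw [h]
  exact (measurable_lintegral_post (X := Vec d) hq (F := fun p θ => ENNReal.ofReal
    (Real.exp (β₀ * ⟪θ - postMean q l σ p.2, p.1⟫ - (β₀ * ‖θ - postMean q l σ p.2‖) ^ 2 / 2)))
    (by simp only [Function.uncurry_def]; fun_prop)).comp
    (f := fun p : Vec d × Vec d => (p.2, p.1)) (by fun_prop)

/-- The denoised noise law, in terms of the coordinates of the Gaussian proposal. -/
lemma mixLaw_eq_map_withDensity (hq : ∀ᵐ θ ∂q, ‖θ‖ ≤ R) (hσ : 0 < σ) {A B v β₀ l' σ' : ℝ}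
    (hv : 0 < v) (hβ₀ : β₀ * √v = B) (hl' : A * l + B = l') (hσ'0 : 0 ≤ σ')
    (hσ' : A ^ 2 * σ ^ 2 + v = σ' ^ 2) :
    mixLaw q l' σ' = (((mixLaw q l σ).prod (_root_.stdGaussian d)).withDensity
      (fun p => trueDensity (postCentred q l σ p.1) β₀ p.2)).map
      (fun p => A • p.1 + B • postMean q l σ p.1 + √v • p.2) := by
  have hm := measurable_postMean (q := q) (l := l) (σ := σ)
  have ht := measurable_trueDensity_postCentred (l := l) (σ := σ) hq β₀
  refine Measure.ext_of_lintegral _ fun f hf => ?_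
  rw [lintegral_map hf (by fun_prop), lintegral_withDensity_eq_lintegral_mul _ ht (by fun_prop),
    lintegral_prod _ (by fun_prop), lintegral_mixLaw _ _ _ hf]
  simp only [Pi.mul_apply]
  have h1 : ∀ y, ∫⁻ x, trueDensity (postCentred q l σ y) β₀ x *
      f (A • y + B • postMean q l σ y + √v • x) ∂(_root_.stdGaussian d) =
      ∫⁻ θ, ∫⁻ x, f (A • y + B • θ + √v • x) ∂(_root_.stdGaussian d) ∂(post q l σ y) := by
    intro y
    have := isProbabilityMeasure_postCentred (l := l) (σ := σ) hq y
    rw [lintegral_trueDensity_mul _ _ (h := fun x => f (A • y + B • postMean q l σ y + √v • x))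
      (by fun_prop), lintegral_postCentred _
      (Measurable.lintegral_prod_right (by simp only [Function.uncurry_def]; fun_prop))]
    refine lintegral_congr fun θ => lintegral_congr fun x => ?_
    congr 1
    rw [← hβ₀]
    module
  simp_rw [h1]
  rw [lintegral_lintegral_post hq hσ.ne'
    (Measurable.lintegral_prod_right (by simp only [Function.uncurry_def]; fun_prop))]
  refine lintegral_congr fun θ => ?_
  have h2 := congrArg (fun μ => ∫⁻ x, f (l' • θ + x) ∂μ) (map_add_stdGaussian (d := d) (A * σ) (√v))
  rw [lintegral_map (by fun_prop) (by fun_prop), lintegral_map (by fun_prop) (by fun_prop),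
    lintegral_prod _ (by fun_prop), mul_pow, Real.sq_sqrt hv.le, hσ', Real.sqrt_sq hσ'0] at h2
  rw [← h2]
  refine lintegral_congr fun g => lintegral_congr fun x => ?_
  congr 1
  rw [← hl']
  module

/-- The law after one sampler step, in terms of the coordinates of the Gaussian proposal. -/
lemma map_step_eq_map_withDensity (hq : ∀ᵐ θ ∂q, ‖θ‖ ≤ R) (P : Measure (Vec d)) [SFinite P]
    {shat : Vec d → Vec d} (hs : Measurable shat) (hl : 0 < l) (hσ : 0 < σ)
    {A c z₁ z₂ z₃ v α β b ξ : ℝ}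
    (hαβ : α ^ 2 + β ^ 2 = 1) (hβ : β * √v = z₃)
    (hb : b * z₃ = l * c / σ ^ 2) (hξ : ξ * z₃ = z₂ - c * z₁ / σ ^ 2 - α * √v) :
    (P.prod ((_root_.stdGaussian d).prod (_root_.stdGaussian d))).map
        (fun p : Vec d × (Vec d × Vec d) => A • p.1 + c • shat (p.1 + z₁ • p.2.1)
          + z₂ • p.2.1 + z₃ • p.2.2) =
      ((P.prod (_root_.stdGaussian d)).withDensity
      (fun p => stepDensity (stepDrift q l σ z₁ b ξ shat p.1) α β p.2)).map
      (fun p => (A - c / σ ^ 2) • p.1 + (l * c / σ ^ 2) • postMean q l σ p.1 + √v • p.2) := by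
  have hm := measurable_postMean (q := q) (l := l) (σ := σ)
  have hD := measurable_stepDrift (l := l) (σ := σ) hq hs z₁ b ξ
  have ht := measurable_stepDensity_uncurry hD α β
  refine Measure.ext_of_lintegral _ fun f hf => ?_
  rw [lintegral_map hf (by fun_prop), lintegral_map hf (by fun_prop),
    lintegral_withDensity_eq_lintegral_mul _ ht (by fun_prop),
    lintegral_prod _ (by fun_prop), lintegral_prod _ (by fun_prop)]
  refine lintegral_congr fun y => ?_
  simp only [Pi.mul_apply]
  have hDy : Measurable (stepDrift q l σ z₁ b ξ shat y) :=
    hD.comp (f := fun g : Vec d => (y, g)) (by fun_prop)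
  rw [lintegral_stepDensity_mul hDy hαβ (h := fun x => f ((A - c / σ ^ 2) • y +
    (l * c / σ ^ 2) • postMean q l σ y + √v • x)) (by fun_prop), lintegral_prod _ (by fun_prop)]
  refine lintegral_congr fun g₁ => lintegral_congr fun g₂ => ?_
  congr 1
  have e1 : √v • (α • g₁ + β • (g₂ + stepDrift q l σ z₁ b ξ shat y g₁)) =
      (α * √v) • g₁ + z₃ • g₂ + z₃ • stepDrift q l σ z₁ b ξ shat y g₁ := by
    rw [← hβ]; module
  have e2 : z₃ • stepDrift q l σ z₁ b ξ shat y g₁ =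
      (l * c / σ ^ 2) • (postMean q l σ (y + z₁ • g₁) - postMean q l σ y) +
      c • (shat (y + z₁ • g₁) -
        (σ ^ 2)⁻¹ • (l • postMean q l σ (y + z₁ • g₁) - (y + z₁ • g₁))) +
      (z₂ - c * z₁ / σ ^ 2 - α * √v) • g₁ := by
    have hc : z₃ * b * (σ ^ 2 / l) = c := by rw [mul_comm z₃, hb]; field_simp
    rw [stepDrift_apply hq, scoreError]
    generalize postMean q l σ (y + z₁ • g₁) - postMean q l σ y = M
    generalize shat (y + z₁ • g₁) -
      (σ ^ 2)⁻¹ • (l • postMean q l σ (y + z₁ • g₁) - (y + z₁ • g₁)) = N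
    calc _ = (b * z₃) • M + (z₃ * b * (σ ^ 2 / l)) • N + (ξ * z₃) • g₁ := by module
      _ = _ := by rw [hc, hb, hξ]
  rw [e1, e2]
  module

theorem klDiv_step_le (hq : ∀ᵐ θ ∂q, ‖θ‖ ≤ R) (P : Measure (Vec d)) [IsProbabilityMeasure P]
    {shat : Vec d → Vec d} (hs : Measurable shat) (hl : 0 < l) (hσ : 0 < σ)
    {A c z₁ z₂ z₃ v α β β₀ b ξ l' σ' : ℝ} (hv : 0 < v)
    (hαβ : α ^ 2 + β ^ 2 = 1) (hβ : β * √v = z₃) (hβ₀ : β₀ * √v = l * c / σ ^ 2)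
    (hb : b * z₃ = l * c / σ ^ 2) (hξ : ξ * z₃ = z₂ - c * z₁ / σ ^ 2 - α * √v)
    (hl' : A * l = l') (hσ'0 : 0 ≤ σ') (hσ' : (A - c / σ ^ 2) ^ 2 * σ ^ 2 + v = σ' ^ 2) :
    InformationTheory.klDiv (mixLaw q l' σ')
      ((P.prod ((_root_.stdGaussian d).prod (_root_.stdGaussian d))).map
        (fun p : Vec d × (Vec d × Vec d) => A • p.1 + c • shat (p.1 + z₁ • p.2.1)
          + z₂ • p.2.1 + z₃ • p.2.2)) ≤
      InformationTheory.klDiv (mixLaw q l σ) P +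
      ∫⁻ y, ∫⁻ x, ENNReal.ofReal (((trueDensity (postCentred q l σ y) β₀ x).toReal -
        (stepDensity (stepDrift q l σ z₁ b ξ shat y) α β x).toReal) ^ 2 /
        (stepDensity (stepDrift q l σ z₁ b ξ shat y) α β x).toReal) ∂(_root_.stdGaussian d)
        ∂(mixLaw q l σ) := by
  have hm := measurable_postMean (q := q) (l := l) (σ := σ)
  have hD := measurable_stepDrift (l := l) (σ := σ) hq hs z₁ b ξ
  have hDy : ∀ y, Measurable (stepDrift q l σ z₁ b ξ shat y) := fun y =>
    hD.comp (f := fun g : Vec d => (y, g)) (by fun_prop)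
  rw [map_step_eq_map_withDensity hq P hs hl hσ hαβ hβ hb hξ,
    mixLaw_eq_map_withDensity hq hσ hv hβ₀ (l := l) (A := A - c / σ ^ 2) (l' := l')
      (by rw [← hl']; ring) hσ'0 hσ']
  have h1 : ∀ y, ∫⁻ x, trueDensity (postCentred q l σ y) β₀ x ∂(_root_.stdGaussian d) = 1 :=
    fun y => by
      have := isProbabilityMeasure_postCentred (l := l) (σ := σ) hq y
      exact lintegral_trueDensity _ _
  have hΦ : Measurable (fun p : Vec d × Vec d =>
      (A - c / σ ^ 2) • p.1 + (l * c / σ ^ 2) • postMean q l σ p.1 + √v • p.2) := by fun_prop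
  have hp1 : ∀ y, ∫⁻ x, stepDensity (stepDrift q l σ z₁ b ξ shat y) α β x
      ∂(_root_.stdGaussian d) = 1 := fun y => lintegral_stepDensity (hDy y) hαβ
  have hp0 : ∀ z : Vec d × Vec d, stepDensity (stepDrift q l σ z₁ b ξ shat z.1) α β z.2 ≠ 0 := by
    intro z
    have := stepDensity_ne_zero (α := α) (β := β) (hDy z.1) z.2
    exact this
  exact klDiv_map_withDensity_prod_le (mixLaw q l σ) P (_root_.stdGaussian d)
    (q := fun p => trueDensity (postCentred q l σ p.1) β₀ p.2)
    (p := fun p => stepDensity (stepDrift q l σ z₁ b ξ shat p.1) α β p.2)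
    (measurable_trueDensity_postCentred hq β₀) (measurable_stepDensity_uncurry hD α β)
    h1 hp1 hp0 hΦ

end Step

lemma ENNReal.ofReal_sqrt_sqrt {x : ℝ} (hx : 0 ≤ x) :
    ENNReal.ofReal (√√x) = ENNReal.ofReal x ^ (1 / 4 : ℝ) := by
  rw [← ENNReal.ofReal_rpow_half (Real.sqrt_nonneg _), ← ENNReal.ofReal_rpow_half hx,
    ← ENNReal.rpow_mul]
  norm_num

/-- Concavity of `stepError` in its last two arguments. -/
lemma lintegral_stepError_le (μ : Measure (Vec d)) [IsProbabilityMeasure μ] {s η ξ Eb Vb : ℝ}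
    (hE0 : 0 ≤ Eb) (hV0 : 0 ≤ Vb) {E V : Vec d → ℝ≥0∞} (hE : Measurable E)
    (hV : Measurable V) (hEt : ∀ y, E y ≠ ∞) (hVt : ∀ y, V y ≠ ∞)
    (hEb : ∫⁻ y, E y ∂μ ≤ ENNReal.ofReal Eb) (hVb : ∫⁻ y, V y ∂μ ≤ ENNReal.ofReal Vb) :
    ∫⁻ y, ENNReal.ofReal (stepError d s η ξ (E y).toReal (V y).toReal) ∂μ ≤
      ENNReal.ofReal (stepError d s η ξ Eb Vb) := by
  have h1 : ∀ a b : ℝ, 0 ≤ a → 0 ≤ b → ENNReal.ofReal (stepError d s η ξ a b) =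
      (ENNReal.ofReal (s ^ 6 * d ^ 4) * ENNReal.ofReal b) ^ (1 / 2 : ℝ) +
      ENNReal.ofReal (s ^ 2 * η ^ 2 * d ^ 2 + s ^ 4 * d ^ 4 + ξ ^ 2 * d) +
      (ENNReal.ofReal (s ^ 4 * d ^ 3) * ENNReal.ofReal a) ^ (1 / 4 : ℝ) := by
    intro a b ha hb
    rw [stepError, ENNReal.ofReal_add (by positivity) (by positivity),
      ENNReal.ofReal_add (by positivity) (by positivity), ENNReal.ofReal_sqrt_sqrt (by positivity),
      ← ENNReal.ofReal_rpow_half (by positivity), ENNReal.ofReal_mul (by positivity),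
      ENNReal.ofReal_mul (p := s ^ 4 * d ^ 3) (by positivity)]
  simp_rw [h1 _ _ ENNReal.toReal_nonneg ENNReal.toReal_nonneg, ENNReal.ofReal_toReal (hEt _),
    ENNReal.ofReal_toReal (hVt _)]
  rw [h1 _ _ hE0 hV0, lintegral_add_left (by fun_prop), lintegral_add_left (by fun_prop),
    lintegral_const, measure_univ, mul_one]
  gcongr
  · refine (lintegral_rpow_le_rpow_lintegral μ (by fun_prop) (by norm_num) (by norm_num)).trans ?_
    rw [lintegral_const_mul _ hV]
    gcongr
  · refine (lintegral_rpow_le_rpow_lintegral μ (by fun_prop) (by norm_num) (by norm_num)).trans ?_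
    rw [lintegral_const_mul _ hE]
    gcongr

theorem exists_klDiv_step_le : ∃ C : ℝ, 0 < C ∧ ∀ (d : ℕ), 1 ≤ d →
    ∀ (q : Measure (Vec d)) [IsProbabilityMeasure q] (P : Measure (Vec d)) [IsProbabilityMeasure P]
      (shat : Vec d → Vec d) (l σ l' σ' A c z₁ z₂ z₃ v α β β₀ b ξ s η E : ℝ),
    (∀ᵐ θ ∂q, ‖θ‖ ≤ √d) → Measurable shat → 0 < l → 0 < σ → 0 < v →
    α ^ 2 + β ^ 2 = 1 → β * √v = z₃ → β₀ * √v = l * c / σ ^ 2 → b * z₃ = l * c / σ ^ 2 →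
    ξ * z₃ = z₂ - c * z₁ / σ ^ 2 - α * √v → A * l = l' → 0 ≤ σ' →
    (A - c / σ ^ 2) ^ 2 * σ ^ 2 + v = σ' ^ 2 →
    0 ≤ β₀ → β₀ ^ 2 ≤ s → b ^ 2 ≤ s → (l / σ ^ 2 * z₁) ^ 2 ≤ s →
    |β₀ ^ 2 / 2 - b * (l / σ ^ 2 * z₁) * (α * β)| ≤ s * η →
    s * d ≤ 1 / 1024 → ξ ^ 2 * d ≤ 1 / 256 → 0 ≤ η → 0 ≤ E →
    (∀ y, ‖scoreError q l σ 0 shat y 0‖ ≤ 2 * √d) →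
    ∫⁻ y, ∫⁻ g, ‖scoreError q l σ z₁ shat y g‖ₑ ^ 2 ∂(_root_.stdGaussian d) ∂(mixLaw q l σ) ≤
      ENNReal.ofReal E →
    InformationTheory.klDiv (mixLaw q l' σ')
      ((P.prod ((_root_.stdGaussian d).prod (_root_.stdGaussian d))).map
        (fun p : Vec d × (Vec d × Vec d) => A • p.1 + c • shat (p.1 + z₁ • p.2.1)
          + z₂ • p.2.1 + z₃ • p.2.2)) ≤
      InformationTheory.klDiv (mixLaw q l σ) P +
        ENNReal.ofReal (C * stepError d s η ξ E (1024 * ((σ / l) ^ 4 * d ^ 2))) := by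
  obtain ⟨C, hC, H⟩ := exists_chiSq_step_le
  refine ⟨C, hC, ?_⟩
  intro d hd q _ P _ shat l σ l' σ' A c z₁ z₂ z₃ v α β β₀ b ξ s η E hq hs hl hσ hv hαβ hβ hβ₀ hb hξ
    hl' hσ'0 hσ' hβ₀0 hβ₀s hbs hℓs hab hsd hξd hη hE he heE
  refine (klDiv_step_le hq P hs hl hσ hv hαβ hβ hβ₀ hb hξ hl' hσ'0 hσ').trans ?_
  gcongr
  have hs0 : 0 ≤ s := (sq_nonneg _).trans hbs
  have hem := measurable_scoreError (q := q) (l := l) (σ := σ) hs z₁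
  have hemy : ∀ y, Measurable (scoreError q l σ z₁ shat y) := fun y =>
    hem.comp (f := fun g : Vec d => (y, g)) (by fun_prop)
  have he' : ∀ y g, ‖scoreError q l σ z₁ shat y g‖ ≤ 2 * √d := by
    intro y g
    have := he (y + z₁ • g)
    simpa [scoreError] using this
  have hEle : ∀ y, ∫⁻ g, ‖scoreError q l σ z₁ shat y g‖ₑ ^ 2 ∂(_root_.stdGaussian d) ≤
      ENNReal.ofReal (4 * d) := by
    intro y
    calc _ ≤ ∫⁻ _, ENNReal.ofReal (4 * d) ∂(_root_.stdGaussian d) := by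
          refine lintegral_mono fun g => ?_
          rw [← ofReal_norm, ← ENNReal.ofReal_pow (norm_nonneg _)]
          apply ENNReal.ofReal_le_ofReal
          calc _ ≤ (2 * √d) ^ 2 := by gcongr; exact he' y g
            _ = _ := by rw [mul_pow, Real.sq_sqrt (by positivity)]; norm_num
      _ = _ := by simp
  have hVle : ∀ y, ∫⁻ w, ‖w‖ₑ ^ 4 ∂(postCentred q l σ y) ≤ ENNReal.ofReal ((2 * √d) ^ 4) := by
    intro y
    have := isProbabilityMeasure_postCentred (l := l) (σ := σ) hq y
    calc _ ≤ ∫⁻ _, ENNReal.ofReal ((2 * √d) ^ 4) ∂(postCentred q l σ y) := by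
          refine lintegral_mono_ae ?_
          filter_upwards [ae_postCentred (l := l) (σ := σ) hq y] with w hw
          rw [← ofReal_norm, ← ENNReal.ofReal_pow (norm_nonneg _)]
          gcongr
      _ = _ := by simp
  have hVm : Measurable (fun y => ∫⁻ w, ‖w‖ₑ ^ 4 ∂(postCentred q l σ y)) := by
    have hm := measurable_postMean (q := q) (l := l) (σ := σ)
    simp_rw [fun y => lintegral_postCentred (q := q) (l := l) (σ := σ) y
      (f := fun w : Vec d => ‖w‖ₑ ^ 4) (by fun_prop)]
    exact (measurable_lintegral_post (X := Unit) hq (F := fun p θ => ‖θ - postMean q l σ p.2‖ₑ ^ 4)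
      (by simp only [Function.uncurry_def]; fun_prop)).comp (f := fun y => ((), y)) (by fun_prop)
  have hEm : Measurable (fun y => ∫⁻ g, ‖scoreError q l σ z₁ shat y g‖ₑ ^ 2
      ∂(_root_.stdGaussian d)) :=
    Measurable.lintegral_prod_right (f := fun y g => ‖scoreError q l σ z₁ shat y g‖ₑ ^ 2)
      (by simp only [Function.uncurry_def]; fun_prop)
  have hEt : ∀ y, ∫⁻ g, ‖scoreError q l σ z₁ shat y g‖ₑ ^ 2 ∂(_root_.stdGaussian d) ≠ ∞ :=
    fun y => ((hEle y).trans_lt ENNReal.ofReal_lt_top).ne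
  have hVt : ∀ y, ∫⁻ w, ‖w‖ₑ ^ 4 ∂(postCentred q l σ y) ≠ ∞ :=
    fun y => ((hVle y).trans_lt ENNReal.ofReal_lt_top).ne
  calc _ ≤ ∫⁻ y, ENNReal.ofReal (C * stepError d s η ξ
        (∫⁻ g, ‖scoreError q l σ z₁ shat y g‖ₑ ^ 2 ∂(_root_.stdGaussian d)).toReal
        (∫⁻ w, ‖w‖ₑ ^ 4 ∂(postCentred q l σ y)).toReal) ∂(mixLaw q l σ) := by
        refine lintegral_mono fun y => ?_
        have := isProbabilityMeasure_postCentred (l := l) (σ := σ) hq y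
        refine H d hd (postCentred q l σ y) (scoreError q l σ z₁ shat y) α β β₀ b
          (l / σ ^ 2 * z₁) ξ s η _ _ (ae_postCentred hq y) (integral_postCentred hq y) (hemy y)
              (he' y)
          hαβ hβ₀0 hβ₀s hbs hℓs hab hsd hξd hη ENNReal.toReal_nonneg ENNReal.toReal_nonneg ?_
          (ENNReal.ofReal_toReal (hEt y)).ge (ENNReal.ofReal_toReal (hVt y)).ge
        exact ENNReal.toReal_le_of_le_ofReal (by positivity) (hEle y)
    _ = ENNReal.ofReal C * ∫⁻ y, ENNReal.ofReal (stepError d s η ξ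
        (∫⁻ g, ‖scoreError q l σ z₁ shat y g‖ₑ ^ 2 ∂(_root_.stdGaussian d)).toReal
        (∫⁻ w, ‖w‖ₑ ^ 4 ∂(postCentred q l σ y)).toReal) ∂(mixLaw q l σ) := by
        simp_rw [ENNReal.ofReal_mul hC.le]
        rw [lintegral_const_mul' _ _ ENNReal.ofReal_ne_top]
    _ ≤ _ := by
        rw [ENNReal.ofReal_mul hC.le]
        gcongr
        exact lintegral_stepError_le (mixLaw q l σ) hE (by positivity) hEm hVm hEt hVt heE
          (lintegral_lintegral_postCentred_pow_le hd hq hl hσ)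

/-- Chi-square divergence between a translate of the standard Gaussian and itself. -/
lemma lintegral_exp_inner_sub_one_sq_stdGaussian (w : Vec d) :
    ∫⁻ x, ENNReal.ofReal ((Real.exp (⟪w, x⟫ - ‖w‖ ^ 2 / 2) - 1) ^ 2) ∂(_root_.stdGaussian d) =
      ENNReal.ofReal (Real.exp (‖w‖ ^ 2) - 1) := by
  have h1 : ∫⁻ x, (ENNReal.ofReal ((Real.exp (⟪w, x⟫ - ‖w‖ ^ 2 / 2) - 1) ^ 2) +
      2 * ENNReal.ofReal (Real.exp (⟪w, x⟫ - ‖w‖ ^ 2 / 2))) ∂(_root_.stdGaussian d) =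
      ∫⁻ x, (ENNReal.ofReal (Real.exp (-‖w‖ ^ 2)) * ENNReal.ofReal (Real.exp ⟪(2 : ℝ) • w, x⟫) + 1)
        ∂(_root_.stdGaussian d) := by
    refine lintegral_congr fun x => ?_
    rw [← ENNReal.ofReal_mul (by positivity), ← Real.exp_add, ← ENNReal.ofReal_one,
      ← ENNReal.ofReal_add (by positivity) (by positivity), two_mul, ← ENNReal.ofReal_add
          (by positivity) (by positivity),
      ← ENNReal.ofReal_add (by positivity) (by positivity),
      inner_smul_left]
    congr 1
    have : Real.exp (-‖w‖ ^ 2 + (starRingEnd ℝ) 2 * ⟪w, x⟫)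
        = Real.exp (⟪w, x⟫ - ‖w‖ ^ 2 / 2) ^ 2 := by
      rw [← Real.exp_nat_mul]
      congr 1
      simp
      ring
    rw [this]
    ring
  rw [lintegral_add_right _ (by fun_prop), lintegral_const_mul _ (by fun_prop),
    lintegral_exp_inner_sub_stdGaussian, lintegral_add_right _ (by fun_prop),
    lintegral_const_mul _ (by fun_prop), lintegral_exp_inner_stdGaussian, lintegral_const,
    measure_univ, ← ENNReal.ofReal_mul (by positivity), ← Real.exp_add, norm_smul] at h1
  have h2 : -‖w‖ ^ 2 + (‖(2 : ℝ)‖ * ‖w‖) ^ 2 / 2 = ‖w‖ ^ 2 := by norm_num; ring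
  rw [h2] at h1
  have h3 : ENNReal.ofReal (Real.exp (‖w‖ ^ 2)) + 1 * 1 =
      ENNReal.ofReal (Real.exp (‖w‖ ^ 2) - 1) + 2 * 1 := by
    rw [show (2 : ℝ≥0∞) * 1 = ENNReal.ofReal 2 by simp,
      show (1 : ℝ≥0∞) * 1 = ENNReal.ofReal 1 by simp,
      ← ENNReal.ofReal_add (by positivity) (by norm_num), ← ENNReal.ofReal_add _ (by norm_num)]
    · congr 1; ring
    · have := Real.add_one_le_exp (‖w‖ ^ 2)
      nlinarith [sq_nonneg ‖w‖]
  rw [h3] at h1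
  exact (ENNReal.add_left_inj (by simp)).1 h1

lemma klDiv_mixLaw_stdGaussian_le {q : Measure (Vec d)} [IsProbabilityMeasure q] {l σ r : ℝ}
    (hd : 1 ≤ d) (hq : ∀ᵐ θ ∂q, ‖θ‖ ≤ √d) (hσ : 0 < σ) (h1 : l ^ 2 + σ ^ 2 = 1)
    (hr : (l / σ) ^ 2 = r) (hrd : 8 * r * d ≤ 1) :
    InformationTheory.klDiv (mixLaw q l σ) (_root_.stdGaussian d)
        ≤ ENNReal.ofReal (32 * (r * d)) := by
  have hd' : (0 : ℝ) < d := by exact_mod_cast hd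
  have hr0 : 0 ≤ r := hr ▸ sq_nonneg _
  let W : Vec d × Vec d → Vec d := fun y => (l / σ) • (y.1 - y.2)
  let D : (Vec d × Vec d) × Vec d → ℝ≥0∞ :=
    fun p => ENNReal.ofReal (Real.exp (⟪W p.1, p.2⟫ - ‖W p.1‖ ^ 2 / 2))
  have hWm : Measurable W := by unfold W; fun_prop
  have hD : Measurable D := by unfold D; fun_prop
  let Φ : (Vec d × Vec d) × Vec d → Vec d := fun p => l • p.1.2 + σ • p.2
  have hΦ : Measurable Φ := by unfold Φ; fun_prop
  have key := klDiv_map_withDensity_prod_le (q.prod (_root_.stdGaussian d))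
    (q.prod (_root_.stdGaussian d)) (_root_.stdGaussian d) (q := D) (p := fun _ => 1) hD
        measurable_const
    (fun y => lintegral_exp_inner_sub_stdGaussian (W y)) (by simp) (by simp) hΦ
  have e1 : (((q.prod (_root_.stdGaussian d)).prod (_root_.stdGaussian d)).withDensity
      (fun _ => 1)).map Φ = _root_.stdGaussian d := by
    have : (fun _ : (Vec d × Vec d) × Vec d => (1 : ℝ≥0∞)) = 1 := rfl
    rw [this, withDensity_one]
    refine Measure.ext_of_lintegral _ fun f hf => ?_
    rw [lintegral_map hf hΦ, lintegral_prod _ (by fun_prop), lintegral_prod _ (by fun_prop)]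
    have h2 : ∀ x : Vec d, ∫⁻ y, ∫⁻ z, f (Φ ((x, y), z)) ∂(_root_.stdGaussian d)
        ∂(_root_.stdGaussian d) = ∫⁻ z, f z ∂(_root_.stdGaussian d) := by
      intro x
      rw [← lintegral_prod (f := fun p : Vec d × Vec d => f (Φ ((x, p.1), p.2)))
        (by fun_prop)]
      have := congrArg (fun μ => ∫⁻ z, f z ∂μ) (map_add_stdGaussian (d := d) l σ)
      simp only [h1, Real.sqrt_one, one_smul, Measure.map_id'] at this
      rw [lintegral_map hf (by fun_prop)] at this
      exact this
    simp [h2]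
  have e2 : (((q.prod (_root_.stdGaussian d)).prod (_root_.stdGaussian d)).withDensity D).map Φ =
      mixLaw q l σ := by
    refine Measure.ext_of_lintegral _ fun f hf => ?_
    rw [lintegral_map hf hΦ, lintegral_withDensity_eq_lintegral_mul _ hD (by fun_prop),
      lintegral_prod _ (by fun_prop), lintegral_prod _ (by fun_prop), lintegral_mixLaw q l σ hf]
    have h2 : ∀ θ y : Vec d, ∫⁻ x, (D * fun a => f (Φ a)) ((θ, y), x) ∂(_root_.stdGaussian d) =
        ∫⁻ x, f (l • θ + σ • x) ∂(_root_.stdGaussian d) := by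
      intro θ y
      have := lintegral_stdGaussian_add (W (θ, y)) (f := fun x => f (l • y + σ • x)) (by fun_prop)
      simp only [Pi.mul_apply, D, Φ]
      rw [← this]
      refine lintegral_congr fun x => ?_
      congr 1
      simp only [W, smul_add, smul_smul, smul_sub, mul_div_cancel₀ l hσ.ne']
      abel
    simp only [h2, lintegral_const, measure_univ, mul_one]
  rw [e1, e2, InformationTheory.klDiv_self, zero_add] at key
  refine key.trans ?_
  have h3 : ∀ y : Vec d × Vec d, ∫⁻ x, ENNReal.ofReal
      (((D (y, x)).toReal - (1 : ℝ≥0∞).toReal) ^ 2 / (1 : ℝ≥0∞).toReal) ∂(_root_.stdGaussian d) =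
      ENNReal.ofReal (Real.exp (‖W y‖ ^ 2) - 1) := by
    intro y
    rw [← lintegral_exp_inner_sub_one_sq_stdGaussian]
    refine lintegral_congr fun x => ?_
    simp only [D, ENNReal.toReal_ofReal (Real.exp_pos _).le, ENNReal.toReal_one, div_one]
  simp_rw [h3]
  rw [lintegral_prod _ (by fun_prop)]
  have h4 : ∀ᵐ θ ∂q, ∫⁻ y, ENNReal.ofReal (Real.exp (‖W (θ, y)‖ ^ 2) - 1) ∂(_root_.stdGaussian d) ≤
      ENNReal.ofReal (32 * (r * d)) := by
    filter_upwards [hq] with θ hθ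
    calc _ ≤ ∫⁻ y, ENNReal.ofReal (16 * (r * d)) * ENNReal.ofReal (Real.exp (‖y‖ ^ 2 / (4 * d)))
          ∂(_root_.stdGaussian d) := by
          refine lintegral_mono fun y => ?_
          rw [← ENNReal.ofReal_mul (by positivity)]
          apply ENNReal.ofReal_le_ofReal
          have a1 : ‖θ‖ ^ 2 ≤ d := by
            calc _ ≤ √d ^ 2 := by gcongr
              _ = d := Real.sq_sqrt hd'.le
          have a2 : ‖W (θ, y)‖ ^ 2 ≤ 8 * r * d * (1 / 4 + ‖y‖ ^ 2 / (4 * d)) := by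
            have : ‖θ - y‖ ^ 2 ≤ 2 * (d + ‖y‖ ^ 2) := by
              calc _ ≤ (‖θ‖ + ‖y‖) ^ 2 := by gcongr; exact norm_sub_le _ _
                _ ≤ _ := by nlinarith [sq_nonneg (‖θ‖ - ‖y‖)]
            simp only [W, norm_smul, mul_pow, Real.norm_eq_abs, sq_abs, hr]
            calc _ ≤ r * (2 * (d + ‖y‖ ^ 2)) := by gcongr
              _ = _ := by field_simp; ring
          set Z := 1 / 4 + ‖y‖ ^ 2 / (4 * d) with hZ
          have hZ0 : 0 ≤ Z := by positivity
          set a := 8 * r * d with ha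
          have ha0 : 0 ≤ a := by positivity
          have a3 : Real.exp (a * Z) ≤ (1 - a) * 1 + a * Real.exp Z := by
            have := convexOn_exp.2 (Set.mem_univ 0) (Set.mem_univ Z)
              (show 0 ≤ 1 - a by linarith) ha0 (by ring)
            simpa using this
          have a4 : Real.exp Z ≤ 2 * Real.exp (‖y‖ ^ 2 / (4 * d)) := by
            rw [hZ, Real.exp_add]
            gcongr
            have : Real.exp (1 / 4) ≤ 2 := by
              have h := Real.exp_bound' (x := 1 / 4) (by norm_num) (by norm_num) (n := 2)
                  (by norm_num)
              norm_num [Finset.sum_range_succ] at h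
              linarith
            exact this
          calc _ ≤ Real.exp (a * Z) - 1 := by gcongr
            _ ≤ a * Real.exp Z := by linarith
            _ ≤ a * (2 * Real.exp (‖y‖ ^ 2 / (4 * d))) := by gcongr
            _ = _ := by rw [ha]; ring
      _ ≤ ENNReal.ofReal (16 * (r * d)) * 2 := by
          rw [lintegral_const_mul _ (by fun_prop)]
          gcongr
          exact lintegral_exp_norm_sq_stdGaussian hd
      _ = _ := by
          rw [show (2 : ℝ≥0∞) = ENNReal.ofReal 2 by simp, ← ENNReal.ofReal_mul (by positivity)]
          congr 1; ring
  calc _ ≤ ∫⁻ _, ENNReal.ofReal (32 * (r * d)) ∂q := lintegral_mono_ae h4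
    _ = _ := by simp

/-- Composition of two Gaussian noising steps. -/
lemma lintegral_mixLaw_add (q : Measure (Vec d)) [IsProbabilityMeasure q] {l σ z l' σ' a b : ℝ}
    (hl : a * l' = l) (hσ : σ ^ 2 + z ^ 2 = (a * σ') ^ 2 + b ^ 2) {f : Vec d → ℝ≥0∞}
    (hf : Measurable f) :
    ∫⁻ y, ∫⁻ g, f (y + z • g) ∂(_root_.stdGaussian d) ∂(mixLaw q l σ) =
      ∫⁻ y, ∫⁻ g, f (a • y + b • g) ∂(_root_.stdGaussian d) ∂(mixLaw q l' σ') := by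
  have key : ∀ (s t : ℝ) (w : Vec d), ∫⁻ x, ∫⁻ g, f (w + s • x + t • g) ∂(_root_.stdGaussian d)
      ∂(_root_.stdGaussian d) =
      ∫⁻ x, f (w + √(s ^ 2 + t ^ 2) • x) ∂(_root_.stdGaussian d) := by
    intro s t w
    rw [← lintegral_prod (f := fun p : Vec d × Vec d => f (w + s • p.1 + t • p.2))
      (by fun_prop)]
    have := congrArg (fun μ => ∫⁻ z, f (w + z) ∂μ) (map_add_stdGaussian (d := d) s t)
    rw [lintegral_map (by fun_prop) (by fun_prop), lintegral_map (by fun_prop)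
        (by fun_prop)] at this
    simpa only [add_assoc] using this
  rw [lintegral_mixLaw q l σ, lintegral_mixLaw q l' σ']
  · refine lintegral_congr fun θ => ?_
    rw [key]
    have h2 : ∀ x g : Vec d, a • (l' • θ + σ' • x) + b • g = l • θ + (a * σ') • x + b • g := by
      intro x g
      rw [smul_add, smul_smul, smul_smul, hl]
    simp_rw [h2]
    rw [key, hσ]
  · exact Measurable.lintegral_prod_right (f := fun y g : Vec d => f (a • y + b • g))
      (by simp only [Function.uncurry_def]; fun_prop)
  · exact Measurable.lintegral_prod_right (f := fun y g : Vec d => f (y + z • g))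
      (by simp only [Function.uncurry_def]; fun_prop)

lemma drift_coefficient_bounds {E c : ℝ} (hE : 0 < E) (hE1 : E ≤ 1 / 100)
    (hc : c * (1 + E) = E * (2 + E)) :
    19 / 10 * E ≤ c ∧ c ≤ 2 * E ∧ 4 * E ^ 2 - c ^ 2 ≤ 4 * E ^ 3 ∧
      2 * E ^ 2 / c ^ 2 ≤ 1 / 2 + E := by
  have hcc : c = E * (2 + E) / (1 + E) := by rw [eq_div_iff (by positivity)]; exact hc
  refine ⟨?_, ?_, ?_, ?_⟩
  · rw [hcc, le_div_iff₀ (by positivity)]; nlinarith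
  · rw [hcc, div_le_iff₀ (by positivity)]; nlinarith
  · have : 4 * E ^ 2 - c ^ 2 = E ^ 3 * (4 + 3 * E) / (1 + E) ^ 2 := by
      rw [hcc]; field_simp; ring
    rw [this, div_le_iff₀ (by positivity), mul_comm 4 (E ^ 3), mul_assoc]
    gcongr
    nlinarith
  · have : 2 * E ^ 2 / c ^ 2 = 2 * (1 + E) ^ 2 / (2 + E) ^ 2 := by
      rw [hcc]; field_simp
    rw [this, div_le_iff₀ (by positivity)]
    nlinarith [pow_pos hE 3]

lemma noise_scale_bounds {E c f z₁ z₂ : ℝ} (hE : 0 < E) (hE1 : E ≤ 1 / 100) (hc : 19 / 10 * E ≤ c)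
    (hf₁ : E ^ 3 / 3 - E ^ 4 / 2 ≤ f) (hf₂ : f ≤ E ^ 3 / 3)
    (hz₁ : z₁ ^ 2 * c ^ 2 = 8 * f) (hz₂ : z₂ ^ 2 * (2 * f) = E ^ 4) :
    z₁ ^ 2 ≤ E ∧ 3 / 2 * E ≤ z₂ ^ 2 ∧ z₂ ^ 2 ≤ 8 / 5 * E := by
  have hE3 := pow_pos hE 3
  refine ⟨?_, ?_, ?_⟩
  · have h1 : z₁ ^ 2 * (19 / 10 * E) ^ 2 ≤ 8 / 3 * E ^ 3 := by
      calc _ ≤ z₁ ^ 2 * c ^ 2 := by gcongr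
        _ ≤ _ := by rw [hz₁]; linarith
    have h2 : E ^ 2 * (361 / 100 * z₁ ^ 2) ≤ E ^ 2 * (8 / 3 * E) := by
      calc _ = z₁ ^ 2 * (19 / 10 * E) ^ 2 := by ring
        _ ≤ _ := h1
        _ = _ := by ring
    have := le_of_mul_le_mul_left h2 (by positivity)
    linarith
  · have h1 : z₂ ^ 2 * (2 * f) ≤ z₂ ^ 2 * (2 * (E ^ 3 / 3)) := by gcongr
    have h2 : E ^ 3 * E ≤ E ^ 3 * (2 / 3 * z₂ ^ 2) := by
      calc _ = z₂ ^ 2 * (2 * f) := by rw [hz₂]; ring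
        _ ≤ _ := h1
        _ = _ := by ring
    have := le_of_mul_le_mul_left h2 (by positivity)
    linarith
  · have h0 : E ^ 3 * (49 / 150) ≤ f := by
      have : E ^ 3 * E ≤ E ^ 3 * (1 / 100) := by gcongr
      have e : E ^ 4 = E ^ 3 * E := by ring
      linarith
    have h1 : z₂ ^ 2 * (2 * (E ^ 3 * (49 / 150))) ≤ z₂ ^ 2 * (2 * f) := by gcongr
    have h2 : E ^ 3 * (49 / 75 * z₂ ^ 2) ≤ E ^ 3 * E := by
      calc _ = z₂ ^ 2 * (2 * (E ^ 3 * (49 / 150))) := by ring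
        _ ≤ _ := h1
        _ = _ := by rw [hz₂]; ring
    have := le_of_mul_le_mul_left h2 (by positivity)
    linarith

lemma abs_half_sub_le {X r y η : ℝ} (hX : 0 ≤ X) (hX2 : X ^ 2 = r ^ 2 - y) (hr : 1 / 2 ≤ r)
    (hr' : r ≤ 1 / 2 + η) (hη : η ≤ 1 / 100) (hy0 : 0 ≤ y) (hy : y ≤ η) : |1 / 2 - X| ≤ 4 * η := by
  have hlow : -η ≤ X ^ 2 - 1 / 4 := by rw [hX2]; nlinarith
  have hup : X ^ 2 - 1 / 4 ≤ 2 * η := by rw [hX2]; nlinarith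
  rw [abs_le]
  constructor <;> nlinarith

lemma abs_sub_sqrt_mul_le {a w : ℝ} (ha : 0 ≤ a) (hw : 0 ≤ w) : |a - √w| * √w ≤ |a ^ 2 - w| := by
  have e : a ^ 2 - w = (a - √w) * (a + √w) := by
    nth_rw 1 [← Real.sq_sqrt hw]; ring
  rw [e, abs_mul, abs_of_nonneg (add_nonneg ha (Real.sqrt_nonneg w))]
  gcongr
  linarith

/-- Variance mismatch of the two noise terms. -/
lemma abs_div_add_div_le {E S η x f : ℝ} (hE : 0 < E) (hS : 0 < S) (hS1 : S ≤ 1)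
    (hES : E ≤ η * S) (hx : x ≤ 0) (hx' : -x ≤ 4 * E ^ 3) (hf : 0 ≤ f) (hf' : f ≤ E ^ 3 / 3) :
    |x / S + 8 * f / S ^ 2| ≤ 7 * (E * η ^ 2) := by
  have hE2 : E ^ 3 / S ^ 2 ≤ E * η ^ 2 := by
    rw [div_le_iff₀ (by positivity)]
    calc E ^ 3 = E * E ^ 2 := by ring
      _ ≤ E * (η * S) ^ 2 := by gcongr
      _ = _ := by ring
  have hE3 : E ^ 3 / S ≤ E * η ^ 2 := by
    refine le_trans ?_ hE2
    apply div_le_div_of_nonneg_left (by positivity) (by positivity)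
    nlinarith
  have h1 : x / S ≤ 0 := div_nonpos_of_nonpos_of_nonneg hx hS.le
  have h2 : -(4 * (E ^ 3 / S)) ≤ x / S := by
    rw [le_div_iff₀ hS]
    have : -(4 * (E ^ 3 / S)) * S = - (4 * E ^ 3) := by field_simp
    linarith
  have h3 : 0 ≤ 8 * f / S ^ 2 := by positivity
  have h4 : 8 * f / S ^ 2 ≤ 8 / 3 * (E ^ 3 / S ^ 2) := by
    rw [div_le_iff₀ (by positivity)]
    have : 8 / 3 * (E ^ 3 / S ^ 2) * S ^ 2 = 8 / 3 * E ^ 3 := by field_simp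
    linarith
  have h5 : 0 ≤ E * η ^ 2 := by positivity
  rw [abs_le]
  constructor <;> linarith

/-- The numerical coefficients of the coupling used to compare one sampler step of size
`log (1 + E)` with the exact reverse step from noise level `√S`. -/
lemma exists_step_coefficients {E S l η c f z₁ z₂ z₃ : ℝ} (hE : 0 < E) (hS : 0 < S) (hS1 : S ≤ 1)
    (hl : 0 ≤ l) (hη0 : 0 ≤ η) (hη : η ≤ 1 / 100) (hES : E ≤ η * S)
    (hc : c * (1 + E) = E * (2 + E)) (hf₁ : E ^ 3 / 3 - E ^ 4 / 2 ≤ f) (hf₂ : f ≤ E ^ 3 / 3)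
    (hf0 : 0 ≤ f) (hz₁0 : 0 ≤ z₁) (hz₂0 : 0 ≤ z₂) (hz₃0 : 0 ≤ z₃) (hz₁ : z₁ ^ 2 * c ^ 2 = 8 * f)
    (hz₂ : z₂ ^ 2 * (2 * f) = E ^ 4) (hz₁₂ : z₁ * z₂ * c = 2 * E ^ 2)
    (hz₃ : z₃ ^ 2 = 2 * E + E ^ 2 - z₂ ^ 2) :
    ∃ v α β β₀ b ξ : ℝ, v = 2 * E + E ^ 2 - c ^ 2 / S ∧ 0 < v ∧ α ^ 2 + β ^ 2 = 1 ∧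
      β * √v = z₃ ∧ β₀ * √v = l * c / S ∧
      b * z₃ = l * c / S ∧ ξ * z₃ = z₂ - c * z₁ / S - α * √v ∧ 0 ≤ β₀ ∧
      β₀ ^ 2 ≤ 16 * (E * (l / S) ^ 2) ∧ b ^ 2 ≤ 16 * (E * (l / S) ^ 2) ∧
      (l / S * z₁) ^ 2 ≤ 16 * (E * (l / S) ^ 2) ∧
      |β₀ ^ 2 / 2 - b * (l / S * z₁) * (α * β)| ≤ 16 * (E * (l / S) ^ 2) * η ∧
      |ξ| ≤ 14 * η ^ 2 ∧ z₁ ^ 2 ≤ E := by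
  have hEη : E ≤ η := hES.trans (mul_le_of_le_one_right hη0 hS1)
  have hE1 : E ≤ 1 / 100 := hEη.trans hη
  obtain ⟨hc1, hc2, hc3, hc4⟩ := drift_coefficient_bounds hE hE1 hc
  have hc0 : 0 < c := lt_of_lt_of_le (by positivity) hc1
  obtain ⟨hz₁E, hz₂l, hz₂u⟩ := noise_scale_bounds hE hE1 hc1 hf₁ hf₂ hz₁ hz₂
  have hz₃l : E / 4 ≤ z₃ ^ 2 := by linarith [sq_nonneg E]
  have hz₃p : 0 < z₃ := by
    rcases hz₃0.eq_or_lt with h | h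
    · rw [← h] at hz₃l; linarith
    · exact h
  have hcS : c ^ 2 / S ≤ E * (4 * η) := by
    rw [div_le_iff₀ hS]
    calc c ^ 2 ≤ (2 * E) ^ 2 := by gcongr
      _ = 4 * E * E := by ring
      _ ≤ 4 * E * (η * S) := by gcongr
      _ = _ := by ring
  have hcS' : c ^ 2 / S ≤ E * (4 * (1 / 100)) := hcS.trans (by gcongr)
  obtain ⟨v, hv⟩ : ∃ v, v = 2 * E + E ^ 2 - c ^ 2 / S := ⟨_, rfl⟩
  obtain ⟨w, hw⟩ : ∃ w, w = z₂ ^ 2 - c ^ 2 / S := ⟨_, rfl⟩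
  have hvE : E ≤ v := by linarith [sq_nonneg E]
  have hv0 : 0 < v := hE.trans_le hvE
  have hwE : E ≤ w := by linarith
  have hw0 : 0 < w := hE.trans_le hwE
  have hvw : w + z₃ ^ 2 = v := by rw [hv, hw, hz₃]; ring
  have hsv : √v ^ 2 = v := Real.sq_sqrt hv0.le
  have hsw : √w ^ 2 = w := Real.sq_sqrt hw0.le
  have hsv0 : 0 < √v := Real.sqrt_pos.2 hv0
  have hsw0 : 0 < √w := Real.sqrt_pos.2 hw0
  obtain ⟨τ, hτe⟩ : ∃ τ, τ = E * (l / S) ^ 2 := ⟨_, rfl⟩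
  rw [← hτe]
  have hτ : 0 ≤ τ := by rw [hτe]; positivity
  have hB : (l * c / S) ^ 2 ≤ 4 * τ * E := by
    calc (l * c / S) ^ 2 = c ^ 2 * (l / S) ^ 2 := by ring
      _ ≤ (2 * E) ^ 2 * (l / S) ^ 2 := by gcongr
      _ = _ := by rw [hτe]; ring
  have hBv : (l * c / S) ^ 2 / v ≤ 4 * τ := by
    rw [div_le_iff₀ hv0]
    exact hB.trans (by gcongr)
  refine ⟨v, √w / √v, z₃ / √v, l * c / S / √v, l * c / S / z₃, (z₂ - c * z₁ / S - √w) / z₃, hv, hv0,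
    ?_, ?_, ?_, ?_, ?_, by positivity, ?_, ?_, ?_, ?_, ?_, hz₁E⟩
  · rw [div_pow, div_pow, hsv, hsw, ← add_div, hvw, div_self hv0.ne']
  · rw [div_mul_cancel₀ _ hsv0.ne']
  · rw [div_mul_cancel₀ _ hsv0.ne']
  · rw [div_mul_cancel₀ _ hz₃p.ne']
  · rw [div_mul_cancel₀ _ hz₃p.ne', div_mul_cancel₀ _ hsv0.ne']
  · rw [div_pow, hsv]
    linarith
  · rw [div_pow, div_le_iff₀ (by positivity)]
    calc _ ≤ 4 * τ * E := hB
      _ = 16 * τ * (E / 4) := by ring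
      _ ≤ _ := by gcongr
  · calc (l / S * z₁) ^ 2 = z₁ ^ 2 * (l / S) ^ 2 := by ring
      _ ≤ E * (l / S) ^ 2 := by gcongr
      _ ≤ _ := by rw [← hτe]; linarith
  · obtain ⟨X, hX⟩ : ∃ X, X = z₁ * √w / c := ⟨_, rfl⟩
    have hX0 : 0 ≤ X := by rw [hX]; positivity
    have hrep : (l * c / S / √v) ^ 2 / 2 - l * c / S / z₃ * (l / S * z₁) * (√w / √v * (z₃ / √v)) =
        (l * c / S) ^ 2 / v * (1 / 2 - X) := by
      rw [div_pow, hsv, hX]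
      have : √w / √v * (z₃ / √v) = √w * z₃ / v := by rw [div_mul_div_comm, ← sq, hsv]
      rw [this]
      field_simp
    have hX2 : X ^ 2 = (2 * E ^ 2 / c ^ 2) ^ 2 - z₁ ^ 2 / S := by
      rw [hX, div_pow, mul_pow, hsw, hw]
      have : z₁ ^ 2 * z₂ ^ 2 * c ^ 2 = (2 * E ^ 2) ^ 2 := by rw [← hz₁₂]; ring
      field_simp
      linear_combination S * this
    have hr1 : 1 / 2 ≤ 2 * E ^ 2 / c ^ 2 := by
      rw [le_div_iff₀ (by positivity)]
      have : c ^ 2 ≤ (2 * E) ^ 2 := by gcongr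
      linarith
    have hz₁S : z₁ ^ 2 / S ≤ η := by
      rw [div_le_iff₀ hS]; linarith
    have hXd := abs_half_sub_le hX0 hX2 hr1 (hc4.trans (by linarith)) hη (by positivity) hz₁S
    rw [hrep, abs_mul, abs_of_nonneg (by positivity)]
    calc _ ≤ 4 * τ * (4 * η) := by gcongr
      _ = _ := by ring
  · rw [abs_div, abs_of_pos hz₃p, div_le_iff₀ hz₃p]
    obtain ⟨a, ha⟩ : ∃ a, a = z₂ - c * z₁ / S := ⟨_, rfl⟩
    rw [← ha]
    have ha0 : 0 ≤ a := by
      have h1 : (c * z₁ / S) ^ 2 ≤ z₂ ^ 2 := by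
        calc (c * z₁ / S) ^ 2 = (c / S) ^ 2 * z₁ ^ 2 := by ring
          _ ≤ 1 ^ 2 * E := by
            gcongr
            rw [div_le_one hS]
            have : η * S ≤ 1 / 100 * S := by gcongr
            linarith
          _ ≤ _ := by linarith
      have := abs_le_of_sq_le_sq h1 hz₂0
      linarith [le_abs_self (c * z₁ / S)]
    have hdiff : a ^ 2 - w = (c ^ 2 - 4 * E ^ 2) / S + 8 * f / S ^ 2 := by
      rw [ha, hw, ← hz₁]
      field_simp
      linear_combination (-2 * S) * hz₁₂
    have hA : |a ^ 2 - w| ≤ 7 * (E * η ^ 2) := by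
      rw [hdiff]
      have : c ^ 2 ≤ (2 * E) ^ 2 := by gcongr
      exact abs_div_add_div_le hE hS hS1 hES (by linarith) (by linarith) hf0 hf₂
    have hprod : |a - √w| * √w ≤ 7 * (E * η ^ 2) := (abs_sub_sqrt_mul_le ha0 hw0.le).trans hA
    have hz₃s : √E ≤ 2 * z₃ := by
      rw [Real.sqrt_le_left (by positivity), mul_pow]; linarith
    have hws : √E ≤ √w := Real.sqrt_le_sqrt hwE
    have hsE : √E ^ 2 = E := Real.sq_sqrt hE.le
    have hsE0 : 0 < √E := Real.sqrt_pos.2 hE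
    have hfin : √E * |a - √w| ≤ √E * (14 * η ^ 2 * z₃) := by
      calc √E * |a - √w| ≤ |a - √w| * √w := by rw [mul_comm]; gcongr
        _ ≤ 7 * (E * η ^ 2) := hprod
        _ = √E * (7 * η ^ 2 * √E) := by nth_rw 1 [← hsE]; ring
        _ ≤ √E * (7 * η ^ 2 * (2 * z₃)) := by gcongr
        _ = _ := by ring
    exact le_of_mul_le_mul_left hfin hsE0

lemma log_one_add_bounds {E : ℝ} (hE : 0 < E) (hE1 : E ≤ 1 / 100) :
    E ^ 3 / 3 - E ^ 4 / 2 ≤ E ^ 2 / 2 - E + Real.log (1 + E) ∧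
      E ^ 2 / 2 - E + Real.log (1 + E) ≤ E ^ 3 / 3 := by
  have h := Real.abs_log_sub_add_sum_range_le (x := -E) (by rw [abs_neg, abs_of_pos hE]; linarith) 4
  rw [abs_neg, abs_of_pos hE, sub_neg_eq_add] at h
  have h2 : E ^ (4 + 1) / (1 - E) ≤ E ^ 4 / 8 := by
    rw [div_le_iff₀ (by linarith)]
    nlinarith [pow_pos hE 4]
  have h3 := abs_le.1 (h.trans h2)
  simp only [Finset.sum_range_succ, Finset.sum_range_zero] at h3
  norm_num at h3
  constructor <;> nlinarith [h3.1, h3.2, pow_pos hE 4]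

/-- Algebraic relations between the sampler coefficients. -/
lemma zeta_relations {Δ E : ℝ} (hΔ : Real.exp Δ = 1 + E) (hE : 0 < E) (hE1 : E ≤ 1 / 100) :
    (Real.exp Δ - Real.exp (-Δ)) * (1 + E) = E * (2 + E) ∧
    E ^ 3 / 3 - E ^ 4 / 2 ≤ f1 Δ ∧ f1 Δ ≤ E ^ 3 / 3 ∧ 0 < f1 Δ ∧
    0 ≤ zeta1 Δ ∧ 0 ≤ zeta2 Δ ∧ 0 ≤ zeta3 Δ ∧
    zeta1 Δ ^ 2 * (Real.exp Δ - Real.exp (-Δ)) ^ 2 = 8 * f1 Δ ∧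
    zeta2 Δ ^ 2 * (2 * f1 Δ) = E ^ 4 ∧
    zeta1 Δ * zeta2 Δ * (Real.exp Δ - Real.exp (-Δ)) = 2 * E ^ 2 ∧
    zeta3 Δ ^ 2 = 2 * E + E ^ 2 - zeta2 Δ ^ 2 := by
  have hΔl : Δ = Real.log (1 + E) := by rw [← hΔ, Real.log_exp]
  have h2 : Real.exp (2 * Δ) = (1 + E) ^ 2 := by rw [two_mul, Real.exp_add, hΔ]; ring
  have hneg : Real.exp (-Δ) = (1 + E)⁻¹ := by rw [Real.exp_neg, hΔ]
  have hf1 : f1 Δ = E ^ 2 / 2 - E + Real.log (1 + E) := by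
    rw [f1, h2, hΔ, ← hΔl]; ring
  have hf2 : f2 Δ = E + E ^ 2 / 2 := by rw [f2, h2]; ring
  have hf3 : f3 Δ = E ^ 2 / 2 := by rw [f3, h2, hΔ]; ring
  obtain ⟨hl, hu⟩ := log_one_add_bounds hE hE1
  rw [← hf1] at hl hu
  have hf0 : 0 < f1 Δ := by
    have : E ^ 4 ≤ E ^ 3 * (1 / 100) := by
      calc E ^ 4 = E ^ 3 * E := by ring
        _ ≤ _ := by gcongr
    linarith [pow_pos hE 3]
  have hc : (Real.exp Δ - Real.exp (-Δ)) * (1 + E) = E * (2 + E) := by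
    rw [hΔ, hneg]; field_simp; ring
  have hc0 : 0 < Real.exp Δ - Real.exp (-Δ) := by
    by_contra h
    have := mul_nonneg (neg_nonneg.2 (not_lt.1 h)) (by positivity : 0 ≤ 1 + E)
    nlinarith
  have hs2 : √2 ^ 2 = (2 : ℝ) := Real.sq_sqrt (by norm_num)
  have hsf : √(f1 Δ) ^ 2 = f1 Δ := Real.sq_sqrt hf0.le
  have hsf0 : 0 < √(f1 Δ) := Real.sqrt_pos.2 hf0
  have hz2 : zeta2 Δ ^ 2 * (2 * f1 Δ) = E ^ 4 := by
    rw [zeta2, div_pow, mul_pow, hs2, hsf, hf3]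
    field_simp
  refine ⟨hc, hl, hu, hf0, ?_, ?_, ?_, ?_, hz2, ?_, ?_⟩
  · unfold zeta1; positivity
  · unfold zeta2; rw [hf3]; positivity
  · unfold zeta3; positivity
  · rw [zeta1, div_pow, mul_pow, mul_pow, hs2, hsf]
    field_simp
    norm_num
  · rw [zeta1, zeta2, hf3]
    field_simp
    rw [hs2]
  · have hz2' : zeta2 Δ ^ 2 = 2 * f3 Δ ^ 2 / f1 Δ := by
      rw [zeta2, div_pow, mul_pow, hs2, hsf]
    have hb := (noise_scale_bounds hE hE1 (drift_coefficient_bounds hE hE1 hc).1 hl hu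
      (z₁ := zeta1 Δ) (z₂ := zeta2 Δ)
      (by rw [zeta1, div_pow, mul_pow, mul_pow, hs2, hsf]; field_simp; norm_num) hz2).2.2
    rw [zeta3, Real.sq_sqrt, ← hz2', hf2]
    · ring
    · rw [← hz2', hf2]; linarith [sq_nonneg E]

lemma stepError_le {S l s η ξ ε : ℝ} (hd : 1 ≤ d) (hS : 0 < S) (hS1 : S ≤ 1) (hl : 0 < l)
    (hl1 : l ≤ 1)
    (hη : 0 ≤ η) (hη1 : η ≤ 1) (hηd : η * d / S ≤ 1) (hs0 : 0 ≤ s) (hs : s ≤ 16 * (η * l ^ 2 / S))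
    (hξ : |ξ| ≤ 14 * η ^ 2) (hε : 0 ≤ ε) :
    stepError d s η ξ ((S * ε / l) ^ 2) (1024 * ((√S / l) ^ 4 * d ^ 2)) ≤
      2 ^ 18 * (η ^ 3 * d ^ 3 / S ^ 2 + η ^ 4 * d ^ 4 / S ^ 4 + √d * √ε) := by
  have hd1 : (1 : ℝ) ≤ d := by exact_mod_cast hd
  have hsS : s ≤ 16 * (η / S) := by
    refine hs.trans ?_
    gcongr
    exact mul_le_of_le_one_right hη (pow_le_one₀ hl.le hl1)
  have hsqS : √S ^ 4 = S ^ 2 := by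
    rw [show 4 = 2 * 2 by norm_num, pow_mul, Real.sq_sqrt hS.le]
  have t1 : √(s ^ 6 * d ^ 4 * (1024 * ((√S / l) ^ 4 * d ^ 2)))
      ≤ 2 ^ 17 * (η ^ 3 * d ^ 3 / S ^ 2) := by
    rw [Real.sqrt_le_left (by positivity), div_pow, hsqS]
    have h1 : s ^ 6 ≤ (16 * (η * l ^ 2 / S)) ^ 6 := by gcongr
    calc _ ≤ (16 * (η * l ^ 2 / S)) ^ 6 * d ^ 4 * (1024 * (S ^ 2 / l ^ 4 * d ^ 2)) := by gcongr
      _ = (2 ^ 17 * (η ^ 3 * d ^ 3 / S ^ 2)) ^ 2 * l ^ 8 := by field_simp; ring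
      _ ≤ _ := mul_le_of_le_one_right (by positivity) (pow_le_one₀ hl.le hl1)
  have hbase : η ^ 4 * d ^ 2 / S ^ 2 ≤ η ^ 3 * d ^ 3 / S ^ 2 := by
    gcongr ?_ / _
    have : η ^ 4 ≤ η ^ 3 := pow_le_pow_of_le_one hη hη1 (by norm_num)
    have : (d : ℝ) ^ 2 ≤ d ^ 3 := pow_le_pow_right₀ hd1 (by norm_num)
    gcongr
  have t2 : s ^ 2 * η ^ 2 * d ^ 2 ≤ 256 * (η ^ 3 * d ^ 3 / S ^ 2) := by
    calc s ^ 2 * η ^ 2 * d ^ 2 ≤ (16 * (η / S)) ^ 2 * η ^ 2 * d ^ 2 := by gcongr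
      _ = 256 * (η ^ 4 * d ^ 2 / S ^ 2) := by field_simp; ring
      _ ≤ _ := by gcongr
  have t3 : s ^ 4 * d ^ 4 ≤ 2 ^ 16 * (η ^ 4 * d ^ 4 / S ^ 4) := by
    calc s ^ 4 * d ^ 4 ≤ (16 * (η / S)) ^ 4 * d ^ 4 := by gcongr
      _ = _ := by field_simp; ring
  have t4 : ξ ^ 2 * d ≤ 196 * (η ^ 3 * d ^ 3 / S ^ 2) := by
    have h1 : ξ ^ 2 ≤ (14 * η ^ 2) ^ 2 := sq_le_sq' (by linarith [(abs_le.1 hξ).1]) (abs_le.1 hξ).2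
    have h2 : η ^ 4 * d ≤ η ^ 4 * d ^ 2 / S ^ 2 := by
      rw [le_div_iff₀ (by positivity)]
      have : S ^ 2 ≤ 1 := pow_le_one₀ hS.le hS1
      have : (d : ℝ) ≤ d ^ 2 := by nlinarith
      calc η ^ 4 * d * S ^ 2 ≤ η ^ 4 * d ^ 2 * 1 := by gcongr
        _ = _ := mul_one _
    calc ξ ^ 2 * d ≤ (14 * η ^ 2) ^ 2 * d := by gcongr
      _ = 196 * (η ^ 4 * d) := by ring
      _ ≤ _ := by linarith
  have t5 : √√(s ^ 4 * d ^ 3 * (S * ε / l) ^ 2) ≤ 16 * (√d * √ε) := by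
    have h1 : s ^ 4 * d ^ 3 * (S * ε / l) ^ 2 ≤ (16 ^ 2 * (d * ε)) ^ 2 := by
      have h2 : s ^ 4 ≤ (16 * (η * l ^ 2 / S)) ^ 4 := by gcongr
      calc _ ≤ (16 * (η * l ^ 2 / S)) ^ 4 * d ^ 3 * (S * ε / l) ^ 2 := by gcongr
        _ = 16 ^ 4 * ((η * d / S) ^ 2 * η ^ 2 * l ^ 6) * d * ε ^ 2 := by field_simp
        _ ≤ 16 ^ 4 * (1 ^ 2 * 1 ^ 2 * 1 ^ 6) * d ^ 2 * ε ^ 2 := by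
          gcongr
          nlinarith
        _ = _ := by ring
    calc √√(s ^ 4 * d ^ 3 * (S * ε / l) ^ 2) ≤ √√((16 ^ 2 * (d * ε)) ^ 2) := by gcongr
      _ = _ := by
        rw [Real.sqrt_sq (by positivity), Real.sqrt_mul (by positivity), Real.sqrt_sq (by norm_num),
          Real.sqrt_mul (by positivity)]
  have p1 : 0 ≤ η ^ 3 * d ^ 3 / S ^ 2 := by positivity
  have p2 : 0 ≤ η ^ 4 * d ^ 4 / S ^ 4 := by positivity
  have p3 : 0 ≤ √(d : ℝ) * √ε := by positivity
  unfold stepError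
  linarith

lemma forwardLaw_eq_mixLaw (q : Measure (Vec d)) (u : ℝ) :
    forwardLaw q u = mixLaw q (Real.exp (-u)) (√(1 - Real.exp (-2 * u))) := rfl

/-- One-step estimate for the sampler in terms of the rescaled score error. -/
theorem exists_klDiv_rkStep_le : ∃ C : ℝ, 0 < C ∧ ∀ (d : ℕ), 1 ≤ d →
    ∀ (q : Measure (Vec d)) [IsProbabilityMeasure q] (P : Measure (Vec d)) [IsProbabilityMeasure P]
      (shat : Vec d → Vec d) (u u' Δ S η ε : ℝ), (∀ᵐ θ ∂q, ‖θ‖ ≤ √d) → Measurable shat →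
    0 < u' → u' < u → u - u' = Δ → 1 - Real.exp (-2 * u) = S →
    Real.exp Δ - 1 ≤ η * S → 0 ≤ η → η ≤ 1 / 100 → η * d / S ≤ 1 / 2 ^ 14 → 0 ≤ ε →
    (∀ y, ‖scoreError q (Real.exp (-u)) (√S) 0 shat y 0‖ ≤ 2 * √d) →
    ∫⁻ y, ∫⁻ g, ‖scoreError q (Real.exp (-u)) (√S) (zeta1 Δ) shat y g‖ₑ ^ 2
      ∂(_root_.stdGaussian d) ∂(forwardLaw q u) ≤
        ENNReal.ofReal ((S * ε / Real.exp (-u)) ^ 2) →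
    InformationTheory.klDiv (forwardLaw q u')
      ((P.prod ((_root_.stdGaussian d).prod (_root_.stdGaussian d))).map
        (fun p : Vec d × (Vec d × Vec d) => rkStep Δ shat p.1 p.2)) ≤
      InformationTheory.klDiv (forwardLaw q u) P +
        ENNReal.ofReal (C * (η ^ 3 * d ^ 3 / S ^ 2 + η ^ 4 * d ^ 4 / S ^ 4 + √d * √ε)) := by
  obtain ⟨C, hC, H⟩ := exists_klDiv_step_le
  refine ⟨C * 2 ^ 18, by positivity, ?_⟩
  intro d hd q _ P _ shat u u' Δ S η ε hq hs hu' huu hΔ hSu hES hη0 hη hηd hε he heE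
  have hd1 : (1 : ℝ) ≤ d := by exact_mod_cast hd
  have hu : 0 < u := hu'.trans huu
  obtain ⟨E, hEΔ⟩ : ∃ E, E = Real.exp Δ - 1 := ⟨_, rfl⟩
  have hexpΔ : Real.exp Δ = 1 + E := by rw [hEΔ]; ring
  have hE : 0 < E := by
    rw [hEΔ, sub_pos, Real.one_lt_exp_iff]; linarith
  have hS : 0 < S := by
    rw [← hSu, sub_pos, Real.exp_lt_one_iff]; linarith
  have hS1 : S ≤ 1 := by rw [← hSu]; linarith [Real.exp_pos (-2 * u)]
  rw [← hEΔ] at hES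
  have hE1 : E ≤ 1 / 100 := hES.trans (by nlinarith)
  obtain ⟨l, hl⟩ : ∃ l, l = Real.exp (-u) := ⟨_, rfl⟩
  have hl0 : 0 < l := hl ▸ Real.exp_pos _
  have hl1 : l ≤ 1 := by rw [hl, Real.exp_le_one_iff]; linarith
  obtain ⟨hc, hf₁, hf₂, hf0, hz₁0, hz₂0, hz₃0, hz₁, hz₂, hz₁₂, hz₃⟩ := zeta_relations hexpΔ hE hE1
  obtain ⟨v, α, β, β₀, b, ξ, hv, hv0, hαβ, hβ, hβ₀, hb, hξ, hβ₀0, hβ₀s, hbs, hℓs, hab, hξη, -⟩ :=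
    exists_step_coefficients (l := l) hE hS hS1 hl0.le hη0 hη hES hc hf₁ hf₂ hf0.le hz₁0 hz₂0 hz₃0
      hz₁ hz₂ hz₁₂ hz₃
  have hsS : √S ^ 2 = S := Real.sq_sqrt hS.le
  have hs16 : 16 * (E * (l / S) ^ 2) ≤ 16 * (η * l ^ 2 / S) := by
    have : E * (l / S) ^ 2 ≤ η * S * (l / S) ^ 2 := by gcongr
    calc _ ≤ 16 * (η * S * (l / S) ^ 2) := by gcongr
      _ = _ := by field_simp
  have hηSd : 16 * (η * l ^ 2 / S) * d ≤ 1 / 1024 := by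
    calc 16 * (η * l ^ 2 / S) * d = 16 * (η * d / S) * l ^ 2 := by ring
      _ ≤ 16 * (1 / 2 ^ 14) * 1 ^ 2 := by gcongr
      _ = _ := by norm_num
  have hξd : ξ ^ 2 * d ≤ 1 / 256 := by
    have h1 : ξ ^ 2 ≤ (14 * η ^ 2) ^ 2 := sq_le_sq' (by linarith [(abs_le.1 hξη).1])
        (abs_le.1 hξη).2
    have h2 : η * d ≤ 1 / 2 ^ 14 := by
      refine le_trans ?_ hηd
      rw [le_div_iff₀ hS]
      exact mul_le_of_le_one_right (by positivity) hS1
    calc ξ ^ 2 * d ≤ (14 * η ^ 2) ^ 2 * d := by gcongr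
      _ = 196 * η ^ 3 * (η * d) := by ring
      _ ≤ 196 * (1 / 100) ^ 3 * (1 / 2 ^ 14) := by gcongr
      _ ≤ _ := by norm_num
  have hσ' : (Real.exp Δ - (Real.exp Δ - Real.exp (-Δ)) / √S ^ 2) ^ 2 * √S ^ 2 + v =
      √(1 - Real.exp (-2 * u')) ^ 2 := by
    rw [hsS, Real.sq_sqrt (by rw [sub_nonneg, Real.exp_le_one_iff]; linarith), hv]
    have h1 : Real.exp (-2 * u') = (1 + E) ^ 2 * (1 - S) := by
      rw [← hexpΔ, ← hSu, sub_sub_cancel, ← Real.exp_nat_mul, ← Real.exp_add, ← hΔ]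
      congr 1
      push_cast
      ring
    rw [h1, hexpΔ]
    rw [hexpΔ] at hc
    obtain ⟨c, hcc⟩ : ∃ c, c = 1 + E - Real.exp (-Δ) := ⟨_, rfl⟩
    rw [← hcc] at hc ⊢
    field_simp
    linear_combination (-2 * S) * hc
  have key := H d hd q P shat l (√S) (Real.exp (-u')) (√(1 - Real.exp (-2 * u'))) (Real.exp Δ)
    (Real.exp Δ - Real.exp (-Δ)) (zeta1 Δ) (zeta2 Δ) (zeta3 Δ) v α β β₀ b ξ
        (16 * (E * (l / S) ^ 2)) η
    ((S * ε / l) ^ 2) hq hs hl0 (Real.sqrt_pos.2 hS) hv0 hαβ hβ (by rw [hsS]; exact hβ₀)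
    (by rw [hsS]; exact hb) (by rw [hsS]; exact hξ)
    (by rw [hl, ← Real.exp_add, ← hΔ]; congr 1; ring) (Real.sqrt_nonneg _) hσ' hβ₀0 hβ₀s hbs
    (by rw [hsS]; exact hℓs) (by rw [hsS]; exact hab)
    (le_trans (by gcongr) hηSd) hξd hη0 (by positivity) (by rw [hl]; exact he)
    (by rw [hl]; rw [forwardLaw_eq_mixLaw, hSu] at heE; exact heE)
  rw [forwardLaw_eq_mixLaw q u, hSu, ← hl]
  refine key.trans ?_
  rw [mul_assoc]
  gcongr
  exact stepError_le hd hS hS1 hl0 hl1 hη0 (by linarith) (hηd.trans (by norm_num)) (by positivity)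
    hs16 hξη hε

/-- The averaged score error seen by one sampler step, from the assumed bound on all nearby
Gaussian perturbations. -/
lemma lintegral_sq_norm_perturbed_le {q : Measure (Vec d)} [IsProbabilityMeasure q]
    {F : Vec d → Vec d}
    (hF : Measurable F) {M : ℝ} (hM : ∀ y, ‖F y‖ ≤ M) {u u' Δ z ε : ℝ} (hu' : 0 < u')
    (huu : u' < u) (hΔ : u - u' = Δ) (hΔ1 : Δ ≤ 1) (hz : z ^ 2 ≤ Real.exp Δ - 1)
    (hε : ∀ a ∈ Set.Icc (1 - 3.1 * √Δ) (1 + 3.1 * √Δ), ∀ b ∈ Set.Icc (0 : ℝ) (3.5 * √Δ),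
      ∫ p : Vec d × Vec d, ‖F (a • p.1 + b • p.2)‖ ^ 2
        ∂((forwardLaw q u').prod (_root_.stdGaussian d)) ≤ ε ^ 2) :
    ∫⁻ y, ∫⁻ g, ‖F (y + z • g)‖ₑ ^ 2 ∂(_root_.stdGaussian d) ∂(forwardLaw q u) ≤
      ENNReal.ofReal (ε ^ 2) := by
  have hΔ0 : 0 < Δ := by linarith
  have hsq : √Δ ^ 2 = Δ := Real.sq_sqrt hΔ0.le
  have hsq0 : 0 < √Δ := Real.sqrt_pos.2 hΔ0
  have hsq1 : Δ ≤ √Δ := by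
    have : √Δ ≤ 1 := by rw [Real.sqrt_le_left (by norm_num)]; linarith
    nlinarith
  have hexp : Real.exp Δ - 1 ≤ 2 * Δ := by
    have := Real.abs_exp_sub_one_le (x := Δ) (by rw [abs_of_pos hΔ0]; exact hΔ1)
    rw [abs_of_pos hΔ0] at this
    exact (le_abs_self _).trans this
  have hneg : 1 - Real.exp (-2 * Δ) ≤ 2 * Δ := by linarith [Real.add_one_le_exp (-2 * Δ)]
  have hneg0 : 0 ≤ 1 - Real.exp (-2 * Δ) := by
    rw [sub_nonneg, Real.exp_le_one_iff]; linarith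
  obtain ⟨b, hb⟩ : ∃ b, b = √(1 - Real.exp (-2 * Δ) + z ^ 2) := ⟨_, rfl⟩
  have hb2 : b ^ 2 = 1 - Real.exp (-2 * Δ) + z ^ 2 := by rw [hb, Real.sq_sqrt (by positivity)]
  have hbmem : b ∈ Set.Icc (0 : ℝ) (3.5 * √Δ) := by
    refine ⟨hb ▸ Real.sqrt_nonneg _, ?_⟩
    rw [hb, Real.sqrt_le_left (by positivity), mul_pow, hsq, show (3.5 : ℝ) ^ 2 = 12.25 by norm_num]
    linarith
  have hamem : Real.exp (-Δ) ∈ Set.Icc (1 - 3.1 * √Δ) (1 + 3.1 * √Δ) := by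
    constructor
    · linarith [Real.add_one_le_exp (-Δ)]
    · have : Real.exp (-Δ) ≤ 1 := by rw [Real.exp_le_one_iff]; linarith
      linarith
  have hsemi : √(1 - Real.exp (-2 * u)) ^ 2 + z ^ 2 =
      (Real.exp (-Δ) * √(1 - Real.exp (-2 * u'))) ^ 2 + b ^ 2 := by
    have e : Real.exp (-Δ) ^ 2 = Real.exp (-2 * Δ) := by
      rw [← Real.exp_nat_mul]; congr 1; push_cast; ring
    have e2 : Real.exp (-2 * u) = Real.exp (-2 * Δ) * Real.exp (-2 * u') := by
      rw [← Real.exp_add, ← hΔ]; congr 1; ring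
    rw [mul_pow, Real.sq_sqrt (by rw [sub_nonneg, Real.exp_le_one_iff]; linarith),
      Real.sq_sqrt (by rw [sub_nonneg, Real.exp_le_one_iff]; linarith), hb2, e, e2]
    ring
  have hFe : Measurable fun y => ‖F y‖ₑ ^ 2 := by fun_prop
  rw [forwardLaw_eq_mixLaw, lintegral_mixLaw_add q (l' := Real.exp (-u'))
    (σ' := √(1 - Real.exp (-2 * u'))) (a := Real.exp (-Δ)) (b := b)
    (by rw [← Real.exp_add, ← hΔ]; congr 1; ring) hsemi hFe, ← forwardLaw_eq_mixLaw]
  have : IsProbabilityMeasure (forwardLaw q u') := by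
    rw [forwardLaw_eq_mixLaw]; infer_instance
  have hFm : Measurable fun p : Vec d × Vec d => F (Real.exp (-Δ) • p.1 + b • p.2) :=
    hF.comp (by fun_prop)
  rw [← lintegral_prod (f := fun p : Vec d × Vec d => ‖F (Real.exp (-Δ) • p.1 + b • p.2)‖ₑ ^ 2)
    (by fun_prop)]
  have h_int : Integrable (fun p : Vec d × Vec d => ‖F (Real.exp (-Δ) • p.1 + b • p.2)‖ ^ 2)
      ((forwardLaw q u').prod (_root_.stdGaussian d)) := by
    refine Integrable.of_bound (hFm.norm.pow_const 2).aestronglyMeasurable (M ^ 2)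
        (ae_of_all _ fun p => ?_)
    rw [Real.norm_of_nonneg (by positivity)]
    gcongr
    exact hM _
  calc _ = ∫⁻ p : Vec d × Vec d, ENNReal.ofReal (‖F (Real.exp (-Δ) • p.1 + b • p.2)‖ ^ 2)
        ∂((forwardLaw q u').prod (_root_.stdGaussian d)) := by
        refine lintegral_congr fun p => ?_
        rw [ENNReal.ofReal_pow (norm_nonneg _), ofReal_norm]
    _ = ENNReal.ofReal (∫ p : Vec d × Vec d, ‖F (Real.exp (-Δ) • p.1 + b • p.2)‖ ^ 2
        ∂((forwardLaw q u').prod (_root_.stdGaussian d))) :=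
        (ofReal_integral_eq_lintegral_ofReal h_int (ae_of_all _ fun p => by positivity)).symm
    _ ≤ _ := ENNReal.ofReal_le_ofReal (hε _ hamem _ hbmem)

/-- One-step estimate for the sampler under the score-estimation assumption. -/
theorem exists_klDiv_rkStep_le_of_score : ∃ C : ℝ, 0 < C ∧ ∀ (d : ℕ), 1 ≤ d →
    ∀ (q : Measure (Vec d)) [IsProbabilityMeasure q] (P : Measure (Vec d)) [IsProbabilityMeasure P]
      (ρ : Vec d → ℝ) (shat : Vec d → Vec d) (u u' Δ S η ε : ℝ), (∀ᵐ θ ∂q, ‖θ‖ ≤ √d) →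
    forwardLaw q u = (volume.withDensity fun x => ENNReal.ofReal (ρ x)) → (∀ x, 0 < ρ x) →
    Continuous ρ → Measurable shat →
    0 < u' → u' < u → u - u' = Δ → 1 - Real.exp (-2 * u) = S →
    Real.exp Δ - 1 ≤ η * S → 0 ≤ η → η ≤ 1 / 100 → η * d / S ≤ 1 / 2 ^ 14 → 0 ≤ ε →
    (∀ a ∈ Set.Icc (1 - 3.1 * √Δ) (1 + 3.1 * √Δ), ∀ b ∈ Set.Icc (0 : ℝ) (3.5 * √Δ),
      ∫ p : Vec d × Vec d, ‖shat (a • p.1 + b • p.2) -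
        gradient (fun y => Real.log (ρ y)) (a • p.1 + b • p.2)‖ ^ 2
        ∂((forwardLaw q u').prod (_root_.stdGaussian d)) ≤ ε ^ 2) →
    (∀ y, S / Real.exp (-u) * ‖shat y - gradient (fun y => Real.log (ρ y)) y‖ ≤ 2 * √d) →
    InformationTheory.klDiv (forwardLaw q u')
      ((P.prod ((_root_.stdGaussian d).prod (_root_.stdGaussian d))).map
        (fun p : Vec d × (Vec d × Vec d) => rkStep Δ shat p.1 p.2)) ≤
      InformationTheory.klDiv (forwardLaw q u) P +
        ENNReal.ofReal (C * (η ^ 3 * d ^ 3 / S ^ 2 + η ^ 4 * d ^ 4 / S ^ 4 + √d * √ε)) := by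
  obtain ⟨C, hC, H⟩ := exists_klDiv_rkStep_le
  refine ⟨C, hC, ?_⟩
  intro d hd q _ P _ ρ shat u u' Δ S η ε hq hρ hρ0 hρc hs hu' huu hΔ hSu hES hη0 hη hηd hε0 hε hb
  have hS : 0 < S := by
    rw [← hSu, sub_pos, Real.exp_lt_one_iff]; linarith
  have hS1 : S ≤ 1 := by rw [← hSu]; linarith [Real.exp_pos (-2 * u)]
  have hsS : √S ^ 2 = S := Real.sq_sqrt hS.le
  have hE1 : Real.exp Δ - 1 ≤ 1 / 100 := hES.trans (by nlinarith)
  have hΔ1 : Δ ≤ 1 := by linarith [Real.add_one_le_exp Δ]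
  have hΔ0 : 0 < Δ := by linarith
  have hE0 : 0 < Real.exp Δ - 1 := by rw [sub_pos, Real.one_lt_exp_iff]; exact hΔ0
  obtain ⟨F, hF⟩ : ∃ F : Vec d → Vec d,
      F = fun y => shat y - gradient (fun y => Real.log (ρ y)) y := ⟨_, rfl⟩
  have hFy : ∀ y, shat y - gradient (fun y => Real.log (ρ y)) y = F y := fun y => by rw [hF]
  simp only [hFy] at hε hb
  have hgrad : ∀ y, F y = shat y - (√S ^ 2)⁻¹ • (Real.exp (-u) • postMean q (Real.exp (-u)) (√S) y
      - y) := by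
    intro y
    rw [← hFy, gradient_log_density hq (Real.sqrt_pos.2 hS) (by rw [← hSu]; exact hρ) hρ0 hρc]
  have hscore : ∀ z y g, scoreError q (Real.exp (-u)) (√S) z shat y g =
      (S / Real.exp (-u)) • F (y + z • g) := by
    intro z y g
    rw [scoreError, hgrad, hsS]
  have hFm : Measurable F := by
    have hm := measurable_postMean (q := q) (l := Real.exp (-u)) (σ := √S)
    rw [show F = _ from funext hgrad]
    fun_prop
  have hSl : 0 < S / Real.exp (-u) := div_pos hS (Real.exp_pos _)
  have hFM : ∀ y, ‖F y‖ ≤ 2 * √d / (S / Real.exp (-u)) := fun y => by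
    rw [le_div_iff₀ hSl, mul_comm]; exact hb y
  have hz : zeta1 Δ ^ 2 ≤ Real.exp Δ - 1 := by
    obtain ⟨hc, hf₁, hf₂, -, -, -, -, hz₁, hz₂, -, -⟩ :=
      zeta_relations (Δ := Δ) (E := Real.exp Δ - 1) (by ring) hE0 hE1
    exact (noise_scale_bounds hE0 hE1 (drift_coefficient_bounds hE0 hE1 hc).1 hf₁ hf₂ hz₁ hz₂).1
  have hav := lintegral_sq_norm_perturbed_le hFm hFM hu' huu hΔ hΔ1 hz hε
  refine H d hd q P shat u u' Δ S η ε hq hs hu' huu hΔ hSu hES hη0 hη hηd hε0 ?_ ?_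
  · intro y
    rw [hscore, smul_zero, add_zero, norm_smul, Real.norm_of_nonneg hSl.le]
    exact hb y
  · calc _ = ∫⁻ y, ∫⁻ g, ENNReal.ofReal ((S / Real.exp (-u)) ^ 2) * ‖F (y + zeta1 Δ • g)‖ₑ ^ 2
          ∂(_root_.stdGaussian d) ∂(forwardLaw q u) := by
          refine lintegral_congr fun y => lintegral_congr fun g => ?_
          rw [hscore, enorm_smul, mul_pow, Real.enorm_eq_ofReal hSl.le, ENNReal.ofReal_pow hSl.le]
      _ = ENNReal.ofReal ((S / Real.exp (-u)) ^ 2) * ∫⁻ y, ∫⁻ g, ‖F (y + zeta1 Δ • g)‖ₑ ^ 2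
          ∂(_root_.stdGaussian d) ∂(forwardLaw q u) := by
          simp_rw [lintegral_const_mul' _ _ ENNReal.ofReal_ne_top]
      _ ≤ ENNReal.ofReal ((S / Real.exp (-u)) ^ 2) * ENNReal.ofReal (ε ^ 2) := by gcongr
      _ = _ := by
          rw [← ENNReal.ofReal_mul (by positivity)]
          congr 1
          ring

instance isProbabilityMeasure_forwardLaw (q : Measure (Vec d)) [IsProbabilityMeasure q] (u : ℝ) :
    IsProbabilityMeasure (forwardLaw q u) := by
  rw [forwardLaw_eq_mixLaw]; infer_instance

lemma measurable_rkStep (Δ : ℝ) {shat : Vec d → Vec d} (hs : Measurable shat) :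
    Measurable (fun p : Vec d × (Vec d × Vec d) => rkStep Δ shat p.1 p.2) := by
  unfold rkStep
  have : Measurable fun p : Vec d × (Vec d × Vec d) => shat (p.1 + zeta1 Δ • p.2.1) :=
    hs.comp (by fun_prop)
  fun_prop

lemma isProbabilityMeasure_samplerLaw (init : Measure (Vec d)) [IsProbabilityMeasure init]
    {step : ℕ → Vec d → Vec d × Vec d → Vec d}
    (hstep : ∀ k, Measurable (fun p : Vec d × (Vec d × Vec d) => step k p.1 p.2)) (k : ℕ) :
    IsProbabilityMeasure (samplerLaw init step k) := by
  induction k with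
  | zero => rw [samplerLaw]; infer_instance
  | succ k ih => rw [samplerLaw]; exact Measure.isProbabilityMeasure_map (hstep k).aemeasurable

lemma klDiv'_le_of_klDiv_le {α : Type*} [MeasurableSpace α] {μ ν : Measure α}
    [IsProbabilityMeasure μ] [IsProbabilityMeasure ν] {r : ℝ} (hr : 0 ≤ r)
    (h : InformationTheory.klDiv μ ν ≤ ENNReal.ofReal r) : klDiv' μ ν ≤ r := by
  have hne : InformationTheory.klDiv μ ν ≠ ∞ := (h.trans_lt ENNReal.ofReal_lt_top).ne
  have hac := (InformationTheory.klDiv_ne_top_iff.1 hne).1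
  have e := InformationTheory.toReal_klDiv_of_measure_eq hac (by simp)
  have : klDiv' μ ν = (InformationTheory.klDiv μ ν).toReal := by rw [e]; rfl
  rw [this]
  exact ENNReal.toReal_le_of_le_ofReal hr h

/-- Remaining time after `k` steps of the geometric schedule that ends at `δ` after `K` steps. -/
def remTime (δ η : ℝ) (K k : ℕ) : ℝ := Real.log (1 + (Real.exp δ - 1) * (1 + η) ^ (K - k))

section Schedule

variable {δ η : ℝ} {K : ℕ}

lemma exp_sub_one_pos (hδ : 0 < δ) : 0 < Real.exp δ - 1 := by
  rw [sub_pos, Real.one_lt_exp_iff]; exact hδ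

lemma remTime_last : remTime δ η K K = δ := by
  rw [remTime, Nat.sub_self, pow_zero, mul_one, add_sub_cancel, Real.log_exp]

lemma exp_remTime (hδ : 0 < δ) (hη : 0 ≤ η) (k : ℕ) :
    Real.exp (remTime δ η K k) = 1 + (Real.exp δ - 1) * (1 + η) ^ (K - k) := by
  have := exp_sub_one_pos hδ
  rw [remTime, Real.exp_log (by positivity)]

lemma le_remTime (hδ : 0 < δ) (hη : 0 ≤ η) (k : ℕ) : δ ≤ remTime δ η K k := by
  rw [← Real.exp_le_exp, exp_remTime hδ hη]
  have h1 : 1 ≤ (1 + η) ^ (K - k) := one_le_pow₀ (by linarith)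
  nlinarith [exp_sub_one_pos hδ]

lemma remTime_succ_lt (hδ : 0 < δ) (hη : 0 < η) {k : ℕ} (hk : k < K) :
    remTime δ η K (k + 1) < remTime δ η K k := by
  rw [← Real.exp_lt_exp, exp_remTime hδ hη.le, exp_remTime hδ hη.le]
  have := exp_sub_one_pos hδ
  gcongr 1 + _ * ?_
  exact pow_lt_pow_right₀ (by linarith) (by omega)

lemma exp_remTime_sub_le (hδ : 0 < δ) (hη : 0 < η) {k : ℕ} (hk : k < K) :
    Real.exp (remTime δ η K k - remTime δ η K (k + 1)) - 1 ≤
      η * (1 - Real.exp (-2 * remTime δ η K k)) := by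
  obtain ⟨x, hx⟩ : ∃ x, x = (Real.exp δ - 1) * (1 + η) ^ (K - (k + 1)) := ⟨_, rfl⟩
  have hx0 : 0 < x := by
    have := exp_sub_one_pos hδ
    rw [hx]; positivity
  have h1 : Real.exp (remTime δ η K (k + 1)) = 1 + x := by rw [exp_remTime hδ hη.le, hx]
  have h2 : Real.exp (remTime δ η K k) = 1 + x * (1 + η) := by
    rw [exp_remTime hδ hη.le, hx, show K - k = K - (k + 1) + 1 by omega, pow_succ, mul_assoc]
  have h3 : Real.exp (-2 * remTime δ η K k) = ((1 + x * (1 + η)) ^ 2)⁻¹ := by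
    rw [← h2, ← Real.exp_nat_mul, ← Real.exp_neg]
    congr 1
    push_cast
    ring
  rw [Real.exp_sub, h1, h2, h3]
  have h4 : (1 + x * (1 + η)) / (1 + x) - 1 = η * (1 - (1 + x)⁻¹) := by
    field_simp
    ring
  rw [h4]
  gcongr
  nlinarith [mul_pos hx0 hη]

lemma le_one_sub_exp {u : ℝ} (hδ : 0 < δ) (hδ1 : δ < 1 / 2) (hu : δ ≤ u) :
    δ ≤ 1 - Real.exp (-2 * u) := by
  have h1 : Real.exp (-2 * u) ≤ Real.exp (-(2 * δ)) := Real.exp_le_exp.2 (by linarith)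
  have h2 : Real.exp (-(2 * δ)) ≤ 1 - δ := by
    rw [Real.exp_neg, inv_le_comm₀ (Real.exp_pos _) (by linarith)]
    refine le_trans ?_ (Real.add_one_le_exp (2 * δ))
    rw [inv_le_iff_one_le_mul₀ (by linarith)]
    nlinarith
  linarith

/-- The initialization error of the sampler. -/
lemma klDiv_forwardLaw_remTime_zero_le {q : Measure (Vec d)} [IsProbabilityMeasure q] {ε : ℝ}
    (hd : 1 ≤ d) (hq : ∀ᵐ θ ∂q, ‖θ‖ ≤ √d) (hδ : 0 < δ) (hη : 0 ≤ η) (hε : 0 < ε) (hε1 : ε ≤ 1)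
    (hK : 4 * d / ε ≤ (Real.exp δ - 1) * (1 + η) ^ K) :
    InformationTheory.klDiv (forwardLaw q (remTime δ η K 0)) (_root_.stdGaussian d) ≤
      ENNReal.ofReal (2 * ε ^ 2) := by
  have hd1 : (1 : ℝ) ≤ d := by exact_mod_cast hd
  obtain ⟨u, hu⟩ : ∃ u, u = remTime δ η K 0 := ⟨_, rfl⟩
  rw [← hu]
  obtain ⟨X, hX⟩ : ∃ X, X = (Real.exp δ - 1) * (1 + η) ^ K := ⟨_, rfl⟩
  rw [← hX] at hK
  have hexp : Real.exp u = 1 + X := by rw [hu, exp_remTime hδ hη, hX, Nat.sub_zero]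
  have hX0 : 0 < X := lt_of_lt_of_le (by positivity) hK
  have hl2 : Real.exp (-u) ^ 2 = ((1 + X) ^ 2)⁻¹ := by rw [Real.exp_neg, hexp, inv_pow]
  have hl2' : Real.exp (-2 * u) = ((1 + X) ^ 2)⁻¹ := by
    rw [← hl2, ← Real.exp_nat_mul]; congr 1; push_cast; ring
  have hσ0 : 0 < 1 - Real.exp (-2 * u) := by
    rw [hl2', sub_pos]
    exact inv_lt_one_of_one_lt₀ (by nlinarith)
  have hr : (Real.exp (-u) / √(1 - Real.exp (-2 * u))) ^ 2 = 1 / ((1 + X) ^ 2 - 1) := by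
    have : (1 + X) ^ 2 - 1 ≠ 0 := by nlinarith
    rw [div_pow, Real.sq_sqrt hσ0.le, hl2, hl2']
    field_simp
  have hrd : 1 / ((1 + X) ^ 2 - 1) * d ≤ ε ^ 2 / 16 := by
    have h1 : (4 * d / ε) ^ 2 ≤ X ^ 2 := by gcongr
    have h2 : d ≤ ε ^ 2 / 16 * (4 * d / ε) ^ 2 := by
      have : ε ^ 2 / 16 * (4 * d / ε) ^ 2 = (d : ℝ) ^ 2 := by field_simp; ring
      rw [this]; nlinarith
    rw [div_mul_eq_mul_div, one_mul, div_le_iff₀ (by nlinarith)]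
    calc (d : ℝ) ≤ ε ^ 2 / 16 * (4 * d / ε) ^ 2 := h2
      _ ≤ ε ^ 2 / 16 * ((1 + X) ^ 2 - 1) := by gcongr; nlinarith
  have hε2 : ε ^ 2 ≤ 1 := pow_le_one₀ hε.le hε1
  rw [forwardLaw_eq_mixLaw]
  refine (klDiv_mixLaw_stdGaussian_le hd hq (Real.sqrt_pos.2 hσ0) ?_ hr ?_).trans ?_
  · rw [Real.sq_sqrt hσ0.le, hl2, hl2']; ring
  · linarith
  · apply ENNReal.ofReal_le_ofReal
    linarith

end Schedule

/-- Number of steps of the geometric schedule. -/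
lemma exists_steps {δ η y L : ℝ} (hδ : 0 < δ) (hη : 0 < η) (hη1 : η ≤ 1) (hL : 1 ≤ L)
    (hy : 0 < y) (hyL : Real.log (y / δ) ≤ 2 * L) :
    ∃ K : ℕ, y ≤ (Real.exp δ - 1) * (1 + η) ^ K ∧ (K : ℝ) ≤ 5 * L / η := by
  refine ⟨⌈4 * L / η⌉₊, ?_, ?_⟩
  · have h1 : 4 * L / η ≤ (⌈4 * L / η⌉₊ : ℝ) := Nat.le_ceil _
    generalize ⌈4 * L / η⌉₊ = K at h1
    rw [div_le_iff₀ hη] at h1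
    have hlog : η / 2 ≤ Real.log (1 + η) := by
      rw [Real.le_log_iff_exp_le (by positivity)]
      have := Real.abs_exp_sub_one_le (x := η / 2) (by rw [abs_of_pos (by positivity)]; linarith)
      rw [abs_of_pos (a := η / 2) (by positivity)] at this
      linarith [(abs_le.1 this).2]
    have h2 : y / δ ≤ (1 + η) ^ K := by
      rw [← Real.exp_log (by positivity : 0 < y / δ), ← Real.exp_log (by positivity : 0 < 1 + η),
        ← Real.exp_nat_mul]
      apply Real.exp_le_exp.2
      have : (K : ℝ) * (η / 2) ≤ K * Real.log (1 + η) := by gcongr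
      linarith
    calc y = δ * (y / δ) := by field_simp
      _ ≤ (Real.exp δ - 1) * (1 + η) ^ K := by
        have := Real.add_one_le_exp δ
        exact mul_le_mul (by linarith) h2 (by positivity) (by linarith)
  · have h1 := (Nat.ceil_lt_add_one (show 0 ≤ 4 * L / η by positivity)).le
    have h2 : 1 ≤ L / η := by rw [le_div_iff₀ hη]; linarith
    calc _ ≤ 4 * L / η + 1 := h1
      _ ≤ 4 * L / η + L / η := by linarith
      _ = _ := by ring

/-- The total discretization error of the geometric schedule. -/
lemma steps_mul_error_le {K : ℕ} {D s δ ε L η S : ℝ} (hD : 1 ≤ D) (hs : 1 ≤ s) (hss : s ^ 2 = D)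
    (hδ : 0 < δ) (hε : 0 < ε) (hL : 1 ≤ L)
    (hη : η = ε * δ / (2 ^ 14 * (D * s * L))) (hK : (K : ℝ) ≤ 5 * L / η) (hS : δ ≤ S) :
    K * (η ^ 3 * D ^ 3 / S ^ 2 + η ^ 4 * D ^ 4 / S ^ 4) ≤
      5 * (ε ^ 2 + ε ^ 3 * (D ^ 2 * s) / δ) := by
  have hη0 : 0 < η := by rw [hη]; positivity
  have h1 : L * η ^ 2 * D ^ 3 / δ ^ 2 ≤ ε ^ 2 := by
    have : L * η ^ 2 * D ^ 3 / δ ^ 2 = ε ^ 2 * (1 / (2 ^ 28 * L)) := by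
      rw [hη, ← hss]; field_simp
    rw [this]
    refine mul_le_of_le_one_right (by positivity) ?_
    rw [div_le_one (by positivity)]
    linarith
  have h2 : L * η ^ 3 * D ^ 4 / δ ^ 4 ≤ ε ^ 3 * (D ^ 2 * s) / δ := by
    have : L * η ^ 3 * D ^ 4 / δ ^ 4 = ε ^ 3 * (1 / (2 ^ 42 * (s * L ^ 2))) / δ := by
      rw [hη, ← hss]; field_simp
    rw [this]
    have h3 : 1 / (2 ^ 42 * (s * L ^ 2)) ≤ 1 := by
      rw [div_le_one (by positivity)]
      nlinarith [one_le_mul_of_one_le_of_one_le hs (one_le_pow₀ hL (n := 2))]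
    have h4 : 1 ≤ D ^ 2 * s := one_le_mul_of_one_le_of_one_le (one_le_pow₀ hD) hs
    gcongr
    exact h3.trans h4
  calc K * (η ^ 3 * D ^ 3 / S ^ 2 + η ^ 4 * D ^ 4 / S ^ 4)
      ≤ 5 * L / η * (η ^ 3 * D ^ 3 / δ ^ 2 + η ^ 4 * D ^ 4 / δ ^ 4) := by gcongr
    _ = 5 * (L * η ^ 2 * D ^ 3 / δ ^ 2 + L * η ^ 3 * D ^ 4 / δ ^ 4) := by field_simp
    _ ≤ _ := by gcongr

/-- A one-step inequality `KL (k+1) ≤ KL k + r k` sums up. -/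
lemma le_add_sum_ofReal {x : ℕ → ℝ≥0∞} {r : ℕ → ℝ} {a : ℝ} (ha : 0 ≤ a) (hr : ∀ k, 0 ≤ r k)
    {K : ℕ} (h0 : x 0 ≤ ENNReal.ofReal a)
    (h : ∀ k < K, x (k + 1) ≤ x k + ENNReal.ofReal (r k)) {k : ℕ} (hk : k ≤ K) :
    x k ≤ ENNReal.ofReal (a + ∑ j ∈ Finset.range k, r j) := by
  induction k with
  | zero => simpa using h0
  | succ k ih =>
    rw [Finset.sum_range_succ, ← add_assoc,
      ENNReal.ofReal_add (add_nonneg ha (Finset.sum_nonneg fun _ _ => hr _)) (hr k)]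
    refine (h k hk).trans ?_
    gcongr
    exact ih (by omega)

end Helpers

/-- **Corollary (iteration complexity).** For any early-stopping point δ ∈ (0, 1/2) and accuracy
level ε in the stated range, there is a choice of time horizon T, of discretization points
0 = t_0 < ⋯ < t_K = T - δ, and of step-size proxy κ, with the stated bound on the number of
steps K (up to a polylogarithmic factor in d, 1/ε, 1/δ), such that whenever the score estimates
satisfy the score-estimation assumption with errors ε_k, the sampler output satisfies
KL(q_δ ‖ p_output) ≤ C (ε² + ε³ d^{5/2} δ⁻¹ + Σ_k d^{1/2} ε_k^{1/2}). -/
theorem stochastic_runge_kutta_complexity_small_eps :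
    ∃ C > (0:ℝ),
    ∀ (d : ℕ), 1 ≤ d →
    ∀ (q0 : Measure (Vec d)), IsProbabilityMeasure q0 →
    (∀ᵐ y ∂q0, ‖y‖ ≤ Real.sqrt d) →
    ∀ (ρ : ℝ → Vec d → ℝ),
    (∀ u, 0 < u → forwardLaw q0 u = volume.withDensity fun x => ENNReal.ofReal (ρ u x)) →
    (∀ u, 0 < u → ∀ x, 0 < ρ u x) →
    (∀ u, 0 < u → ContDiff ℝ (⊤ : ℕ∞) (ρ u)) →
    ∀ (δ : ℝ), 0 < δ → δ < 1/2 →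
    ∀ (ε : ℝ), 0 < ε → ε ≤ 1 / Real.sqrt d →
    ∃ (T : ℝ) (K : ℕ) (t : ℕ → ℝ) (κ : ℝ),
      0 < T ∧ t 0 = 0 ∧ (∀ k < K, t k < t (k+1)) ∧ t K = T - δ ∧ 0 < κ ∧
      -- number of steps, up to a polylogarithmic factor
      (K : ℝ) ≤ C * ((d:ℝ) * Real.sqrt d) / (ε * δ)
          * (1 + Real.log (1/δ) + Real.log d + Real.log (1/ε))^2 ∧
      -- score-estimation assumption ⇒ KL guarantee
      (∀ (sHat : ℕ → Vec d → Vec d), (∀ k, Measurable (sHat k)) →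
        ∀ (εk : ℕ → ℝ), (∀ k, 0 ≤ εk k) →
        (∀ k < K, ∀ a ∈ Set.Icc (1 - 3.1 * Real.sqrt ((t (k+1) - t k) * κ))
                                (1 + 3.1 * Real.sqrt ((t (k+1) - t k) * κ)),
          ∀ b ∈ Set.Icc (0:ℝ) (3.5 * Real.sqrt (t (k+1) - t k)),
          ∫ p : Vec d × Vec d,
              ‖sHat k (a • p.1 + b • p.2) - score ρ T (t k) (a • p.1 + b • p.2)‖^2
            ∂((forwardLaw q0 (T - t (k+1))).prod (stdGaussian d)) ≤ (εk k)^2) →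
        (∀ k < K, ∀ y : Vec d,
          (1 - Real.exp (-2*(T - t k))) / Real.exp (-(T - t k)) * ‖sHat k y - score ρ T (t k) y‖
            ≤ 2 * Real.sqrt d) →
        klDiv' (forwardLaw q0 δ)
            (samplerLaw (stdGaussian d) (fun k => rkStep (t (k+1) - t k) (sHat k)) K)
          ≤ C * (ε^2 + ε^3 * ((d:ℝ)^2 * Real.sqrt d) / δ
              + ∑ k ∈ Finset.range K, Real.sqrt d * Real.sqrt (εk k))) := by
  obtain ⟨C, hC, hstep⟩ := exists_klDiv_rkStep_le_of_score
  refine ⟨5 * 2 ^ 14 + 5 * C, by positivity, ?_⟩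
  intro d hd q0 hq0 hq ρ hρ hρpos hρsmooth δ hδ hδ1 ε hε hεd
  have hd1 : (1 : ℝ) ≤ d := by exact_mod_cast hd
  have hs1 : 1 ≤ √(d : ℝ) := Real.one_le_sqrt.2 hd1
  have hss : √(d : ℝ) ^ 2 = d := Real.sq_sqrt (by positivity)
  have hε1 : ε ≤ 1 := hεd.trans ((div_le_one (by positivity)).2 hs1)
  obtain ⟨L, hLdef⟩ : ∃ L, L = 1 + Real.log (1 / δ) + Real.log d + Real.log (1 / ε) := ⟨_, rfl⟩
  have hlδ : 0 ≤ Real.log (1 / δ) := Real.log_nonneg (by rw [le_div_iff₀ hδ]; linarith)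
  have hld : 0 ≤ Real.log d := Real.log_nonneg hd1
  have hlε : 0 ≤ Real.log (1 / ε) := Real.log_nonneg (by rw [le_div_iff₀ hε]; linarith)
  have hL : 1 ≤ L := by linarith
  rw [← hLdef]
  obtain ⟨η, hη⟩ : ∃ η, η = ε * δ / (2 ^ 14 * (d * √(d : ℝ) * L)) := ⟨_, rfl⟩
  have hη0 : 0 < η := by rw [hη]; positivity
  have hηd : η * d / δ ≤ 1 / 2 ^ 14 := by
    have : η * d / δ = ε * (1 / (√(d : ℝ) * L)) * (1 / 2 ^ 14) := by rw [hη]; field_simp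
    rw [this]
    refine mul_le_of_le_one_left (by positivity) (mul_le_one₀ hε1 (by positivity) ?_)
    exact (div_le_one (by positivity)).2 (one_le_mul_of_one_le_of_one_le hs1 hL)
  have hη1 : η ≤ 1 / 100 := by
    rw [div_le_iff₀ hδ] at hηd
    nlinarith
  have hlog : Real.log (4 * d / ε / δ) ≤ 2 * L := by
    have h4 : Real.log 4 ≤ 2 := by
      rw [show (4 : ℝ) = 2 ^ 2 by norm_num, Real.log_pow]
      push_cast
      linarith [Real.log_two_lt_d9]
    have : 4 * d / ε / δ = 4 * d * (1 / ε) * (1 / δ) := by field_simp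
    rw [this, Real.log_mul (by positivity) (by positivity), Real.log_mul (by positivity)
      (by positivity), Real.log_mul (by positivity) (by positivity)]
    linarith
  obtain ⟨K, hKy, hK⟩ := exists_steps hδ hη0 (by linarith) hL (by positivity) hlog
  have hu (k : ℕ) : δ ≤ remTime δ η K k := le_remTime hδ hη0.le k
  refine ⟨remTime δ η K 0, K, fun k => remTime δ η K 0 - remTime δ η K k, 1,
    hδ.trans_le (hu 0), sub_self _, fun k hk => sub_lt_sub_left (remTime_succ_lt hδ hη0 hk) _,
    by simp only [remTime_last], one_pos, ?_, ?_⟩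
  · calc (K : ℝ) ≤ 5 * L / η := hK
      _ = 5 * 2 ^ 14 * (d * √(d : ℝ)) / (ε * δ) * L ^ 2 := by rw [hη]; field_simp
      _ ≤ _ := by
        gcongr
        linarith
  intro sHat hsHat εk hεk hscore hbound
  simp only [sub_sub_cancel, sub_sub_sub_cancel_left, mul_one, score] at hscore hbound ⊢
  have hmeas (k : ℕ) := measurable_rkStep (remTime δ η K k - remTime δ η K (k + 1)) (hsHat k)
  have hprob (k : ℕ) := isProbabilityMeasure_samplerLaw (_root_.stdGaussian d)
    (step := fun k => rkStep (remTime δ η K k - remTime δ η K (k + 1)) (sHat k)) hmeas k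
  have hkl := le_add_sum_ofReal (K := K) (a := 2 * ε ^ 2)
    (x := fun k => InformationTheory.klDiv (forwardLaw q0 (remTime δ η K k))
      (samplerLaw (_root_.stdGaussian d)
        (fun k => rkStep (remTime δ η K k - remTime δ η K (k + 1)) (sHat k)) k))
    (r := fun k => C * (η ^ 3 * d ^ 3 / δ ^ 2 + η ^ 4 * d ^ 4 / δ ^ 4 + √d * √(εk k)))
    (by positivity) (fun k => by positivity)
    (klDiv_forwardLaw_remTime_zero_le hd hq hδ hη0.le hε hε1 hKy)
    (fun k hk => by
      have hk0 := hδ.trans_le (hu k)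
      have hS := le_one_sub_exp hδ hδ1 (hu k)
      have hS' : η * d / (1 - Real.exp (-2 * remTime δ η K k)) ≤ 1 / 2 ^ 14 := by
        refine le_trans ?_ hηd
        gcongr
      have := hprob k
      refine (hstep d hd q0 (samplerLaw (_root_.stdGaussian d) _ k) (ρ (remTime δ η K k)) (sHat k)
        (remTime δ η K k) (remTime δ η K (k + 1)) _ _ η (εk k) hq (hρ _ hk0) (hρpos _ hk0)
        (hρsmooth _ hk0).continuous (hsHat k) (hδ.trans_le (hu _)) (remTime_succ_lt hδ hη0 hk)
        rfl rfl (exp_remTime_sub_le hδ hη0 hk) hη0.le hη1 hS' (hεk k) (hscore k hk)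
        (hbound k hk)).trans ?_
      gcongr) le_rfl
  simp only [remTime_last] at hkl
  have := hprob K
  refine (klDiv'_le_of_klDiv_le (by positivity) hkl).trans ?_
  have htot := steps_mul_error_le hd1 hs1 hss hδ hε hL hη hK le_rfl
  rw [← Finset.mul_sum, Finset.sum_add_distrib, Finset.sum_const, Finset.card_range, nsmul_eq_mul]
  have hsum : 0 ≤ ∑ k ∈ Finset.range K, √d * √(εk k) :=
    Finset.sum_nonneg fun _ _ => by positivity
  have hnn : 0 ≤ ε ^ 3 * ((d : ℝ) ^ 2 * √d) / δ := by positivity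
  have := mul_le_mul_of_nonneg_left htot hC.le
  nlinarith [sq_nonneg ε, mul_nonneg hC.le hsum]

end
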